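/- Let Ω ⊆ ℝⁿ be a connected open set, let f : Ω → ℝ be measurable with 0 < λ ≤ f ≤ Λ for constants λ ≤ Λ, and let u ≥ v be convex functions on Ω such that Mu(E) = Mv(E) = ∫_E f(x) dx for every Borel set E ⊆ Ω. If u is not identically equal to v on Ω, then every point x ∈ Ω with u(x) = v(x) belongs to Σ_u ∩ Σ_v. -/

import Mathlib

open MeasureTheory Set
open scoped RealInnerProductSpace ENNReal

noncomputable section

abbrev En (n : ℕ) := EuclideanSpace ℝ (Fin n)

/-- The subgradient of `u` (as a convex function on `Ω`) at `x`. -/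
def subgrad {n : ℕ} (Ω : Set (En n)) (u : En n → ℝ) (x : En n) : Set (En n) :=
  {p | ∀ y ∈ Ω, u x + ⟪p, y - x⟫ ≤ u y}

/-- The Monge–Ampère measure of `u` on a set `s`. -/
def MAm {n : ℕ} (Ω : Set (En n)) (u : En n → ℝ) (s : Set (En n)) : ℝ≥0∞ :=
  volume (⋃ x ∈ s, subgrad Ω u x)

/-- `x₀` is a strictly convex point of `u` on `Ω`. -/
def IsStrictConvexPt {n : ℕ} (Ω : Set (En n)) (u : En n → ℝ) (x₀ : En n) : Prop :=
  ∀ x ∈ Ω, x ≠ x₀ → u ((1/2 : ℝ) • (x + x₀)) < (u x + u x₀) / 2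

/-- `Σ_u`: the set of non-strictly convex points of `u` in `Ω`. -/
def SigmaSet {n : ℕ} (Ω : Set (En n)) (u : En n → ℝ) : Set (En n) :=
  {x ∈ Ω | ¬ IsStrictConvexPt Ω u x}

section Subdifferential

variable {E : Type*} [NormedAddCommGroup E] [InnerProductSpace ℝ E]

/-- The subdifferential at `x` of a function defined on the whole space. -/
def sd (ψ : E → ℝ) (x : E) : Set E := {p | ∀ y, ψ x + ⟪p, y - x⟫ ≤ ψ y}

lemma sd_monotone {ψ : E → ℝ} {x y p q : E} (hp : p ∈ sd ψ x) (hq : q ∈ sd ψ y) :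
    0 ≤ ⟪p - q, x - y⟫ := by
  have h1 := hp y
  have h2 := hq x
  have : ⟪p, y - x⟫ = - ⟪p, x - y⟫ := by rw [← inner_neg_right, neg_sub]
  rw [inner_sub_left]
  linarith

lemma norm_le_of_mem_sd {ψ : E → ℝ} {R : NNReal} (hR : LipschitzWith R ψ) {x p : E}
    (hp : p ∈ sd ψ x) : ‖p‖ ≤ R := by
  have h1 := hp (x + p)
  have h2 := hR.dist_le_mul (x + p) x
  rw [Real.dist_eq, dist_eq_norm] at h2
  simp only [add_sub_cancel_left, real_inner_self_eq_norm_sq] at h1 h2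
  have h3 := le_trans (le_abs_self _) h2
  by_contra! h
  have : 0 < ‖p‖ := lt_of_le_of_lt R.2 h
  nlinarith

lemma isClosed_graph_sd {ψ : E → ℝ} (hψ : Continuous ψ) :
    IsClosed {z : E × E | z.2 ∈ sd ψ z.1} := by
  have : {z : E × E | z.2 ∈ sd ψ z.1} = ⋂ y, {z : E × E | ψ z.1 + ⟪z.2, y - z.1⟫ ≤ ψ y} := by
    ext z; simp [sd]
  rw [this]
  refine isClosed_iInter fun y => isClosed_le ?_ continuous_const
  fun_prop

lemma mem_sd_of_tendsto {ψ : E → ℝ} (hψ : Continuous ψ) {ι : Type*} {l : Filter ι} [l.NeBot]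
    {x p : ι → E} {x₀ p₀ : E} (hx : Filter.Tendsto x l (nhds x₀))
    (hp : Filter.Tendsto p l (nhds p₀)) (h : ∀ᶠ i in l, p i ∈ sd ψ (x i)) : p₀ ∈ sd ψ x₀ :=
  (isClosed_graph_sd hψ).mem_of_tendsto (hx.prodMk_nhds hp) h

lemma mem_sd_of_eventually {ψ : E → ℝ} (hc : ConvexOn ℝ univ ψ) {x p : E}
    (h : ∀ᶠ y in nhds x, ψ x + ⟪p, y - x⟫ ≤ ψ y) : p ∈ sd ψ x := by
  have hconv : ConvexOn ℝ univ (fun y => ψ y - ⟪p, y⟫) := by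
    refine hc.sub ?_
    exact ((innerSL ℝ p).toLinearMap).concaveOn convex_univ
  have hmin : IsLocalMin (fun y => ψ y - ⟪p, y⟫) x := by
    filter_upwards [h] with y hy
    rw [inner_sub_right] at hy
    linarith
  have := IsMinOn.of_isLocalMin_of_convex_univ hmin hconv
  intro y
  have hy : ψ x - ⟪p, x⟫ ≤ ψ y - ⟪p, y⟫ := this y
  rw [inner_sub_right]
  linarith

lemma sd_smul {ψ : E → ℝ} {x p : E} {c : ℝ} (hc : 0 < c) (h : p ∈ sd (fun y => c * ψ y) x) :
    c⁻¹ • p ∈ sd ψ x := by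
  intro y
  have h1 := h y
  rw [inner_smul_left]
  simp only [conj_trivial]
  have : c * (ψ x + c⁻¹ * ⟪p, y - x⟫) ≤ c * ψ y := by
    rw [mul_add, ← mul_assoc, mul_inv_cancel₀ hc.ne', one_mul]; exact h1
  exact le_of_mul_le_mul_left this hc

lemma sub_mem_sd_of_prox {ψ : E → ℝ} (hc : ConvexOn ℝ univ ψ) {x y : E}
    (hx : ∀ z, ψ x + ‖x - y‖ ^ 2 / 2 ≤ ψ z + ‖z - y‖ ^ 2 / 2) : y - x ∈ sd ψ x := by
  intro z
  have key : ∀ t : ℝ, 0 < t → t ≤ 1 → ψ x + ⟪y - x, z - x⟫ ≤ ψ z + t * (‖z - x‖ ^ 2 / 2) := by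
    intro t ht ht1
    have h1 := hx ((1 - t) • x + t • z)
    have h2 := hc.2 (mem_univ x) (mem_univ z) (sub_nonneg.2 ht1) ht.le (by ring)
    have h3 : (1 - t) • x + t • z - y = t • (z - x) - (y - x) := by module
    rw [h3, norm_sub_sq_real (t • (z - x)), norm_smul, inner_smul_left] at h1
    simp only [conj_trivial, smul_eq_mul, Real.norm_eq_abs, mul_pow, sq_abs] at h1 h2
    rw [real_inner_comm, norm_sub_rev y x] at h1
    have : t * (ψ x + ⟪y - x, z - x⟫) ≤ t * (ψ z + t * (‖z - x‖ ^ 2 / 2)) := by nlinarith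
    exact le_of_mul_le_mul_left this ht
  have hlim : Filter.Tendsto (fun t : ℝ => ψ z + t * (‖z - x‖ ^ 2 / 2))
      (nhdsWithin 0 (Ioi 0)) (nhds (ψ z + 0 * (‖z - x‖ ^ 2 / 2))) := by
    apply Filter.Tendsto.mono_left _ nhdsWithin_le_nhds
    apply Continuous.tendsto
    fun_prop
  rw [zero_mul, add_zero] at hlim
  refine ge_of_tendsto hlim ?_
  filter_upwards [Ioc_mem_nhdsGT (show (0:ℝ) < 1 by norm_num)] with t ht
  exact key t ht.1 ht.2

variable [FiniteDimensional ℝ E]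

lemma exists_prox {ψ : E → ℝ} {R : NNReal} (hR : LipschitzWith R ψ) (y : E) :
    ∃ x, ∀ z, ψ x + ‖x - y‖ ^ 2 / 2 ≤ ψ z + ‖z - y‖ ^ 2 / 2 := by
  have hcont : Continuous fun x => ψ x + ‖x - y‖ ^ 2 / 2 := by
    have := hR.continuous
    fun_prop
  refine hcont.exists_forall_le_of_isBounded y ?_
  refine (Metric.isBounded_closedBall (x := y) (r := 2 * R)).subset ?_
  intro x hx
  simp only [mem_ofPred_eq, sub_self, norm_zero] at hx
  have h2 := hR.dist_le_mul y x
  rw [Real.dist_eq, dist_comm, dist_eq_norm] at h2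
  have h3 := le_trans (le_abs_self _) h2
  rw [Metric.mem_closedBall, dist_eq_norm]
  by_contra! h
  have : 0 < ‖x - y‖ := lt_of_le_of_lt (by positivity) h
  nlinarith

lemma sd_nonempty {ψ : E → ℝ} {R : NNReal} (hc : ConvexOn ℝ univ ψ) (hR : LipschitzWith R ψ)
    (x : E) : (sd ψ x).Nonempty := by
  have hstep : ∀ k : ℕ, ∃ z p : E, p ∈ sd ψ z ∧ ‖z - x‖ ≤ R * (1 / ((k : ℝ) + 1)) := by
    intro k
    set ε : ℝ := 1 / ((k : ℝ) + 1) with hε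
    have hε0 : 0 < ε := by positivity
    have hL : LipschitzWith (ε.toNNReal * R) (fun y => ε * ψ y) := by
      refine LipschitzWith.of_dist_le_mul fun a b => ?_
      have := hR.dist_le_mul a b
      rw [Real.dist_eq] at this ⊢
      rw [← mul_sub, abs_mul, abs_of_pos hε0]
      rw [NNReal.coe_mul, Real.coe_toNNReal _ hε0.le, mul_assoc]
      exact mul_le_mul_of_nonneg_left this hε0.le
    obtain ⟨z, hz⟩ := exists_prox hL x
    have h1 := sub_mem_sd_of_prox (hc.smul hε0.le) hz
    have h2 := sd_smul hε0 h1
    refine ⟨z, _, h2, ?_⟩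
    have h3 := norm_le_of_mem_sd hR h2
    rw [norm_smul, norm_inv, Real.norm_eq_abs, abs_of_pos hε0, inv_mul_le_iff₀ hε0] at h3
    rw [norm_sub_rev]; linarith
  choose z p hp hz using hstep
  have hzlim : Filter.Tendsto z Filter.atTop (nhds x) := by
    rw [tendsto_iff_norm_sub_tendsto_zero]
    refine squeeze_zero (fun _ => norm_nonneg _) hz ?_
    simpa using tendsto_one_div_add_atTop_nhds_zero_nat.const_mul (R : ℝ)
  have hpb : ∀ k, p k ∈ Metric.closedBall (0 : E) R := fun k => by
    simpa using norm_le_of_mem_sd hR (hp k)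
  obtain ⟨q, -, φ, hφ, hq⟩ := (isCompact_closedBall (0 : E) (R : ℝ)).tendsto_subseq hpb
  exact ⟨q, mem_sd_of_tendsto hR.continuous (hzlim.comp hφ.tendsto_atTop) hq
    (Filter.Eventually.of_forall fun k => hp _)⟩

lemma isCompact_iUnion_sd {ψ : E → ℝ} {R : NNReal} (hR : LipschitzWith R ψ) {K : Set E}
    (hK : IsCompact K) : IsCompact (⋃ x ∈ K, sd ψ x) := by
  have h1 : IsCompact ((K ×ˢ Metric.closedBall (0 : E) R) ∩ {z : E × E | z.2 ∈ sd ψ z.1}) :=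
    (hK.prod (isCompact_closedBall _ _)).inter_right (isClosed_graph_sd hR.continuous)
  convert h1.image continuous_snd using 1
  ext p
  simp only [mem_iUnion, mem_image, mem_inter_iff, mem_prod, mem_ofPred_eq, Prod.exists,
    exists_eq_right, exists_prop]
  constructor
  · rintro ⟨x, hx, hp⟩
    exact ⟨x, ⟨hx, by simpa using norm_le_of_mem_sd hR hp⟩, hp⟩
  · rintro ⟨x, ⟨hx, -⟩, hp⟩
    exact ⟨x, hx, hp⟩

open Classical in
/-- The proximal map of `ψ`. -/
def prox (ψ : E → ℝ) (y : E) : E :=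
  if h : ∃ x, ∀ z, ψ x + ‖x - y‖ ^ 2 / 2 ≤ ψ z + ‖z - y‖ ^ 2 / 2 then h.choose else 0

variable {ψ : E → ℝ} {R : NNReal}

lemma prox_spec (hR : LipschitzWith R ψ) (y z : E) :
    ψ (prox ψ y) + ‖prox ψ y - y‖ ^ 2 / 2 ≤ ψ z + ‖z - y‖ ^ 2 / 2 := by
  unfold prox
  rw [dif_pos (exists_prox hR y)]
  exact (exists_prox hR y).choose_spec z

lemma sub_prox_mem_sd (hc : ConvexOn ℝ univ ψ) (hR : LipschitzWith R ψ) (y : E) :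
    y - prox ψ y ∈ sd ψ (prox ψ y) := sub_mem_sd_of_prox hc (prox_spec hR y)

lemma prox_add_eq (hc : ConvexOn ℝ univ ψ) (hR : LipschitzWith R ψ) {x p : E} (hp : p ∈ sd ψ x) :
    prox ψ (x + p) = x := by
  have h := sd_monotone hp (sub_prox_mem_sd hc hR (x + p))
  have h2 : p - (x + p - prox ψ (x + p)) = - (x - prox ψ (x + p)) := by abel
  rw [h2, inner_neg_left, real_inner_self_eq_norm_sq] at h
  have : ‖x - prox ψ (x + p)‖ = 0 := by
    have := norm_nonneg (x - prox ψ (x + p)); nlinarith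
  exact (sub_eq_zero.1 (norm_eq_zero.1 this)).symm

lemma prox_firm (hc : ConvexOn ℝ univ ψ) (hR : LipschitzWith R ψ) (y z : E) :
    ‖prox ψ y - prox ψ z‖ ^ 2 ≤ ⟪y - z, prox ψ y - prox ψ z⟫ := by
  have h := sd_monotone (sub_prox_mem_sd hc hR y) (sub_prox_mem_sd hc hR z)
  have h2 : y - prox ψ y - (z - prox ψ z) = (y - z) - (prox ψ y - prox ψ z) := by abel
  rw [h2, inner_sub_left, real_inner_self_eq_norm_sq] at h
  linarith

lemma lipschitz_prox (hc : ConvexOn ℝ univ ψ) (hR : LipschitzWith R ψ) :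
    LipschitzWith 1 (prox ψ) := by
  refine LipschitzWith.of_dist_le_mul fun y z => ?_
  rw [dist_eq_norm, dist_eq_norm, NNReal.coe_one, one_mul]
  have h := (prox_firm hc hR y z).trans (real_inner_le_norm _ _)
  by_contra! hlt
  have := norm_nonneg (y - z)
  nlinarith

/-- The Legendre transform of `ψ + ‖·‖² / 2`. -/
def conj (ψ : E → ℝ) (y : E) : ℝ := ⟪y, prox ψ y⟫ - ψ (prox ψ y) - ‖prox ψ y‖ ^ 2 / 2

lemma le_conj (hR : LipschitzWith R ψ) (y x : E) : ⟪y, x⟫ - ψ x - ‖x‖ ^ 2 / 2 ≤ conj ψ y := by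
  have h := prox_spec hR y x
  rw [norm_sub_sq_real, norm_sub_sq_real, real_inner_comm, real_inner_comm y x] at h
  unfold conj
  linarith

lemma conj_add_le (hR : LipschitzWith R ψ) (y z : E) :
    conj ψ y + ⟪prox ψ y, z - y⟫ ≤ conj ψ z := by
  have h := le_conj hR z (prox ψ y)
  rw [inner_sub_right, real_inner_comm, real_inner_comm y]
  unfold conj at *
  linarith

lemma hasFDerivAt_conj (hc : ConvexOn ℝ univ ψ) (hR : LipschitzWith R ψ) (y : E) :
    HasFDerivAt (conj ψ) (innerSL ℝ (prox ψ y)) y := by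
  have hb : ∀ z, ‖conj ψ z - conj ψ y - innerSL ℝ (prox ψ y) (z - y)‖ ≤ 1 * ‖z - y‖ ^ 2 := by
    intro z
    have h1 := conj_add_le hR y z
    have h2 := conj_add_le hR z y
    have h3 := (lipschitz_prox hc hR).dist_le_mul z y
    rw [dist_eq_norm, dist_eq_norm, NNReal.coe_one, one_mul] at h3
    have h4 : ⟪prox ψ z - prox ψ y, z - y⟫ ≤ ‖z - y‖ * ‖z - y‖ :=
      (real_inner_le_norm _ _).trans (mul_le_mul_of_nonneg_right h3 (norm_nonneg _))
    rw [inner_sub_left] at h4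
    have h5 : ⟪prox ψ z, y - z⟫ = - ⟪prox ψ z, z - y⟫ := by rw [← inner_neg_right, neg_sub]
    rw [innerSL_apply_apply, Real.norm_eq_abs, abs_of_nonneg (by linarith)]
    nlinarith
  rw [hasFDerivAt_iff_isLittleO]
  refine Asymptotics.IsBigO.trans_isLittleO (g := fun z => ‖z - y‖ ^ 2)
    (Asymptotics.IsBigO.of_bound 1 (Filter.Eventually.of_forall fun z => ?_)) ?_
  · simpa using hb z
  · have := (Asymptotics.isLittleO_pow_sub_sub y (m := 2) (by norm_num))
    exact this

end Subdifferential

section Alexandrov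

variable {E : Type*} [NormedAddCommGroup E] [InnerProductSpace ℝ E]

/-- Symmetric and positive semidefinite operators. -/
def IsPSD (A : E →L[ℝ] E) : Prop := (∀ a b, ⟪A a, b⟫ = ⟪a, A b⟫) ∧ ∀ a, 0 ≤ ⟪A a, a⟫

/-- Differentiability of a set-valued map at a point. -/
def SubDiffAt (G : E → Set E) (x : E) (A : E →L[ℝ] E) : Prop :=
  ∀ ε > 0, ∀ᶠ x' in nhds x, ∀ p ∈ G x, ∀ p' ∈ G x', ‖p' - p - A (x' - x)‖ ≤ ε * ‖x' - x‖

lemma SubDiffAt.hasFDerivAt {G : E → Set E} {x : E} {A : E →L[ℝ] E} (h : SubDiffAt G x A)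
    {g : E → E} (hg : ∀ y, g y ∈ G y) : HasFDerivAt g A x := by
  rw [hasFDerivAt_iff_isLittleO, Asymptotics.isLittleO_iff]
  intro ε hε
  filter_upwards [h ε hε] with y hy
  exact hy _ (hg x) _ (hg y)

lemma SubDiffAt.subsingleton {G : E → Set E} {x : E} {A : E →L[ℝ] E} (h : SubDiffAt G x A) :
    (G x).Subsingleton := by
  intro p hp q hq
  have := (h 1 one_pos).self_of_nhds q hq p hp
  simpa [sub_eq_zero] using this

variable [FiniteDimensional ℝ E] {ψ : E → ℝ} {R : NNReal}

lemma prox_fderiv_symm (hc : ConvexOn ℝ univ ψ) (hR : LipschitzWith R ψ) {y : E}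
    {T : E →L[ℝ] E} (hT : HasFDerivAt (prox ψ) T y) (a b : E) : ⟪T a, b⟫ = ⟪a, T b⟫ := by
  have h1 : HasFDerivAt (fun y => innerSL ℝ (prox ψ y)) ((innerSL ℝ).comp T) y :=
    (innerSL ℝ).hasFDerivAt.comp y hT
  have h2 := second_derivative_symmetric (fun y => hasFDerivAt_conj hc hR y) h1 a b
  simp only [ContinuousLinearMap.comp_apply] at h2
  rw [real_inner_comm (T b)]
  exact h2

lemma prox_fderiv_firm (hc : ConvexOn ℝ univ ψ) (hR : LipschitzWith R ψ) {y : E}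
    {T : E →L[ℝ] E} (hT : HasFDerivAt (prox ψ) T y) (a : E) : ‖T a‖ ^ 2 ≤ ⟪a, T a⟫ := by
  have h1 : Filter.Tendsto (fun t : ℝ => t⁻¹ • (prox ψ (y + t • a) - prox ψ y))
      (nhdsWithin 0 (Ioi 0)) (nhds (T a)) :=
    hT.hasLineDerivAt a |>.tendsto_slope_zero_right
  have h2 := (h1.norm.pow 2)
  have h3 := (tendsto_const_nhds (x := a)).inner (𝕜 := ℝ) h1
  refine le_of_tendsto_of_tendsto h2 h3 ?_
  filter_upwards [self_mem_nhdsWithin] with t ht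
  have ht : 0 < t := ht
  have := prox_firm hc hR (y + t • a) y
  rw [add_sub_cancel_left, inner_smul_left] at this
  simp only [conj_trivial] at this
  rw [norm_smul, inner_smul_right, mul_pow, norm_inv, Real.norm_eq_abs, abs_of_pos ht]
  calc _ ≤ (t⁻¹) ^ 2 * (t * ⟪a, prox ψ (y + t • a) - prox ψ y⟫) := by gcongr
    _ = _ := by field_simp

lemma prox_expand (hc : ConvexOn ℝ univ ψ) (hR : LipschitzWith R ψ) {y : E}
    {κ r : ℝ} (hr : 0 < r)
    (h : ∀ w, ‖w‖ ≤ r → κ * ‖w‖ ^ 2 ≤ ⟪prox ψ (y + w) - prox ψ y, w⟫) (y' : E)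
    (hy' : ‖prox ψ y' - prox ψ y‖ < κ * r) :
    ‖y' - y‖ ≤ r ∧ κ * ‖y' - y‖ ≤ ‖prox ψ y' - prox ψ y‖ := by
  have hle : ‖y' - y‖ ≤ r := by
    by_contra! hlt
    set L := ‖y' - y‖ with hL
    have hL0 : 0 < L := hr.trans hlt
    set w := (r / L) • (y' - y) with hw
    have hwn : ‖w‖ = r := by
      rw [hw, norm_smul, ← hL, Real.norm_eq_abs, abs_of_pos (by positivity)]
      field_simp
    have h1 := h w hwn.le
    have h2 := (sq_nonneg _).trans (prox_firm hc hR y' (y + w))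
    have h3 : y' - (y + w) = ((L - r) / r) • w := by
      rw [hw, smul_smul, ← sub_sub]
      have : (L - r) / r * (r / L) = 1 - r / L := by field_simp
      rw [this, sub_smul, one_smul]
    rw [h3, inner_smul_left] at h2
    have hpos : 0 < (L - r) / r := by apply div_pos <;> linarith
    have h4 : 0 ≤ ⟪w, prox ψ y' - prox ψ (y + w)⟫ := by
      by_contra! hneg
      exact absurd h2 (not_le.2 (mul_neg_of_pos_of_neg hpos hneg))
    have h5 : ⟪w, prox ψ y' - prox ψ (y + w)⟫ + ⟪prox ψ (y + w) - prox ψ y, w⟫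
        = ⟪prox ψ y' - prox ψ y, w⟫ := by
      rw [real_inner_comm, ← inner_add_left]; congr 1; abel
    have h6 := real_inner_le_norm (prox ψ y' - prox ψ y) w
    rw [hwn] at h6 h1
    nlinarith
  refine ⟨hle, ?_⟩
  have h1 := h (y' - y) hle
  rw [add_sub_cancel] at h1
  have h6 := real_inner_le_norm (prox ψ y' - prox ψ y) (y' - y)
  rcases eq_or_lt_of_le (norm_nonneg (y' - y)) with h0 | h0
  · rw [← h0]; simp
  · have : (κ * ‖y' - y‖) * ‖y' - y‖ ≤ ‖prox ψ y' - prox ψ y‖ * ‖y' - y‖ := by linarith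
    exact le_of_mul_le_mul_right this h0

lemma subDiffAt_of_prox (hc : ConvexOn ℝ univ ψ) (hR : LipschitzWith R ψ) {y : E}
    {T : E →L[ℝ] E} (hT : HasFDerivAt (prox ψ) T y) (hdet : T.det ≠ 0) :
    ∃ A : E →L[ℝ] E, IsPSD A ∧ SubDiffAt (sd ψ) (prox ψ y) A := by
  set S : E →L[ℝ] E := ((T.toContinuousLinearEquivOfDetNeZero hdet).symm : E →L[ℝ] E) with hS
  have hTS : ∀ a, T (S a) = a := fun a =>
    (T.toContinuousLinearEquivOfDetNeZero hdet).apply_symm_apply a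
  have hST : ∀ a, S (T a) = a := fun a =>
    (T.toContinuousLinearEquivOfDetNeZero hdet).symm_apply_apply a
  set A : E →L[ℝ] E := S - ContinuousLinearMap.id ℝ E with hA
  have hAa : ∀ a, A a = S a - a := fun a => by simp [hA]
  have hfirm := prox_fderiv_firm hc hR hT
  set κ : ℝ := 1 / (2 * (‖S‖ + 1) ^ 2) with hκ
  have hκ0 : 0 < κ := by positivity
  have hκT : ∀ a, 2 * κ * ‖a‖ ^ 2 ≤ ⟪a, T a⟫ := by
    intro a
    refine le_trans ?_ (hfirm a)
    have h1 : ‖a‖ ≤ (‖S‖ + 1) * ‖T a‖ := by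
      calc ‖a‖ = ‖S (T a)‖ := by rw [hST]
        _ ≤ ‖S‖ * ‖T a‖ := S.le_opNorm _
        _ ≤ _ := by gcongr; linarith
    have h2 : ‖a‖ ^ 2 ≤ ((‖S‖ + 1) * ‖T a‖) ^ 2 := by gcongr
    calc 2 * κ * ‖a‖ ^ 2 ≤ 2 * κ * ((‖S‖ + 1) * ‖T a‖) ^ 2 := by gcongr
      _ = ‖T a‖ ^ 2 := by rw [hκ]; field_simp
  have hsmall : ∀ ε > 0, ∃ r > 0, ∀ w, ‖w‖ ≤ r → ‖prox ψ (y + w) - prox ψ y - T w‖ ≤ ε * ‖w‖ := by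
    intro ε hε
    have := (hasFDerivAt_iff_isLittleO_nhds_zero.1 hT).def hε
    obtain ⟨r, hr, h⟩ := Metric.eventually_nhds_iff.1 this
    refine ⟨r / 2, by positivity, fun w hw => h ?_⟩
    rw [dist_zero_right]; linarith
  obtain ⟨r₀, hr₀, hr₀'⟩ := hsmall κ hκ0
  have hexp : ∀ w, ‖w‖ ≤ r₀ → κ * ‖w‖ ^ 2 ≤ ⟪prox ψ (y + w) - prox ψ y, w⟫ := by
    intro w hw
    have h1 := hr₀' w hw
    have h2 := hκT w
    have h3 : ⟪prox ψ (y + w) - prox ψ y, w⟫ = ⟪prox ψ (y + w) - prox ψ y - T w, w⟫ + ⟪w, T w⟫ := by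
      rw [inner_sub_left _ (T w), real_inner_comm w (T w)]; ring
    have h4 := abs_le.1 (abs_real_inner_le_norm (prox ψ (y + w) - prox ψ y - T w) w)
    have h5 : ‖prox ψ (y + w) - prox ψ y - T w‖ * ‖w‖ ≤ κ * ‖w‖ * ‖w‖ := by gcongr
    rw [h3]
    nlinarith [h4.1]
  refine ⟨A, ⟨?_, ?_⟩, ?_⟩
  · intro a b
    have h1 : ⟪S a, b⟫ = ⟪a, S b⟫ := by
      conv_lhs => rw [← hTS b]
      rw [← prox_fderiv_symm hc hR hT, hTS]
    rw [hAa, hAa, inner_sub_left, inner_sub_right, h1]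
  · intro a
    have h1 := hfirm (S a)
    rw [hTS] at h1
    rw [hAa, inner_sub_left, real_inner_self_eq_norm_sq]
    linarith
  · intro ε hε
    obtain ⟨r₁, hr₁, hr₁'⟩ := hsmall (ε * κ / (‖S‖ + 1)) (by positivity)
    set r := min r₀ r₁ with hr
    have hrpos : 0 < r := lt_min hr₀ hr₁
    have hexp' : ∀ w, ‖w‖ ≤ r → κ * ‖w‖ ^ 2 ≤ ⟪prox ψ (y + w) - prox ψ y, w⟫ :=
      fun w hw => hexp w (hw.trans (min_le_left _ _))
    have hunique : ∀ p ∈ sd ψ (prox ψ y), p = y - prox ψ y := by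
      intro p hp
      have h1 := prox_add_eq hc hR hp
      have h2 := (prox_expand hc hR hrpos hexp' (prox ψ y + p)
        (by rw [h1, sub_self, norm_zero]; positivity)).2
      rw [h1, sub_self, norm_zero] at h2
      have h3 : ‖prox ψ y + p - y‖ = 0 := by
        have := norm_nonneg (prox ψ y + p - y); nlinarith
      rw [eq_sub_iff_add_eq, add_comm]
      exact sub_eq_zero.1 (norm_eq_zero.1 h3)
    filter_upwards [Metric.ball_mem_nhds (prox ψ y) (show 0 < κ * r by positivity)] with x' hx'
    intro p hp p' hp'
    rw [Metric.mem_ball, dist_eq_norm] at hx'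
    have h1 := prox_add_eq hc hR hp'
    have h2 := prox_expand hc hR hrpos hexp' (x' + p') (by rw [h1]; exact hx')
    rw [h1] at h2
    have h3 := hr₁' (x' + p' - y) (h2.1.trans (min_le_right _ _))
    rw [add_sub_cancel, h1] at h3
    rw [hunique p hp]
    have h4 : p' - (y - prox ψ y) - A (x' - prox ψ y)
        = - S (x' - prox ψ y - T (x' + p' - y)) := by
      rw [hAa, map_sub S _ (T _), hST]; abel
    rw [h4, norm_neg]
    calc _ ≤ ‖S‖ * ‖x' - prox ψ y - T (x' + p' - y)‖ := S.le_opNorm _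
      _ ≤ (‖S‖ + 1) * (ε * κ / (‖S‖ + 1) * ‖x' + p' - y‖) := by gcongr; linarith
      _ = ε * (κ * ‖x' + p' - y‖) := by field_simp
      _ ≤ _ := by gcongr; exact h2.2

variable [MeasurableSpace E] [BorelSpace E]

lemma volume_image_eq_zero_of_lipschitz {K : NNReal} {g : E → E} (hg : LipschitzWith K g)
    {s : Set E} (hs : volume s = 0) : volume (g '' s) = 0 := by
  have h1 : (volume : Measure E) ≪ μH[Module.finrank ℝ E] :=
    Measure.absolutelyContinuous_isAddHaarMeasure _ _
  have h2 : (μH[Module.finrank ℝ E] : Measure E) ≪ volume :=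
    Measure.absolutelyContinuous_isAddHaarMeasure _ _
  refine h1 (le_antisymm ?_ zero_le)
  refine (hg.hausdorffMeasure_image_le (d := Module.finrank ℝ E) (by positivity) s).trans ?_
  rw [h2 hs, mul_zero]

theorem ae_subDiffAt (hc : ConvexOn ℝ univ ψ) (hR : LipschitzWith R ψ) :
    ∀ᵐ x : E, ∃ A : E →L[ℝ] E, IsPSD A ∧ SubDiffAt (sd ψ) x A := by
  set N₁ : Set E := {y | ¬ DifferentiableAt ℝ (prox ψ) y} with hN₁
  set N₂ : Set E := {y | DifferentiableAt ℝ (prox ψ) y ∧ (fderiv ℝ (prox ψ) y).det = 0} with hN₂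
  have h1 : volume (prox ψ '' N₁) = 0 :=
    volume_image_eq_zero_of_lipschitz (lipschitz_prox hc hR)
      (lipschitz_prox hc hR).ae_differentiableAt
  have h2 : volume (prox ψ '' N₂) = 0 :=
    addHaar_image_eq_zero_of_det_fderivWithin_eq_zero (f' := fderiv ℝ (prox ψ)) volume
      (fun y hy => hy.1.hasFDerivAt.hasFDerivWithinAt) (fun y hy => hy.2)
  have h3 : volume (prox ψ '' N₁ ∪ prox ψ '' N₂) = 0 := measure_union_null h1 h2
  rw [ae_iff]
  refine measure_mono_null ?_ h3
  intro x hx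
  by_contra hcon
  apply hx
  obtain ⟨p, hp⟩ := sd_nonempty hc hR x
  have hxp := prox_add_eq hc hR hp
  have hd : DifferentiableAt ℝ (prox ψ) (x + p) := by
    by_contra hd
    exact hcon (Or.inl ⟨x + p, hd, hxp⟩)
  have hdet : (fderiv ℝ (prox ψ) (x + p)).det ≠ 0 := by
    intro h0
    exact hcon (Or.inr ⟨x + p, ⟨hd, h0⟩, hxp⟩)
  have := subDiffAt_of_prox hc hR hd.hasFDerivAt hdet
  rwa [hxp] at this

end Alexandrov

section LinearAlgebra

variable {E : Type*} [NormedAddCommGroup E] [InnerProductSpace ℝ E]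

lemma det_eq_prod_of_diag {ι : Type*} [Fintype ι] [DecidableEq ι] (b : Module.Basis ι ℝ E)
    (d : ι → ℝ) (T : E →L[ℝ] E) (h : ∀ i, T (b i) = d i • b i) : T.det = ∏ i, d i := by
  have h1 : LinearMap.toMatrix b b (T : E →ₗ[ℝ] E) = Matrix.diagonal d := by
    ext i j
    rw [LinearMap.toMatrix_apply]
    simp only [ContinuousLinearMap.coe_coe, h, map_smul, Finsupp.smul_apply,
      Module.Basis.repr_self, Matrix.diagonal_apply, smul_eq_mul, Finsupp.single_apply]
    by_cases hij : i = j
    · subst hij; simp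
    · rw [if_neg hij, if_neg (Ne.symm hij), mul_zero]
  rw [ContinuousLinearMap.det, ← LinearMap.det_toMatrix b, h1, Matrix.det_diagonal]

lemma cld_comp (S T : E →L[ℝ] E) : (S.comp T).det = S.det * T.det := by
  simp [ContinuousLinearMap.det]

variable [FiniteDimensional ℝ E]

lemma IsPSD.exists_diag {A : E →L[ℝ] E} (hA : IsPSD A) :
    ∃ (b : OrthonormalBasis (Fin (Module.finrank ℝ E)) ℝ E)
      (a : Fin (Module.finrank ℝ E) → ℝ), (∀ i, 0 ≤ a i) ∧ ∀ i, A (b i) = a i • b i := by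
  have hs : (A : E →ₗ[ℝ] E).IsSymmetric := fun x y => hA.1 x y
  refine ⟨hs.eigenvectorBasis rfl, hs.eigenvalues rfl, fun i => ?_, fun i => ?_⟩
  · have h := hA.2 (hs.eigenvectorBasis rfl i)
    have h2 : A (hs.eigenvectorBasis rfl i) = hs.eigenvalues rfl i • hs.eigenvectorBasis rfl i :=
      hs.apply_eigenvectorBasis rfl i
    rw [h2, inner_smul_left, real_inner_self_eq_norm_sq] at h
    simpa using h
  · exact hs.apply_eigenvectorBasis rfl i

lemma IsPSD.det_nonneg {A : E →L[ℝ] E} (hA : IsPSD A) : 0 ≤ A.det := by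
  obtain ⟨b, a, ha, hb⟩ := hA.exists_diag
  rw [det_eq_prod_of_diag b.toBasis a A (by simpa using hb)]
  exact Finset.prod_nonneg fun i _ => ha i

lemma IsPSD.exists_sqrt {A : E →L[ℝ] E} (hA : IsPSD A) :
    ∃ S : E →L[ℝ] E, (∀ x y, ⟪S x, y⟫ = ⟪x, S y⟫) ∧ ∀ x, S (S x) = A x := by
  obtain ⟨b, a, ha, hb⟩ := hA.exists_diag
  set S₀ : E →ₗ[ℝ] E := b.toBasis.constr ℝ (fun i => √(a i) • b i) with hS₀
  have hSb : ∀ i, S₀ (b i) = √(a i) • b i := fun i => by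
    have := b.toBasis.constr_basis ℝ (fun i => √(a i) • b i) i
    rwa [OrthonormalBasis.coe_toBasis] at this
  refine ⟨LinearMap.toContinuousLinearMap S₀, ?_, ?_⟩
  · have h1 : (innerₗ E).comp S₀ = (innerₗ E).compl₂ S₀ := by
      refine b.toBasis.ext fun i => b.toBasis.ext fun j => ?_
      simp only [OrthonormalBasis.coe_toBasis, LinearMap.comp_apply, LinearMap.compl₂_apply, hSb,
        innerₗ_apply_apply, inner_smul_left, inner_smul_right, conj_trivial]
      by_cases hij : i = j
      · subst hij; rfl
      · rw [b.orthonormal.2 hij]; simp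
    intro x y
    exact congrFun (congrArg DFunLike.coe (congrFun (congrArg DFunLike.coe h1) x)) y
  · have h2 : S₀.comp S₀ = (A : E →ₗ[ℝ] E) := by
      refine b.toBasis.ext fun i => ?_
      simp only [OrthonormalBasis.coe_toBasis, LinearMap.comp_apply, hSb, map_smul, smul_smul,
        ContinuousLinearMap.coe_coe, hb, Real.mul_self_sqrt (ha i)]
    intro x
    exact congrFun (congrArg DFunLike.coe h2) x

lemma exists_inv_of_det_ne_zero {T : E →L[ℝ] E} (h : T.det ≠ 0) :
    ∃ S : E →L[ℝ] E, (∀ x, T (S x) = x) ∧ (∀ x, S (T x) = x) ∧ S.det = T.det⁻¹ := by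
  set S : E →L[ℝ] E := ((T.toContinuousLinearEquivOfDetNeZero h).symm : E →L[ℝ] E) with hS
  have h1 : ∀ x, T (S x) = x := fun a =>
    (T.toContinuousLinearEquivOfDetNeZero h).apply_symm_apply a
  refine ⟨S, h1, fun a => (T.toContinuousLinearEquivOfDetNeZero h).symm_apply_apply a, ?_⟩
  have h2 : T.comp S = ContinuousLinearMap.id ℝ E := by ext x; simp [h1]
  have h3 := cld_comp T S
  rw [h2] at h3
  have h4 : (ContinuousLinearMap.id ℝ E).det = 1 := by simp [ContinuousLinearMap.det]
  rw [h4] at h3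
  exact eq_inv_of_mul_eq_one_right h3.symm

/-- A form of log-concavity of the determinant. -/
lemma det_le_of_convex_comb {A B D : E →L[ℝ] E} (hA : IsPSD A) (hB : IsPSD B) (hD : IsPSD D)
    {c : ℝ} (hc : 0 < c) (h : ∀ x, (1 + c) • A x = c • D x + B x) (hdet : A.det = B.det)
    (hpos : 0 < A.det) : D.det ≤ A.det := by
  obtain ⟨S, hSs, hSA⟩ := hA.exists_sqrt
  have hSdet : S.det * S.det = A.det := by
    rw [← cld_comp]; congr 1; ext x; exact hSA x
  have hS0 : S.det ≠ 0 := by rintro h0; rw [h0] at hSdet; simp at hSdet; linarith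
  obtain ⟨V, hSV, hVS, hVdet⟩ := exists_inv_of_det_ne_zero hS0
  have hVs : ∀ x y, ⟪V x, y⟫ = ⟪x, V y⟫ := by
    intro x y
    conv_lhs => rw [← hSV y]
    rw [← hSs, hSV]
  have key : ∀ T : E →L[ℝ] E, IsPSD T → IsPSD (V.comp (T.comp V)) := by
    intro T hT
    refine ⟨fun x y => ?_, fun x => ?_⟩
    · simp only [ContinuousLinearMap.comp_apply]; rw [hVs, hT.1, hVs]
    · simp only [ContinuousLinearMap.comp_apply]; rw [hVs]; exact hT.2 _
  obtain ⟨b, β, hβ, hb⟩ := (key B hB).exists_diag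
  have hVdetsq : V.det * V.det = A.det⁻¹ := by rw [hVdet, ← hSdet, mul_inv]
  have hβprod : ∏ i, β i = 1 := by
    rw [← det_eq_prod_of_diag b.toBasis β (V.comp (B.comp V))
      (by rw [OrthonormalBasis.coe_toBasis]; exact hb), cld_comp, cld_comp, ← hdet]
    rw [show V.det * (A.det * V.det) = (V.det * V.det) * A.det by ring, hVdetsq,
      inv_mul_cancel₀ hpos.ne']
  have hDb : ∀ i, (V.comp (D.comp V)) (b i) = ((1 + c - β i) / c) • b i := by
    intro i
    have h1 := congrArg V (h (V (b i)))
    have h2 := hb i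
    simp only [ContinuousLinearMap.comp_apply] at h2 ⊢
    rw [map_add, map_smul, map_smul, h2, ← hSA, hVS, hSV] at h1
    have h3 : c • V (D (V (b i))) = (1 + c - β i) • b i := by
      rw [sub_smul, h1]; abel
    rw [div_eq_inv_mul, mul_smul, ← h3, smul_smul, inv_mul_cancel₀ hc.ne', one_smul]
  have hd0 : ∀ i, 0 ≤ (1 + c - β i) / c := by
    intro i
    have h1 := (key D hD).2 (b i)
    rw [hDb, inner_smul_left, real_inner_self_eq_norm_sq] at h1
    simpa using h1
  have hDdet : D.det * A.det⁻¹ = ∏ i, (1 + c - β i) / c := by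
    rw [← det_eq_prod_of_diag b.toBasis _ (V.comp (D.comp V))
      (by rw [OrthonormalBasis.coe_toBasis]; exact hDb), cld_comp, cld_comp, ← hVdetsq]
    ring
  have hsum : (0 : ℝ) ≤ ∑ i, (β i - 1) := by
    have h1 : ∏ i, β i ≤ ∏ i, Real.exp (β i - 1) :=
      Finset.prod_le_prod (fun i _ => hβ i) fun i _ => by
        have := Real.add_one_le_exp (β i - 1); linarith
    rw [hβprod, ← Real.exp_sum] at h1
    exact Real.one_le_exp_iff.1 h1
  have hle : ∏ i, (1 + c - β i) / c ≤ 1 := by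
    have h1 : ∏ i, (1 + c - β i) / c ≤ ∏ i, Real.exp (-(1/c) * (β i - 1)) :=
      Finset.prod_le_prod (fun i _ => hd0 i) fun i _ => by
        have := Real.add_one_le_exp (-(1/c) * (β i - 1))
        refine le_trans (le_of_eq ?_) this
        field_simp; ring
    rw [← Real.exp_sum, ← Finset.mul_sum] at h1
    refine h1.trans (Real.exp_le_one_iff.2 ?_)
    exact mul_nonpos_of_nonpos_of_nonneg (by simp [hc.le]) hsum
  rw [← hDdet] at hle
  rwa [← div_eq_mul_inv, div_le_one hpos] at hle

end LinearAlgebra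

section Regularity

variable {E : Type*} [NormedAddCommGroup E] [InnerProductSpace ℝ E]

/-- The support-type function of `h` over `Q`. -/
def omega (Q : Set E) (h : E → ℝ) (p : E) : ℝ := sSup ((fun z => ⟪p, z⟫ - h z) '' Q)

lemma omega_bddAbove {Q : Set E} (hQ : IsCompact Q) {h : E → ℝ} (hh : Continuous h) (p : E) :
    BddAbove ((fun z => ⟪p, z⟫ - h z) '' Q) :=
  (hQ.image (by fun_prop)).bddAbove

lemma le_omega {Q : Set E} (hQ : IsCompact Q) {h : E → ℝ} (hh : Continuous h) (p : E) {z : E}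
    (hz : z ∈ Q) : ⟪p, z⟫ - h z ≤ omega Q h p :=
  le_csSup (omega_bddAbove hQ hh p) (mem_image_of_mem _ hz)

lemma exists_eq_omega {Q : Set E} (hQ : IsCompact Q) (hne : Q.Nonempty) {h : E → ℝ}
    (hh : Continuous h) (p : E) : ∃ z ∈ Q, omega Q h p = ⟪p, z⟫ - h z := by
  obtain ⟨z, hz, hmax⟩ := (hQ.image (f := fun z => ⟪p, z⟫ - h z) (by fun_prop)).sSup_mem
    (hne.image _)
  exact ⟨z, hz, hmax.symm⟩

lemma mem_sd_omega {Q : Set E} (hQ : IsCompact Q) {h : E → ℝ} (hh : Continuous h) {p z : E}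
    (hz : z ∈ Q) (hmax : omega Q h p = ⟪p, z⟫ - h z) : z ∈ sd (omega Q h) p := by
  intro q
  have := le_omega hQ hh q hz
  rw [hmax, inner_sub_right, real_inner_comm q z, real_inner_comm p z]
  linarith

lemma lipschitz_omega {Q : Set E} (hQ : IsCompact Q) (hne : Q.Nonempty) {h : E → ℝ}
    (hh : Continuous h) : ∃ R : NNReal, LipschitzWith R (omega Q h) := by
  obtain ⟨C, hC⟩ := hQ.isBounded.exists_norm_le
  refine ⟨C.toNNReal, LipschitzWith.of_le_add_mul _ fun p q => ?_⟩
  obtain ⟨z, hz, hmax⟩ := exists_eq_omega hQ hne hh p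
  have h1 := le_omega hQ hh q hz
  have h2 : ⟪p - q, z⟫ ≤ ‖p - q‖ * ‖z‖ := real_inner_le_norm _ _
  have h3 : ‖p - q‖ * ‖z‖ ≤ ‖p - q‖ * C := by gcongr; exact hC z hz
  have h4 : C ≤ C.toNNReal := Real.le_coe_toNNReal C
  have h5 : ‖p - q‖ * C ≤ ‖p - q‖ * C.toNNReal := by gcongr
  rw [inner_sub_left] at h2
  rw [hmax, dist_eq_norm]
  linarith

lemma convexOn_omega {Q : Set E} (hQ : IsCompact Q) (hne : Q.Nonempty) {h : E → ℝ}
    (hh : Continuous h) : ConvexOn ℝ univ (omega Q h) := by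
  refine ⟨convex_univ, fun p _ q _ a b ha hb hab => ?_⟩
  obtain ⟨z, hz, hmax⟩ := exists_eq_omega hQ hne hh (a • p + b • q)
  have h1 := mul_le_mul_of_nonneg_left (le_omega hQ hh p hz) ha
  have h2 := mul_le_mul_of_nonneg_left (le_omega hQ hh q hz) hb
  rw [hmax, inner_add_left, inner_smul_left, inner_smul_left]
  simp only [conj_trivial, smul_eq_mul]
  have : h z = a * h z + b * h z := by rw [← add_mul, hab, one_mul]
  linarith

variable [FiniteDimensional ℝ E] [MeasurableSpace E] [BorelSpace E]

/-- A differentiable map with nonsingular differentials pulls null sets back to null sets. -/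
lemma null_inter_preimage {s N : Set E} {g : E → E} {g' : E → E →L[ℝ] E}
    (hg : ∀ x ∈ s, HasFDerivWithinAt g (g' x) s x) (hdet : ∀ x ∈ s, (g' x).det ≠ 0)
    (hN : volume N = 0) : volume (s ∩ g ⁻¹' N) = 0 := by
  rcases s.eq_empty_or_nonempty with rfl | hsne
  · simp
  have hr : ∀ A : E →L[ℝ] E, ∃ δ : NNReal, δ ≠ 0 ∧ (A.det ≠ 0 → ∃ m : NNReal, m ≠ 0 ∧
      ∀ (s : Set E) (f : E → E), ApproximatesLinearOn f A s δ →
        (m : ℝ≥0∞) * volume s ≤ volume (f '' s)) := by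
    intro A
    by_cases hA : A.det = 0
    · exact ⟨1, one_ne_zero, fun h => absurd hA h⟩
    · set m : NNReal := (|A.det| / 2).toNNReal with hm
      have hm1 : (m : ℝ≥0∞) < ENNReal.ofReal |A.det| := by
        rw [hm]
        have : 0 < |A.det| := abs_pos.2 hA
        exact (ENNReal.ofReal_lt_ofReal_iff this).2 (by linarith)
      have := mul_le_addHaar_image_of_lt_det (volume : Measure E) A hm1
      obtain ⟨δ, hδ1, hδ2⟩ := (this.and self_mem_nhdsWithin).exists
      refine ⟨δ, ne_of_gt hδ2, fun _ => ⟨m, ?_, hδ1⟩⟩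
      rw [hm]
      have : 0 < |A.det| := abs_pos.2 hA
      exact ne_of_gt (Real.toNNReal_pos.2 (by linarith))
  choose r hr0 hr1 using hr
  obtain ⟨t, A, -, -, hcov, happ, hmem⟩ :=
    exists_partition_approximatesLinearOn_of_hasFDerivWithinAt g s g' hg r hr0
  have hsub : s ∩ g ⁻¹' N ⊆ ⋃ n, (s ∩ t n) ∩ g ⁻¹' N := by
    rintro x ⟨hx, hxN⟩
    obtain ⟨n, hn⟩ := mem_iUnion.1 (hcov hx)
    exact mem_iUnion.2 ⟨n, ⟨hx, hn⟩, hxN⟩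
  refine measure_mono_null hsub (measure_iUnion_null fun n => ?_)
  obtain ⟨y, hy, hAy⟩ := hmem hsne n
  obtain ⟨m, hm0, hm⟩ := hr1 (A n) (by rw [hAy]; exact hdet y hy)
  have h1 := hm ((s ∩ t n) ∩ g ⁻¹' N) g ((happ n).mono_set inter_subset_left)
  have h2 : volume (g '' ((s ∩ t n) ∩ g ⁻¹' N)) = 0 :=
    measure_mono_null (by rintro _ ⟨x, ⟨_, hx⟩, rfl⟩; exact hx) hN
  rw [h2] at h1
  have h3 := le_antisymm h1 zero_le
  rcases mul_eq_zero.1 h3 with h | h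
  · exact absurd (by exact_mod_cast h) hm0
  · exact h

/-- The set of slopes attained by `ψ` at more than one point is null. -/
lemma null_multiple_slopes {ψ : E → ℝ} (hψ : Continuous ψ) :
    volume {p : E | ∃ x x', x ≠ x' ∧ p ∈ sd ψ x ∧ p ∈ sd ψ x'} = 0 := by
  have hsub : {p : E | ∃ x x', x ≠ x' ∧ p ∈ sd ψ x ∧ p ∈ sd ψ x'} ⊆
      ⋃ k : ℕ, {p | ¬ ∃ A, IsPSD A ∧ SubDiffAt (sd (omega (Metric.closedBall 0 k) ψ)) p A} := by
    rintro p ⟨x, x', hne, hx, hx'⟩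
    obtain ⟨k, hk⟩ := exists_nat_ge (max ‖x‖ ‖x'‖)
    refine mem_iUnion.2 ⟨k, ?_⟩
    rintro ⟨A, -, hA⟩
    have hQ := isCompact_closedBall (0 : E) (k : ℝ)
    have key : ∀ z, ‖z‖ ≤ k → p ∈ sd ψ z → z ∈ sd (omega (Metric.closedBall 0 k) ψ) p := by
      intro z hz hpz
      have hzQ : z ∈ Metric.closedBall (0 : E) k := by simpa using hz
      refine mem_sd_omega hQ hψ hzQ ?_
      obtain ⟨w, hw, hmax⟩ := exists_eq_omega hQ ⟨z, hzQ⟩ hψ p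
      refine le_antisymm ?_ (le_omega hQ hψ p hzQ)
      have := hpz w
      rw [inner_sub_right] at this
      rw [hmax]; linarith
    exact hne (hA.subsingleton (key x ((le_max_left _ _).trans hk) hx)
      (key x' ((le_max_right _ _).trans hk) hx'))
  refine measure_mono_null hsub (measure_iUnion_null fun k => ?_)
  have hQ := isCompact_closedBall (0 : E) (k : ℝ)
  have hne : (Metric.closedBall (0 : E) k).Nonempty := ⟨0, by simp⟩
  obtain ⟨R, hR⟩ := lipschitz_omega hQ hne hψ
  exact ae_subDiffAt (convexOn_omega hQ hne hψ) hR

/-- `u` is a global convex Lipschitz function with Monge-Ampère measure `f` on `D`. -/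
structure IsMA (D : Set E) (f : E → ℝ) (u : E → ℝ) (R : NNReal) : Prop where
  conv : ConvexOn ℝ univ u
  lip : LipschitzWith R u
  ma : ∀ s ⊆ D, MeasurableSet s →
    volume (⋃ x ∈ s, sd u x) = ∫⁻ x in s, ENNReal.ofReal (f x)

/-- `f` is a density on the open set `D` bounded between positive constants. -/
structure IsDensity (D : Set E) (f : E → ℝ) (lam Lam : ℝ) : Prop where
  isOpen : IsOpen D
  measurable : Measurable f
  pos : 0 < lam
  lower : ∀ x ∈ D, lam ≤ f x
  upper : ∀ x ∈ D, f x ≤ Lam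

lemma IsMA.ae_regular {D : Set E} {f u : E → ℝ} {R : NNReal} {lam Lam : ℝ}
    (hu : IsMA D f u R) (hf : IsDensity D f lam Lam) :
    ∀ᵐ x : E, x ∈ D → ∃ A, IsPSD A ∧ SubDiffAt (sd u) x A ∧ A.det = f x := by
  have hae := ae_subDiffAt hu.conv hu.lip
  set S : Set E := {x | ∃ A, IsPSD A ∧ SubDiffAt (sd u) x A} with hS
  have hSnull : volume Sᶜ = 0 := hae
  set T : Set E := (toMeasurable volume Sᶜ)ᶜ with hT
  have hTm : MeasurableSet T := (measurableSet_toMeasurable _ _).compl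
  have hTS : T ⊆ S := by
    rw [hT, compl_subset_comm]; exact subset_toMeasurable _ _
  have hTnull : volume Tᶜ = 0 := by rw [hT, compl_compl, measure_toMeasurable, hSnull]
  have hex : ∀ x, ∃ A : E →L[ℝ] E, x ∈ S → IsPSD A ∧ SubDiffAt (sd u) x A := by
    intro x
    by_cases hx : x ∈ S
    · obtain ⟨A, hA⟩ := hx; exact ⟨A, fun _ => hA⟩
    · exact ⟨0, fun h => absurd h hx⟩
  choose A hA using hex
  choose g hg using fun x => sd_nonempty hu.conv hu.lip x
  have hder : ∀ s ⊆ T, ∀ x ∈ s, HasFDerivWithinAt g (A x) s x := fun s hs x hx =>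
    ((hA x (hTS (hs hx))).2.hasFDerivAt hg).hasFDerivWithinAt
  have himg : ∀ s ⊆ D ∩ T, MeasurableSet s →
      volume (g '' s) = ∫⁻ x in s, ENNReal.ofReal (f x) := by
    intro s hs hsm
    rw [← hu.ma s (fun x hx => (hs hx).1) hsm]
    congr 1
    ext p
    simp only [mem_image, mem_iUnion, exists_prop]
    constructor
    · rintro ⟨x, hx, rfl⟩; exact ⟨x, hx, hg x⟩
    · rintro ⟨x, hx, hp⟩
      exact ⟨x, hx, (hA x (hTS (hs hx).2)).2.subsingleton (hg x) hp⟩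
  have hfm : Measurable fun x => ENNReal.ofReal (f x) := hf.measurable.ennreal_ofReal
  have hDT : MeasurableSet (D ∩ T) := hf.isOpen.measurableSet.inter hTm
  have hle : (fun x => ENNReal.ofReal (f x)) ≤ᵐ[volume.restrict (D ∩ T)]
      fun x => ENNReal.ofReal |(A x).det| := by
    refine ae_le_of_forall_setLIntegral_le_of_sigmaFinite hfm fun s hs _ => ?_
    rw [Measure.restrict_restrict hs, ← himg _ inter_subset_right (hs.inter hDT)]
    exact addHaar_image_le_lintegral_abs_det_fderiv volume (hs.inter hDT)
      (hder _ (fun x hx => hx.2.2))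
  rw [Filter.EventuallyLE, ae_restrict_iff' hDT, ae_iff] at hle
  set bad : Set E := {p : E | ∃ x x', x ≠ x' ∧ p ∈ sd u x ∧ p ∈ sd u x'} with hbad
  have hbadnull : volume bad = 0 := null_multiple_slopes hu.lip.continuous
  set W : Set E := {x ∈ D ∩ T | ENNReal.ofReal (f x) ≤ ENNReal.ofReal |(A x).det|} with hW
  have hWbad : volume (W ∩ g ⁻¹' bad) = 0 := by
    refine null_inter_preimage (hder W fun x hx => hx.1.2) (fun x hx h0 => ?_) hbadnull
    have h1 := hx.2
    rw [h0, abs_zero, ENNReal.ofReal_zero] at h1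
    have h2 := ENNReal.ofReal_eq_zero.1 (le_antisymm h1 zero_le)
    linarith [hf.lower x hx.1.1, hf.pos]
  have hDTbad : volume ((D ∩ T) ∩ g ⁻¹' bad) = 0 := by
    refine measure_mono_null ?_ (measure_union_null hWbad hle)
    rintro x ⟨hx, hxb⟩
    by_cases h : ENNReal.ofReal (f x) ≤ ENNReal.ofReal |(A x).det|
    · exact Or.inl ⟨⟨hx, h⟩, hxb⟩
    · exact Or.inr (fun hh => h (hh hx))
  set T₂ : Set E := (D ∩ T) \ toMeasurable volume ((D ∩ T) ∩ g ⁻¹' bad) with hT₂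
  have hT₂m : MeasurableSet T₂ := hDT.diff (measurableSet_toMeasurable _ _)
  have hinj : InjOn g T₂ := by
    intro x hx y hy hxy
    by_contra hne
    refine hx.2 (subset_toMeasurable _ _ ⟨hx.1, ?_⟩)
    exact ⟨x, y, hne, hg x, hxy ▸ hg y⟩
  have heq : (fun x => ENNReal.ofReal (f x)) =ᵐ[volume.restrict T₂]
      fun x => ENNReal.ofReal |(A x).det| := by
    refine ae_eq_of_forall_setLIntegral_eq_of_sigmaFinite₀ hfm.aemeasurable
      (aemeasurable_ofReal_abs_det_fderivWithin volume hT₂m (hder _ fun x hx => hx.1.2)) ?_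
    intro s hs _
    have hsub : s ∩ T₂ ⊆ D ∩ T := fun x hx => hx.2.1
    rw [Measure.restrict_restrict hs, ← himg _ hsub (hs.inter hT₂m)]
    exact (lintegral_abs_det_fderiv_eq_addHaar_image volume (hs.inter hT₂m)
      (hder _ fun x hx => (hsub hx).2) (hinj.mono inter_subset_right)).symm
  rw [Filter.EventuallyEq, ae_restrict_iff' hT₂m] at heq
  have hT2null : ∀ᵐ x : E, x ∉ toMeasurable volume ((D ∩ T) ∩ g ⁻¹' bad) := by
    rw [ae_iff]; simpa using hDTbad
  have hTae : ∀ᵐ x : E, x ∈ T := hTnull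
  filter_upwards [heq, hT2null, hTae] with x h1 h2 h3 hxD
  obtain ⟨hpsd, hsda⟩ := hA x (hTS h3)
  refine ⟨A x, hpsd, hsda, ?_⟩
  have h4 := h1 ⟨⟨hxD, h3⟩, h2⟩
  rw [abs_of_nonneg hpsd.det_nonneg, ENNReal.ofReal_eq_ofReal_iff
    (hf.pos.le.trans (hf.lower x hxD)) hpsd.det_nonneg] at h4
  exact h4.symm

end Regularity

section Comparison

variable {E : Type*} [NormedAddCommGroup E] [InnerProductSpace ℝ E]

lemma SubDiffAt.hasFDerivAt_comp {G : E → Set E} {z : E → E} {p : E} {A C : E →L[ℝ] E}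
    (h : SubDiffAt G (z p) A) (hz : HasFDerivAt z C p) {a : E → E}
    (ha : ∀ᶠ q in nhds p, a q ∈ G (z q)) : HasFDerivAt a (A.comp C) p := by
  have h1 : (fun q => a q - a p - A (z q - z p)) =o[nhds p] fun q => z q - z p := by
    rw [Asymptotics.isLittleO_iff]
    intro ε hε
    filter_upwards [hz.continuousAt.eventually (h ε hε), ha] with q hq haq
    exact hq _ ha.self_of_nhds _ haq
  have h2 := h1.trans_isBigO hz.isBigO_sub
  have h3 : HasFDerivAt (fun q => A (z q)) (A.comp C) p := A.hasFDerivAt.comp p hz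
  rw [hasFDerivAt_iff_isLittleO] at h3 ⊢
  refine (h2.add h3).congr_left fun q => ?_
  rw [map_sub]; simp

lemma mem_sd_of_max {Q O : Set E} (hO : IsOpen O) (hOQ : O ⊆ Q) {u v : E → ℝ}
    (hu : ConvexOn ℝ univ u) {c : ℝ} (hc : 0 < c) {p z b : E} (hz : z ∈ O)
    (hmax : ∀ x ∈ Q, ⟪p, x⟫ - ((1 + c) * u x - v x) / c ≤ ⟪p, z⟫ - ((1 + c) * u z - v z) / c)
    (hb : b ∈ sd v z) : (1 + c)⁻¹ • (b + c • p) ∈ sd u z := by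
  refine mem_sd_of_eventually hu ?_
  filter_upwards [hO.mem_nhds hz] with x hx
  have h1 := hmax x (hOQ hx)
  have h2 := hb x
  rw [inner_smul_left, inner_add_left, inner_smul_left, inner_sub_right p]
  simp only [conj_trivial]
  have h3 : c * (⟪p, x⟫ - ((1 + c) * u x - v x) / c) ≤ c * (⟪p, z⟫ - ((1 + c) * u z - v z) / c) :=
    mul_le_mul_of_nonneg_left h1 hc.le
  rw [mul_sub, mul_sub, mul_div_cancel₀ _ hc.ne', mul_div_cancel₀ _ hc.ne'] at h3
  have h4 : (1 + c) * (u z + (1 + c)⁻¹ * (⟪b, x - z⟫ + c * (⟪p, x⟫ - ⟪p, z⟫))) ≤ (1 + c) * u x := by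
    rw [mul_add, ← mul_assoc, mul_inv_cancel₀ (by positivity), one_mul]
    linarith
  exact le_of_mul_le_mul_left h4 (by positivity)

variable [FiniteDimensional ℝ E]

lemma SubDiffAt.le_quadratic {ω : E → ℝ} {R : NNReal} (hω : ConvexOn ℝ univ ω)
    (hR : LipschitzWith R ω) {p z : E} {C : E →L[ℝ] E} (hC : SubDiffAt (sd ω) p C)
    (hz : z ∈ sd ω p) {ε : ℝ} (hε : 0 < ε) : ∃ r > 0, ∀ η, ‖η‖ ≤ r →
      ω (p + η) ≤ ω p + ⟪z, η⟫ + ⟪C η, η⟫ + ε * ‖η‖ ^ 2 := by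
  obtain ⟨r, hr, h⟩ := Metric.eventually_nhds_iff.1 (hC ε hε)
  refine ⟨r / 2, by positivity, fun η hη => ?_⟩
  obtain ⟨w, hw⟩ := sd_nonempty hω hR (p + η)
  have h1 := h (y := p + η) (by rw [dist_eq_norm, add_sub_cancel_left]; linarith) z hz w hw
  rw [add_sub_cancel_left] at h1
  have h2 := hw p
  have h3 : p - (p + η) = -η := by abel
  rw [h3, inner_neg_right] at h2
  have h4 := (abs_le.1 (abs_real_inner_le_norm (w - z - C η) η)).2
  have h5 : ‖w - z - C η‖ * ‖η‖ ≤ ε * ‖η‖ * ‖η‖ := by gcongr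
  rw [inner_sub_left, inner_sub_left] at h4
  nlinarith

variable [MeasurableSpace E] [BorelSpace E]

lemma IsMA.volume_sd_le {D : Set E} {f u : E → ℝ} {R : NNReal} {lam Lam : ℝ}
    (hu : IsMA D f u R) (hf : IsDensity D f lam Lam) {s : Set E} (hs : s ⊆ D)
    (hsm : MeasurableSet s) : volume (⋃ x ∈ s, sd u x) ≤ ENNReal.ofReal Lam * volume s := by
  rw [hu.ma s hs hsm, ← setLIntegral_const]
  exact setLIntegral_mono measurable_const fun x hx => ENNReal.ofReal_le_ofReal (hf.upper x (hs hx))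

lemma IsMA.le_volume_sd {D : Set E} {f u : E → ℝ} {R : NNReal} {lam Lam : ℝ}
    (hu : IsMA D f u R) (hf : IsDensity D f lam Lam) {s : Set E} (hs : s ⊆ D)
    (hsm : MeasurableSet s) : ENNReal.ofReal lam * volume s ≤ volume (⋃ x ∈ s, sd u x) := by
  rw [hu.ma s hs hsm, ← setLIntegral_const]
  exact setLIntegral_mono hf.measurable.ennreal_ofReal
    fun x hx => ENNReal.ofReal_le_ofReal (hf.lower x (hs hx))

/-- A quadratic lower bound for `u` at `z` bounds the determinant of the form from below. -/
lemma le_det_of_quadratic_gain {D : Set E} {f u : E → ℝ} {R : NNReal} {lam Lam : ℝ}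
    (hu : IsMA D f u R) (hf : IsDensity D f lam Lam) {O : Set E} (hO : IsOpen O) (hOD : O ⊆ D)
    {z a : E} (hz : z ∈ O) {S : E →L[ℝ] E} (hS : ∀ x y, ⟪S x, y⟫ = ⟪x, S y⟫) (hdet : S.det ≠ 0)
    {κ r : ℝ} (hκ : 0 < κ) (hr : 0 < r)
    (hgain : ∀ x ∈ O, ∀ η, ‖η‖ ≤ r → u z + ⟪a, x - z⟫ + κ * (⟪η, x - z⟫ - ‖S η‖ ^ 2) ≤ u x) :
    (κ / 8) ^ (Module.finrank ℝ E) ≤ Lam * S.det ^ 2 := by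
  obtain ⟨V, hSV, hVS, -⟩ := exists_inv_of_det_ne_zero hdet
  obtain ⟨δ, hδ, hδO⟩ := Metric.isOpen_iff.1 hO z hz
  set ρ : ℝ := min (δ / (2 * (‖S‖ + 1))) (r / (‖V‖ + 1)) with hρ
  have hρ0 : 0 < ρ := by positivity
  have hρ1 : ‖S‖ * ρ < δ := by
    have : ρ ≤ δ / (2 * (‖S‖ + 1)) := min_le_left _ _
    rw [le_div_iff₀ (by positivity)] at this
    nlinarith [norm_nonneg S]
  have hρ2 : ‖V‖ * ρ ≤ r := by
    have : ρ ≤ r / (‖V‖ + 1) := min_le_right _ _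
    rw [le_div_iff₀ (by positivity)] at this
    nlinarith [norm_nonneg V]
  set Ell : Set E := (fun w => z + S w) '' Metric.closedBall 0 ρ with hEll
  have hEllc : IsCompact Ell := (isCompact_closedBall _ _).image (by fun_prop)
  have hEllO : Ell ⊆ O := by
    rintro _ ⟨w, hw, rfl⟩
    apply hδO
    rw [Metric.mem_ball, dist_eq_norm, add_sub_cancel_left]
    refine (S.le_opNorm w).trans_lt (lt_of_le_of_lt ?_ hρ1)
    have : ‖w‖ ≤ ρ := by simpa using hw
    gcongr
  have hopen : IsOpen ((fun w => z + S w) '' Metric.ball 0 ρ) := by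
    have : (fun w => z + S w) '' Metric.ball 0 ρ = (fun x => V (x - z)) ⁻¹' Metric.ball 0 ρ := by
      ext x
      constructor
      · rintro ⟨w, hw, rfl⟩
        simpa [hVS] using hw
      · intro hx
        exact ⟨V (x - z), hx, by simp [hSV]⟩
    rw [this]
    exact Metric.isOpen_ball.preimage (by fun_prop)
  have hslopes : (fun ζ => ζ + a) '' (S ⁻¹' Metric.closedBall 0 (κ * ρ / 8)) ⊆
      ⋃ x ∈ Ell, sd u x := by
    rintro _ ⟨ζ, hζ, rfl⟩
    have hζ' : ‖S ζ‖ ≤ κ * ρ / 8 := by simpa using hζ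
    have hcont : Continuous u := hu.lip.continuous
    obtain ⟨x, hx, hmin⟩ := hEllc.exists_isMinOn (f := fun x => u x - ⟪ζ + a, x⟫)
      ⟨z, 0, by simp [hρ0.le], by simp⟩ (by fun_prop)
    obtain ⟨w, hw, rfl⟩ := hx
    have hw' : ‖w‖ ≤ ρ := by simpa using hw
    refine mem_iUnion₂.2 ⟨z + S w, mem_image_of_mem _ hw, ?_⟩
    have hlt : ‖w‖ < ρ := by
      refine lt_of_le_of_ne hw' fun hwρ => ?_
      have h1 := hgain (z + S w) (hEllO (mem_image_of_mem _ hw)) ((1 / 2 : ℝ) • V w) (by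
        rw [norm_smul]
        have h2 := V.le_opNorm w
        rw [hwρ] at h2
        have : ‖(1 / 2 : ℝ)‖ = 1 / 2 := by norm_num
        rw [this]
        linarith [norm_nonneg (V w)])
      have h2 : u (z + S w) - ⟪ζ + a, z + S w⟫ ≤ u z - ⟪ζ + a, z⟫ :=
        hmin ⟨0, by simp [hρ0.le], by simp⟩
      have h3 : ⟪ζ, S w⟫ ≤ κ * ρ / 8 * ρ := by
        rw [← hS]
        refine (real_inner_le_norm _ _).trans ?_
        gcongr
      rw [add_sub_cancel_left, map_smul, hSV, norm_smul, inner_smul_left, ← hS (V w), hSV,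
        real_inner_self_eq_norm_sq, hwρ, mul_pow] at h1
      rw [inner_add_left, inner_add_right, inner_add_right, inner_add_left] at h2
      have h5 : ‖(1 / 2 : ℝ)‖ ^ 2 = 1 / 4 := by norm_num
      rw [h5] at h1
      simp only [conj_trivial] at h1
      have : 0 < κ * ρ ^ 2 := by positivity
      nlinarith
    refine mem_sd_of_eventually hu.conv ?_
    have hmem : z + S w ∈ (fun w => z + S w) '' Metric.ball 0 ρ :=
      mem_image_of_mem _ (by simpa using hlt)
    filter_upwards [hopen.mem_nhds hmem] with y hy
    have h1 : u (z + S w) - ⟪ζ + a, z + S w⟫ ≤ u y - ⟪ζ + a, y⟫ :=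
      hmin (image_mono Metric.ball_subset_closedBall hy)
    rw [inner_sub_right]
    linarith
  have h1 := measure_mono (μ := volume) hslopes
  have h2 := hu.volume_sd_le hf (hEllO.trans hOD) hEllc.isClosed.measurableSet
  have h3 : volume Ell = ENNReal.ofReal |S.det| * volume (Metric.closedBall (0 : E) ρ) := by
    have : Ell = (fun x => z + x) '' (S '' Metric.closedBall 0 ρ) := by rw [image_image]
    rw [this, image_add_left, measure_preimage_add, Measure.addHaar_image_continuousLinearMap]
  rw [image_add_right, measure_preimage_add_right,
    Measure.addHaar_preimage_continuousLinearMap _ hdet,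
    Measure.addHaar_closedBall _ _ (by positivity)] at h1
  rw [h3, Measure.addHaar_closedBall _ _ hρ0.le] at h2
  have h4 := h1.trans h2
  set ωn := volume (Metric.ball (0 : E) 1) with hωn
  have hω0 : ωn ≠ 0 := (Metric.measure_ball_pos _ _ one_pos).ne'
  have hωt : ωn ≠ ⊤ := measure_ball_lt_top.ne
  rw [← mul_assoc, ← mul_assoc, ← mul_assoc, ENNReal.mul_le_mul_iff_left hω0 hωt] at h4
  have hLam : 0 ≤ Lam := hf.pos.le.trans ((hf.lower z (hOD hz)).trans (hf.upper z (hOD hz)))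
  have hd : 0 < |S.det| := abs_pos.2 hdet
  rw [← ENNReal.ofReal_mul (by positivity), ← ENNReal.ofReal_mul (by positivity),
    ← ENNReal.ofReal_mul (by positivity), ENNReal.ofReal_le_ofReal_iff (by positivity)] at h4
  set n := Module.finrank ℝ E
  have h5 : κ * ρ / 8 = κ / 8 * ρ := by ring
  rw [h5, mul_pow, abs_inv, inv_mul_le_iff₀ hd] at h4
  have h6 : (κ / 8) ^ n * ρ ^ n ≤ Lam * S.det ^ 2 * ρ ^ n := by
    rw [← sq_abs S.det]; linarith
  exact le_of_mul_le_mul_right h6 (by positivity)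

end Comparison

section SlopeEstimate

variable {E : Type*} [NormedAddCommGroup E] [InnerProductSpace ℝ E]

lemma IsPSD.add_smul_id {C : E →L[ℝ] E} (hC : IsPSD C) {ε : ℝ} (hε : 0 ≤ ε) :
    IsPSD (C + ε • ContinuousLinearMap.id ℝ E) := by
  refine ⟨fun a b => ?_, fun a => ?_⟩
  · simp only [add_apply, smul_apply,
      ContinuousLinearMap.id_apply, inner_add_left, inner_add_right, inner_smul_left,
      inner_smul_right, hC.1 a b, conj_trivial]
  · simp only [add_apply, smul_apply,
      ContinuousLinearMap.id_apply, inner_add_left, inner_smul_left, conj_trivial,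
      real_inner_self_eq_norm_sq]
    have := hC.2 a
    positivity

variable [FiniteDimensional ℝ E]

lemma IsPSD.det_add_smul_id_pos {C : E →L[ℝ] E} (hC : IsPSD C) {ε : ℝ} (hε : 0 < ε) :
    0 < (C + ε • ContinuousLinearMap.id ℝ E).det := by
  obtain ⟨b, a, ha, hb⟩ := hC.exists_diag
  rw [det_eq_prod_of_diag b.toBasis (fun i => a i + ε) _ (by
    intro i
    rw [OrthonormalBasis.coe_toBasis]
    simp [hb, add_smul])]
  exact Finset.prod_pos fun i _ => by have := ha i; positivity

variable [MeasurableSpace E] [BorelSpace E]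

/-- The Hessian of the support function is nonsingular. -/
lemma det_ne_zero_of_subDiffAt {D : Set E} {f u v : E → ℝ} {Ru Rv : NNReal} {lam Lam : ℝ}
    (hf : IsDensity D f lam Lam) (hu : IsMA D f u Ru) (hv : ConvexOn ℝ univ v)
    (hvl : LipschitzWith Rv v) {c : ℝ} (hc : 0 < c) {Q O : Set E} (hQ : IsCompact Q)
    (hQD : Q ⊆ D) (hO : IsOpen O) (hOQ : O ⊆ Q) {p z : E} (hz : z ∈ O)
    (hmax : omega Q (fun x => ((1 + c) * u x - v x) / c) p = ⟪p, z⟫ - ((1 + c) * u z - v z) / c)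
    {C : E →L[ℝ] E} (hC : IsPSD C)
    (hCd : SubDiffAt (sd (omega Q (fun x => ((1 + c) * u x - v x) / c))) p C) : C.det ≠ 0 := by
  set h : E → ℝ := fun x => ((1 + c) * u x - v x) / c with hh
  have hhc : Continuous h := by
    have := hu.lip.continuous
    have := hvl.continuous
    fun_prop
  obtain ⟨R, hR⟩ := lipschitz_omega hQ ⟨z, hOQ hz⟩ hhc
  have hconv := convexOn_omega hQ ⟨z, hOQ hz⟩ hhc
  have hzsd : z ∈ sd (omega Q h) p := mem_sd_omega hQ hhc (hOQ hz) hmax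
  obtain ⟨b, hb⟩ := sd_nonempty hv hvl z
  set κ : ℝ := c / (1 + c) with hκ
  have hκ0 : 0 < κ := by positivity
  have hbound : ∀ ε : ℝ, 0 < ε → (κ / 8) ^ (Module.finrank ℝ E) ≤
      Lam * (C + ε • ContinuousLinearMap.id ℝ E).det := by
    intro ε hε
    obtain ⟨S, hSs, hSS⟩ := (hC.add_smul_id hε.le).exists_sqrt
    have hSdet : S.det ^ 2 = (C + ε • ContinuousLinearMap.id ℝ E).det := by
      rw [sq, ← cld_comp]; congr 1; ext x; exact hSS x
    have hSdet0 : S.det ≠ 0 := by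
      intro h0
      have := hC.det_add_smul_id_pos hε
      rw [← hSdet, h0] at this
      simp at this
    obtain ⟨r, hr, hquad⟩ := hCd.le_quadratic hconv hR hzsd hε
    rw [← hSdet]
    refine le_det_of_quadratic_gain hu hf hO (hOQ.trans hQD) hz hSs hSdet0 (a := (1 + c)⁻¹ • (b + c • p))
      hκ0 hr fun x hx η hη => ?_
    have h1 := hquad η hη
    have h2 := le_omega hQ hhc (p + η) (hOQ hx)
    have h3 := hb x
    have h4 : ‖S η‖ ^ 2 = ⟪C η, η⟫ + ε * ‖η‖ ^ 2 := by
      rw [← real_inner_self_eq_norm_sq, ← hSs, hSS]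
      simp [inner_add_left, inner_smul_left]
    rw [hmax, inner_add_left] at *
    have h5 : c * (⟪p, x⟫ + ⟪η, x⟫ - h x) ≤
        c * (⟪p, z⟫ - h z + ⟪z, η⟫ + ⟪C η, η⟫ + ε * ‖η‖ ^ 2) :=
      mul_le_mul_of_nonneg_left (h2.trans h1) hc.le
    have h6 : ∀ y, c * h y = (1 + c) * u y - v y := fun y => by rw [hh]; field_simp
    have h7 : (1 + c) * (u z + ⟪(1 + c)⁻¹ • (b + c • p), x - z⟫ +
        κ * (⟪η, x - z⟫ - ‖S η‖ ^ 2)) ≤ (1 + c) * u x := by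
      rw [h4, inner_smul_left, inner_add_left, inner_smul_left, inner_sub_right η, inner_sub_right p,
        real_inner_comm z η, mul_add, mul_add, ← mul_assoc, ← mul_assoc (1 + c) κ, hκ,
        mul_div_cancel₀ _ (by positivity)]
      simp only [conj_trivial]
      rw [mul_inv_cancel₀ (by positivity), one_mul]
      rw [mul_sub, mul_add, h6] at h5
      have := h6 z
      nlinarith
    exact le_of_mul_le_mul_left h7 (by positivity)
  intro h0
  have hlim : Filter.Tendsto (fun ε : ℝ => Lam * (C + ε • ContinuousLinearMap.id ℝ E).det)
      (nhdsWithin 0 (Ioi 0)) (nhds (Lam * (C + (0 : ℝ) • ContinuousLinearMap.id ℝ E).det)) := by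
    refine Filter.Tendsto.mono_left (Continuous.tendsto ?_ _) nhdsWithin_le_nhds
    exact continuous_const.mul (ContinuousLinearMap.continuous_det.comp (by fun_prop))
  rw [zero_smul, add_zero, h0, mul_zero] at hlim
  have := ge_of_tendsto hlim (by
    filter_upwards [self_mem_nhdsWithin] with ε hε using hbound ε hε)
  have h9 : 0 < (κ / 8) ^ (Module.finrank ℝ E) := by positivity
  linarith

/-- The key comparison: slopes whose minimisers over `Q` stay in `O` have volume at most the
Monge-Ampère mass of `O`. -/
lemma volume_slopes_le {D : Set E} {f u v : E → ℝ} {Ru Rv : NNReal} {lam Lam : ℝ}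
    (hf : IsDensity D f lam Lam) (hu : IsMA D f u Ru) (hv : IsMA D f v Rv)
    {c : ℝ} (hc : 0 < c) {Q O : Set E} (hQ : IsCompact Q) (hne : Q.Nonempty)
    (hQD : Q ⊆ D) (hO : IsOpen O) (hOQ : O ⊆ Q) {P : Set E} (hP : MeasurableSet P)
    (hmin : ∀ p ∈ P, ∀ z ∈ Q, (∀ x ∈ Q, (1 + c) * u z - v z - c * ⟪p, z⟫ ≤
      (1 + c) * u x - v x - c * ⟪p, x⟫) → z ∈ O) :
    volume P ≤ ∫⁻ x in O, ENNReal.ofReal (f x) := by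
  set h : E → ℝ := fun x => ((1 + c) * u x - v x) / c with hh
  have hhc : Continuous h := by
    have := hu.lip.continuous
    have := hv.lip.continuous
    fun_prop
  obtain ⟨R, hR⟩ := lipschitz_omega hQ hne hhc
  have hconv := convexOn_omega hQ hne hhc
  choose z hzQ hzmax using exists_eq_omega hQ hne hhc
  have hzle : ∀ p, ∀ x ∈ Q, ⟪p, x⟫ - h x ≤ ⟪p, z p⟫ - h (z p) := fun p x hx => by
    rw [← hzmax]; exact le_omega hQ hhc p hx
  have hzsd : ∀ p, z p ∈ sd (omega Q h) p := fun p => mem_sd_omega hQ hhc (hzQ p) (hzmax p)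
  have hzO : ∀ p ∈ P, z p ∈ O := by
    intro p hp
    refine hmin p hp _ (hzQ p) fun x hx => ?_
    have h1 := mul_le_mul_of_nonneg_left (hzle p x hx) hc.le
    have h6 : ∀ y, c * h y = (1 + c) * u y - v y := fun y => by rw [hh]; field_simp
    rw [mul_sub, mul_sub, h6, h6] at h1
    linarith
  have hex : ∀ p, ∃ C : E →L[ℝ] E, (∃ C, IsPSD C ∧ SubDiffAt (sd (omega Q h)) p C) →
      IsPSD C ∧ SubDiffAt (sd (omega Q h)) p C := by
    intro p
    by_cases hx : ∃ C, IsPSD C ∧ SubDiffAt (sd (omega Q h)) p C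
    · obtain ⟨C, hC⟩ := hx; exact ⟨C, fun _ => hC⟩
    · exact ⟨0, fun h => absurd h hx⟩
  choose C hC using hex
  set P₁ : Set E := {p ∈ P | ∃ C, IsPSD C ∧ SubDiffAt (sd (omega Q h)) p C} with hP₁
  have hder : ∀ p ∈ P₁, HasFDerivAt z (C p) p := fun p hp => (hC p hp.2).2.hasFDerivAt hzsd
  have hCdet : ∀ p ∈ P₁, (C p).det ≠ 0 := fun p hp =>
    det_ne_zero_of_subDiffAt hf hu hv.conv hv.lip hc hQ hQD hO hOQ (hzO p hp.1) (hzmax p)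
      (hC p hp.2).1 (hC p hp.2).2
  set N : Set E := {x | x ∈ D ∧ ¬ ((∃ A, IsPSD A ∧ SubDiffAt (sd u) x A ∧ A.det = f x) ∧
    ∃ A, IsPSD A ∧ SubDiffAt (sd v) x A ∧ A.det = f x)} with hN
  have hNnull : volume N = 0 := by
    have : ∀ᵐ x : E, x ∉ N := by
      filter_upwards [hu.ae_regular hf, hv.ae_regular hf] with x h1 h2 hx
      exact hx.2 ⟨h1 hx.1, h2 hx.1⟩
    exact measure_eq_zero_iff_ae_notMem.2 this
  have hpre : volume (P₁ ∩ z ⁻¹' N) = 0 :=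
    null_inter_preimage (fun p hp => (hder p hp).hasFDerivWithinAt) hCdet hNnull
  choose gv hgv using fun x => sd_nonempty hv.conv hv.lip x
  have hgu : ∀ p, z p ∈ O → (1 + c)⁻¹ • (gv (z p) + c • p) ∈ sd u (z p) := fun p hp =>
    mem_sd_of_max hO hOQ hu.conv hc hp (hzle p) (hgv _)
  have hgood : ∀ p ∈ P₁ \ z ⁻¹' N, (∃ A, SubDiffAt (sd u) (z p) A) ∧
      1 ≤ |(C p).det| * f (z p) := by
    rintro p ⟨hp, hpN⟩
    have hzp := hzO p hp.1
    have hreg : (∃ A, IsPSD A ∧ SubDiffAt (sd u) (z p) A ∧ A.det = f (z p)) ∧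
        ∃ A, IsPSD A ∧ SubDiffAt (sd v) (z p) A ∧ A.det = f (z p) := by
      by_contra hcon
      exact hpN ⟨hQD (hOQ hzp), hcon⟩
    obtain ⟨⟨A, hA, hAd, hAdet⟩, B, hB, hBd, hBdet⟩ := hreg
    refine ⟨⟨A, hAd⟩, ?_⟩
    have hz' := hder p hp
    have hev : ∀ᶠ q in nhds p, z q ∈ O := hz'.continuousAt.eventually (hO.mem_nhds hzp)
    have h1 := hAd.hasFDerivAt_comp hz' (a := fun q => (1 + c)⁻¹ • (gv (z q) + c • q))
      (hev.mono fun q hq => hgu q hq)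
    have h2 := hBd.hasFDerivAt_comp hz' (a := fun q => gv (z q))
      (Filter.Eventually.of_forall fun q => hgv _)
    have h3 := (h2.add ((hasFDerivAt_id p).const_smul c)).const_smul ((1 + c)⁻¹)
    have h4 := h1.unique h3
    obtain ⟨V, hCV, hVC, hVdet⟩ := exists_inv_of_det_ne_zero (hCdet p hp)
    have hCp := (hC p hp.2).1
    have hV : IsPSD V := by
      refine ⟨fun a b => ?_, fun a => ?_⟩
      · conv_lhs => rw [← hCV b]
        rw [← hCp.1, hCV]
      · conv_rhs => rw [← hCV a]
        rw [hVC, ← hCp.1]; exact hCp.2 _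
    have hdetpos : 0 < f (z p) := hf.pos.trans_le (hf.lower _ (hQD (hOQ hzp)))
    have hle := det_le_of_convex_comb hA hB hV hc (fun x => ?_) (hAdet.trans hBdet.symm)
      (hAdet ▸ hdetpos)
    · rw [hVdet, hAdet] at hle
      have hCpos : 0 < (C p).det := lt_of_le_of_ne hCp.det_nonneg (hCdet p hp).symm
      rw [abs_of_pos hCpos]
      rwa [inv_le_iff_one_le_mul₀' hCpos] at hle
    · have h5 := congrArg (fun T : E →L[ℝ] E => T (V x)) h4
      simp only [ContinuousLinearMap.comp_apply, smul_apply,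
        add_apply, ContinuousLinearMap.id_apply, hCV] at h5
      rw [h5, smul_smul, mul_inv_cancel₀ (by positivity), one_smul, add_comm]
  have hae : ∀ᵐ p : E, p ∈ P → p ∈ P₁ \ z ⁻¹' N := by
    have h2 : ∀ᵐ p : E, p ∉ P₁ ∩ z ⁻¹' N := measure_eq_zero_iff_ae_notMem.1 hpre
    filter_upwards [ae_subDiffAt hconv hR, h2] with p h1 h2 hp
    exact ⟨⟨hp, h1⟩, fun h3 => h2 ⟨⟨hp, h1⟩, h3⟩⟩
  set Bad : Set E := {p | ¬ (p ∈ P → p ∈ P₁ \ z ⁻¹' N)} with hBad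
  have hBadnull : volume Bad = 0 := hae
  set G : Set E := P \ toMeasurable volume Bad with hG
  have hGm : MeasurableSet G := hP.diff (measurableSet_toMeasurable _ _)
  have hGgood : ∀ p ∈ G, p ∈ P₁ \ z ⁻¹' N := by
    intro p hp
    by_contra hcon
    exact hp.2 (subset_toMeasurable _ _ (fun hh => hcon (hh hp.1)))
  have hvol : volume P = volume G := by
    rw [hG, measure_sdiff_null]
    rw [measure_toMeasurable, hBadnull]
  have hinj : InjOn z G := by
    intro p hp q hq hpq
    obtain ⟨A, hA⟩ := (hgood p (hGgood p hp)).1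
    have h1 := hgu p (hzO p hp.1)
    have h2 := hgu q (hzO q hq.1)
    rw [← hpq] at h2
    have h3 := hA.subsingleton h1 h2
    have h4 := smul_right_injective E (inv_ne_zero (by positivity : (1 + c) ≠ 0)) h3
    exact smul_right_injective E hc.ne' (add_left_cancel h4)
  calc volume P = ∫⁻ p in G, 1 := by rw [hvol, setLIntegral_one]
    _ ≤ ∫⁻ p in G, ENNReal.ofReal |(C p).det| * ENNReal.ofReal (f (z p)) := by
        refine setLIntegral_mono' hGm fun p hp => ?_
        rw [← ENNReal.ofReal_mul (abs_nonneg _), ← ENNReal.ofReal_one]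
        exact ENNReal.ofReal_le_ofReal (hgood p (hGgood p hp)).2
    _ = ∫⁻ x in z '' G, ENNReal.ofReal (f x) :=
        (lintegral_image_eq_lintegral_abs_det_fderiv_mul volume hGm
          (fun p hp => (hder p (hGgood p hp).1).hasFDerivWithinAt) hinj
          (fun x => ENNReal.ofReal (f x))).symm
    _ ≤ ∫⁻ x in O, ENNReal.ofReal (f x) := by
        refine lintegral_mono_set ?_
        rintro _ ⟨p, hp, rfl⟩
        exact hzO p hp.1

end SlopeEstimate

section ContactSet

variable {E : Type*} [NormedAddCommGroup E] [InnerProductSpace ℝ E] [FiniteDimensional ℝ E]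

lemma eventually_sd_subset {ψ : E → ℝ} {R : NNReal} (hR : LipschitzWith R ψ) {U : Set E}
    (hU : IsOpen U) {x : E} (hx : sd ψ x ⊆ U) : ∀ᶠ y in nhds x, sd ψ y ⊆ U := by
  by_contra hcon
  have h1 : ∃ᶠ y in nhds x, ∃ q ∈ sd ψ y, q ∉ U := by
    refine (Filter.not_eventually.1 hcon).mono fun y hy => ?_
    simpa [subset_def] using hy
  obtain ⟨y, hy, hyq⟩ := Filter.exists_seq_forall_of_frequently h1
  choose q hq hqU using hyq
  obtain ⟨q₀, -, φ, hφ, hlim⟩ := (isCompact_closedBall (0 : E) R).tendsto_subseq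
    (x := q) fun j => by simpa using norm_le_of_mem_sd hR (hq j)
  have h2 := mem_sd_of_tendsto hR.continuous (hy.comp hφ.tendsto_atTop) hlim
    (Filter.Eventually.of_forall fun j => hq _)
  exact (hU.isClosed_compl.mem_of_tendsto hlim (Filter.Eventually.of_forall fun j => hqU _))
    (hx h2)

variable [MeasurableSpace E] [BorelSpace E]
  {D : Set E} {f u v : E → ℝ} {Ru Rv : NNReal} {lam Lam : ℝ}

lemma volume_slopes_le_of_contact (hf : IsDensity D f lam Lam) (hu : IsMA D f u Ru)
    (hv : IsMA D f v Rv) (hvu : ∀ x ∈ D, v x ≤ u x) {Q O : Set E} (hQ : IsCompact Q)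
    (hQD : Q ⊆ D) (hQK : ∃ x ∈ Q, u x = v x) (hO : IsOpen O) (hOQ : O ⊆ Q) {P : Set E}
    (hP : IsCompact P)
    (hmin : ∀ p ∈ P, ∀ z ∈ Q, u z = v z →
      (∀ x ∈ Q, u x = v x → u z - ⟪p, z⟫ ≤ u x - ⟪p, x⟫) → z ∈ O) :
    volume P ≤ ∫⁻ x in O, ENNReal.ofReal (f x) := by
  by_contra hcon
  obtain ⟨k, hkQ, hk⟩ := hQK
  have hex : ∀ m : ℕ, ∃ p ∈ P, ∃ z ∈ Q, (∀ x ∈ Q, (1 + 1 / ((m : ℝ) + 1)) * u z - v z -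
      1 / ((m : ℝ) + 1) * ⟪p, z⟫ ≤ (1 + 1 / ((m : ℝ) + 1)) * u x - v x -
      1 / ((m : ℝ) + 1) * ⟪p, x⟫) ∧ z ∉ O := by
    intro m
    by_contra! hm
    exact hcon (volume_slopes_le hf hu hv (c := 1 / ((m : ℝ) + 1)) (by positivity) hQ ⟨k, hkQ⟩ hQD
      hO hOQ hP.measurableSet hm)
  choose p hp z hz hpz hzO using hex
  obtain ⟨⟨p₀, z₀⟩, ⟨hp₀, hz₀⟩, φ, hφ, hlim⟩ := (hP.prod hQ).tendsto_subseq
    (x := fun m => (p m, z m)) fun m => ⟨hp m, hz m⟩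
  have hlp : Filter.Tendsto (fun j => p (φ j)) Filter.atTop (nhds p₀) :=
    (continuous_fst.tendsto _).comp hlim
  have hlz : Filter.Tendsto (fun j => z (φ j)) Filter.atTop (nhds z₀) :=
    (continuous_snd.tendsto _).comp hlim
  have huc := hu.lip.continuous
  have hvc := hv.lip.continuous
  have hlu := (huc.tendsto z₀).comp hlz
  have hlv := (hvc.tendsto z₀).comp hlz
  have hle : ∀ m, ∀ x ∈ Q, u x = v x → u (z m) - ⟪p m, z m⟫ ≤ u x - ⟪p m, x⟫ := by
    intro m x hx hxv
    have h1 := hpz m x hx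
    have h2 := hvu _ (hQD (hz m))
    rw [← hxv] at h1
    have h3 : 0 < 1 / ((m : ℝ) + 1) := by positivity
    refine le_of_mul_le_mul_left ?_ h3
    linarith
  have hlim0 : Filter.Tendsto (fun j => 1 / ((φ j : ℝ) + 1)) Filter.atTop (nhds 0) :=
    tendsto_one_div_add_atTop_nhds_zero_nat.comp hφ.tendsto_atTop
  have hz₀K : u z₀ = v z₀ := by
    refine le_antisymm ?_ (hvu _ (hQD hz₀))
    have h1 : ∀ j, (1 + 1 / ((φ j : ℝ) + 1)) * u (z (φ j)) - v (z (φ j)) -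
      1 / ((φ j : ℝ) + 1) * ⟪p (φ j), z (φ j)⟫ ≤ (1 + 1 / ((φ j : ℝ) + 1)) * u k - v k -
      1 / ((φ j : ℝ) + 1) * ⟪p (φ j), k⟫ := fun j => hpz (φ j) k hkQ
    have h2 := le_of_tendsto_of_tendsto'
      (((((tendsto_const_nhds (x := (1 : ℝ))).add hlim0).mul hlu).sub hlv).sub
        (hlim0.mul (hlp.inner hlz)))
      (((((tendsto_const_nhds (x := (1 : ℝ))).add hlim0).mul_const (u k)).sub_const (v k)).sub
        (hlim0.mul (hlp.inner tendsto_const_nhds))) h1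
    simp only [add_zero, one_mul, zero_mul, sub_zero] at h2
    linarith
  refine (hO.isClosed_compl.mem_of_tendsto hlz (Filter.Eventually.of_forall fun j => hzO _)) ?_
  refine hmin p₀ hp₀ z₀ hz₀ hz₀K fun x hx hxv => ?_
  exact le_of_tendsto_of_tendsto' (hlu.sub (hlp.inner hlz))
    ((tendsto_const_nhds (x := u x)).sub (hlp.inner tendsto_const_nhds)) fun j => hle (φ j) x hx hxv

lemma volume_slopes_le_of_compact (hf : IsDensity D f lam Lam) (hu : IsMA D f u Ru)
    (hv : IsMA D f v Rv) (hvu : ∀ x ∈ D, v x ≤ u x) {Q Z : Set E} (hQ : IsCompact Q)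
    (hQD : Q ⊆ D) (hQK : ∃ x ∈ Q, u x = v x) (hZ : IsCompact Z) (hZQ : Z ⊆ interior Q)
    {P : Set E} (hP : MeasurableSet P)
    (hmin : ∀ p ∈ P, ∀ z ∈ Q, u z = v z →
      (∀ x ∈ Q, u x = v x → u z - ⟪p, z⟫ ≤ u x - ⟪p, x⟫) → z ∈ Z) :
    volume P ≤ ∫⁻ x in Z, ENNReal.ofReal (f x) := by
  refine le_of_forall_lt fun r hr => ?_
  obtain ⟨P', hP'P, hP', hrP'⟩ := hP.exists_lt_isCompact hr
  refine hrP'.trans_le ?_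
  have hLam : 0 < Lam := by
    obtain ⟨x, hx, -⟩ := hQK
    exact hf.pos.trans_le ((hf.lower x (hQD hx)).trans (hf.upper x (hQD hx)))
  refine ENNReal.le_of_forall_pos_le_add fun ε hε hfin => ?_
  obtain ⟨O, hZO, hO, hOv⟩ := hZ.exists_isOpen_lt_add (μ := volume)
    (ε := ENNReal.ofReal (ε / Lam)) (by
      have : 0 < (ε : ℝ) / Lam := by positivity
      simpa using this)
  have h1 : volume P' ≤ ∫⁻ x in O ∩ interior Q, ENNReal.ofReal (f x) :=
    volume_slopes_le_of_contact hf hu hv hvu hQ hQD hQK (hO.inter isOpen_interior)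
      (inter_subset_right.trans interior_subset) hP'
      fun p hp z hz hzv hm => ⟨hZO (hmin p (hP'P hp) z hz hzv hm), hZQ (hmin p (hP'P hp) z hz hzv hm)⟩
  have h2 : volume ((O ∩ interior Q) \ Z) ≤ ENNReal.ofReal (ε / Lam) := by
    refine (measure_mono (sdiff_subset_sdiff_left inter_subset_left)).trans ?_
    rw [measure_sdiff hZO hZ.measurableSet.nullMeasurableSet hZ.measure_lt_top.ne]
    exact tsub_le_iff_left.2 hOv.le
  calc volume P' ≤ _ := h1
    _ ≤ ∫⁻ x in Z ∪ ((O ∩ interior Q) \ Z), ENNReal.ofReal (f x) :=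
        lintegral_mono_set (by rw [union_sdiff_self]; exact subset_union_right)
    _ ≤ _ := lintegral_union_le _ _ _
    _ ≤ (∫⁻ x in Z, ENNReal.ofReal (f x)) + ε := by
        gcongr
        calc ∫⁻ x in (O ∩ interior Q) \ Z, ENNReal.ofReal (f x)
            ≤ ∫⁻ x in (O ∩ interior Q) \ Z, ENNReal.ofReal Lam :=
              setLIntegral_mono measurable_const fun x hx =>
                ENNReal.ofReal_le_ofReal (hf.upper x (hQD (interior_subset hx.1.2)))
          _ ≤ ENNReal.ofReal Lam * ENNReal.ofReal (ε / Lam) := by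
              rw [setLIntegral_const]; gcongr
          _ = ε := by
              rw [← ENNReal.ofReal_mul hLam.le, mul_div_cancel₀ _ hLam.ne', ENNReal.ofReal_coe_nnreal]

/-- If all minimisers on the contact set are interior, then the minimum over the contact set is
the minimum over the whole compact set. -/
lemma exists_contact_minimizer (hf : IsDensity D f lam Lam) (hu : IsMA D f u Ru)
    (hv : IsMA D f v Rv) (hvu : ∀ x ∈ D, v x ≤ u x) {Q B : Set E} (hQ : IsCompact Q)
    (hQD : Q ⊆ D) (hQK : ∃ x ∈ Q, u x = v x) (hB : IsOpen B)
    (hmin : ∀ p ∈ B, ∀ z ∈ Q, u z = v z →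
      (∀ x ∈ Q, u x = v x → u z - ⟪p, z⟫ ≤ u x - ⟪p, x⟫) → z ∈ interior Q) {p : E} (hp : p ∈ B) :
    ∃ z ∈ interior Q, u z = v z ∧ p ∈ sd u z := by
  have huc := hu.lip.continuous
  have hvc := hv.lip.continuous
  have hQKc : IsCompact (Q ∩ {x | u x = v x}) := hQ.inter_right (isClosed_eq huc hvc)
  by_contra hcon
  have hstrict : ∃ y ∈ Q, ∀ z ∈ Q ∩ {x | u x = v x}, u y - ⟪p, y⟫ < u z - ⟪p, z⟫ := by
    by_contra! hall
    obtain ⟨z, hz, hzm⟩ := hQKc.exists_isMinOn hQK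
      (f := fun x => u x - ⟪p, x⟫) (by fun_prop)
    have hzi : z ∈ interior Q := hmin p hp z hz.1 hz.2 fun x hx hxv => hzm ⟨hx, hxv⟩
    refine hcon ⟨z, hzi, hz.2, mem_sd_of_eventually hu.conv ?_⟩
    filter_upwards [isOpen_interior.mem_nhds hzi] with y hy
    obtain ⟨w, hw, hwy⟩ := hall y (interior_subset hy)
    have := hzm hw
    simp only [mem_ofPred_eq] at this
    rw [inner_sub_right]
    linarith
  obtain ⟨y, hyQ, hy⟩ := hstrict
  obtain ⟨m, hm, hmle⟩ := hQKc.exists_forall_le' (f := fun z => u z - ⟪p, z⟫ - (u y - ⟪p, y⟫))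
    (by fun_prop) (a := 0) fun z hz => by linarith [hy z hz]
  obtain ⟨R, hR⟩ := hQ.isBounded.exists_norm_le
  obtain ⟨r, hr, hrB⟩ := Metric.isOpen_iff.1 hB p hp
  have hR0 : 0 ≤ R := (norm_nonneg y).trans (hR y hyQ)
  set ρ : ℝ := min (r / 2) (m / (4 * (R + 1))) with hρ
  have hρ0 : 0 < ρ := by positivity
  set P₁ := Metric.closedBall p ρ with hP₁
  have hP₁B : P₁ ⊆ B := (Metric.closedBall_subset_ball
    ((min_le_left _ _).trans_lt (by linarith))).trans hrB
  have hP₁lt : ∀ q ∈ P₁, ∀ z ∈ Q, u z = v z → u y - ⟪q, y⟫ < u z - ⟪q, z⟫ := by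
    intro q hq z hz hzv
    have h1 := hmle z ⟨hz, hzv⟩
    have h2 : ‖q - p‖ ≤ m / (4 * (R + 1)) := by
      rw [← dist_eq_norm]; exact hq.trans (min_le_right _ _)
    have h3 : ⟪q - p, z - y⟫ ≤ m / (4 * (R + 1)) * (2 * R) := by
      refine (real_inner_le_norm _ _).trans ?_
      refine mul_le_mul h2 ?_ (norm_nonneg _) (by positivity)
      exact (norm_sub_le _ _).trans (by linarith [hR z hz, hR y hyQ])
    have h4 : m / (4 * (R + 1)) * (2 * R) < m := by
      rw [div_mul_eq_mul_div, div_lt_iff₀ (by positivity)]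
      nlinarith
    simp only [inner_sub_left, inner_sub_right] at h3
    linarith
  set W : Set (E × E) := (P₁ ×ˢ (Q ∩ {x | u x = v x})) ∩
    ⋂ x ∈ Q ∩ {x | u x = v x}, {w | u w.2 - ⟪w.1, w.2⟫ ≤ u x - ⟪w.1, x⟫} with hW
  have hWc : IsCompact W := by
    refine ((isCompact_closedBall _ _).prod hQKc).inter_right ?_
    refine isClosed_biInter fun x hx => isClosed_le ?_ ?_ <;> fun_prop
  set Z := Prod.snd '' W with hZ
  have hZc : IsCompact Z := hWc.image continuous_snd
  have hmemZ : ∀ q ∈ P₁, ∀ z ∈ Q, u z = v z →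
      (∀ x ∈ Q, u x = v x → u z - ⟪q, z⟫ ≤ u x - ⟪q, x⟫) → z ∈ Z := by
    intro q hq z hz hzv h
    refine ⟨(q, z), ⟨⟨hq, hz, hzv⟩, ?_⟩, rfl⟩
    simp only [mem_iInter]
    exact fun x hx => h x hx.1 hx.2
  have hZQ : Z ⊆ interior Q := by
    rintro _ ⟨⟨q, z⟩, ⟨⟨hq, hz, hzv⟩, h⟩, rfl⟩
    simp only [mem_iInter] at h
    exact hmin q (hP₁B hq) z hz hzv fun x hx hxv => h x ⟨hx, hxv⟩
  have hZK : ∀ z ∈ Z, u z = v z := by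
    rintro _ ⟨⟨q, z⟩, ⟨⟨hq, hz, hzv⟩, h⟩, rfl⟩
    exact hzv
  have hZD : Z ⊆ D := (hZQ.trans interior_subset).trans hQD
  set P₂ := ⋃ z ∈ Z, sd u z with hP₂
  have hP₂c : IsCompact P₂ := isCompact_iUnion_sd hu.lip hZc
  set Bad : Set E := {p | ∃ x x', x ≠ x' ∧ p ∈ sd u x ∧ p ∈ sd u x'} with hBad
  set P₃ := P₂ \ toMeasurable volume Bad with hP₃
  have hP₃m : MeasurableSet P₃ := hP₂c.measurableSet.diff (measurableSet_toMeasurable _ _)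
  have hP₃v : volume P₃ = volume P₂ := by
    rw [hP₃, measure_sdiff_null]
    rw [measure_toMeasurable]; exact null_multiple_slopes huc
  have hdisj : Disjoint P₁ P₃ := by
    rw [Set.disjoint_left]
    rintro q hq ⟨hq2, -⟩
    simp only [hP₂, mem_iUnion, exists_prop] at hq2
    obtain ⟨z, hzZ, hz⟩ := hq2
    have h1 := hP₁lt q hq z (interior_subset (hZQ hzZ)) (hZK z hzZ)
    have h2 := hz y
    rw [inner_sub_right] at h2
    linarith
  have hle := volume_slopes_le_of_compact hf hu hv hvu hQ hQD hQK hZc hZQ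
    (P := P₁ ∪ P₃) (Metric.isClosed_closedBall.measurableSet.union hP₃m) (by
    rintro q (hq | ⟨hq2, hqb⟩) z hz hzv h
    · exact hmemZ q hq z hz hzv h
    · simp only [hP₂, mem_iUnion, exists_prop] at hq2
      obtain ⟨w, hwZ, hw⟩ := hq2
      have h1 := h w (interior_subset (hZQ hwZ)) (hZK w hwZ)
      have h2 : q ∈ sd u z := by
        intro x
        have := hw x
        rw [inner_sub_right] at this ⊢
        linarith
      by_contra hne
      exact hqb (subset_toMeasurable _ _ ⟨w, z, fun h => hne (h ▸ hwZ), hw, h2⟩))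
  rw [measure_union hdisj hP₃m, hP₃v, ← hu.ma Z hZD hZc.measurableSet, ← hP₂] at hle
  have h0 : volume P₁ ≤ 0 := by
    refine (ENNReal.add_le_add_iff_right (hP₂c.measure_lt_top (μ := volume)).ne).1 ?_
    rwa [zero_add]
  exact absurd h0 (not_le.2 (Metric.measure_closedBall_pos _ _ hρ0))

end ContactSet

section LocalContact

variable {E : Type*} [NormedAddCommGroup E] [InnerProductSpace ℝ E] [FiniteDimensional ℝ E]
  [MeasurableSpace E] [BorelSpace E]
  {D : Set E} {f u v : E → ℝ} {Ru Rv : NNReal} {lam Lam : ℝ}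

/-- Near a strictly supported contact point, all nearby slopes are slopes at contact points. -/
lemma exists_contact_slopes (hf : IsDensity D f lam Lam) (hu : IsMA D f u Ru)
    (hv : IsMA D f v Rv) (hvu : ∀ x ∈ D, v x ≤ u x) {k p : E} (hk : k ∈ D) (hkv : u k = v k)
    (hstrict : ∀ x ∈ D, x ≠ k → u k + ⟪p, x - k⟫ < u x) :
    ∃ r > 0, ∃ δ > 0, Metric.closedBall k r ⊆ D ∧
      ∀ q ∈ Metric.ball p δ, ∃ z ∈ Metric.ball k r, u z = v z ∧ q ∈ sd u z := by
  have huc := hu.lip.continuous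
  obtain ⟨r, hr, hrD⟩ := Metric.nhds_basis_closedBall.mem_iff.1 (hf.isOpen.mem_nhds hk)
  obtain ⟨m, hm, hmle⟩ := (isCompact_sphere k r).exists_forall_le'
    (f := fun x => u x - (u k + ⟪p, x - k⟫)) (by fun_prop) (a := 0) fun x hx => by
      have := hstrict x (hrD (Metric.sphere_subset_closedBall hx))
        (Metric.ne_of_mem_sphere hx hr.ne')
      linarith
  have hmin : ∀ q ∈ Metric.ball p (m / r), ∀ z ∈ Metric.closedBall k r, u z = v z →
      (∀ x ∈ Metric.closedBall k r, u x = v x → u z - ⟪q, z⟫ ≤ u x - ⟪q, x⟫) →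
      z ∈ Metric.ball k r := by
    intro q hq z hz hzv h
    by_contra hzb
    have hzs : dist z k = r := le_antisymm hz (not_lt.1 hzb)
    have h1 := hmle z hzs
    have h2 := h k (Metric.mem_closedBall_self hr.le) hkv
    have h3 : ⟪q - p, z - k⟫ < m := by
      refine (real_inner_le_norm _ _).trans_lt ?_
      rw [← dist_eq_norm, ← dist_eq_norm, hzs]
      exact (lt_div_iff₀ hr).1 hq
    simp only [inner_sub_left, inner_sub_right] at h1 h3
    linarith
  refine ⟨r, hr, m / r, by positivity, hrD, fun q hq => ?_⟩
  obtain ⟨z, hz, hzv, hqz⟩ := exists_contact_minimizer hf hu hv hvu (isCompact_closedBall k r) hrD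
    ⟨k, Metric.mem_closedBall_self hr.le, hkv⟩ Metric.isOpen_ball (fun q hq z hz hzv h =>
      interior_maximal Metric.ball_subset_closedBall Metric.isOpen_ball (hmin q hq z hz hzv h)) hq
  refine ⟨z, hmin q hq z (interior_subset hz) hzv fun x hx hxv => ?_, hzv, hqz⟩
  have := hqz x
  rw [inner_sub_right] at this
  linarith

/-- A point all of whose slopes are slopes at contact points is itself a contact point. -/
lemma contact_of_slopes (hf : IsDensity D f lam Lam) (hu : IsMA D f u Ru) (hvc : Continuous v)
    {B : Set E} (hB : IsOpen B) (hBs : ∀ q ∈ B, ∃ z, u z = v z ∧ q ∈ sd u z) {x : E} (hx : x ∈ D)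
    (hxB : sd u x ⊆ B) : u x = v x := by
  have huc := hu.lip.continuous
  by_contra hne
  have hopen : IsOpen {y | u y ≠ v y} := isOpen_ne_fun huc hvc
  have hev : ∀ᶠ y in nhds x, y ∈ D ∧ u y ≠ v y ∧ sd u y ⊆ B :=
    Filter.eventually_and.2 ⟨hf.isOpen.mem_nhds hx,
      Filter.eventually_and.2 ⟨hopen.mem_nhds hne, eventually_sd_subset hu.lip hB hxB⟩⟩
  obtain ⟨r, hr, hrs⟩ := Metric.eventually_nhds_iff_ball.1 hev
  have h1 := hu.le_volume_sd hf (s := Metric.ball x r) (fun y hy => (hrs y hy).1)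
    Metric.isOpen_ball.measurableSet
  have h2 : volume (⋃ y ∈ Metric.ball x r, sd u y) = 0 := by
    refine measure_mono_null ?_ (null_multiple_slopes huc)
    intro q hq
    simp only [mem_iUnion, exists_prop] at hq
    obtain ⟨y, hy, hqy⟩ := hq
    obtain ⟨-, hyn, hyB⟩ := hrs y hy
    obtain ⟨z, hz, hqz⟩ := hBs q (hyB hqy)
    exact ⟨y, z, fun h => hyn (h ▸ hz), hqy, hqz⟩
  rw [h2] at h1
  have h3 : 0 < ENNReal.ofReal lam * volume (Metric.ball x r) :=
    ENNReal.mul_pos (by simpa using hf.pos) (Metric.measure_ball_pos _ _ hr).ne'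
  exact absurd h1 (not_le.2 h3)

/-- Near a strictly supported contact point there is a ball of contact points. -/
lemma exists_ball_contact (hf : IsDensity D f lam Lam) (hu : IsMA D f u Ru)
    (hv : IsMA D f v Rv) (hvu : ∀ x ∈ D, v x ≤ u x) {k p : E} (hk : k ∈ D) (hkv : u k = v k)
    (hstrict : ∀ x ∈ D, x ≠ k → u k + ⟪p, x - k⟫ < u x) :
    ∃ z ∈ D, ∀ᶠ y in nhds z, u y = v y := by
  obtain ⟨r, hr, δ, hδ, hrD, hs⟩ := exists_contact_slopes hf hu hv hvu hk hkv hstrict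
  set N : Set E := {x | ¬ ∃ A, IsPSD A ∧ SubDiffAt (sd u) x A} with hN
  have hN0 : volume N = 0 := ae_subDiffAt hu.conv hu.lip
  have hI : volume (⋃ x ∈ toMeasurable volume N ∩ D, sd u x) = 0 := by
    have h1 := hu.volume_sd_le hf (s := toMeasurable volume N ∩ D) inter_subset_right
      ((measurableSet_toMeasurable _ _).inter hf.isOpen.measurableSet)
    have h2 : volume (toMeasurable volume N ∩ D) = 0 :=
      measure_mono_null inter_subset_left (by rw [measure_toMeasurable, hN0])
    rw [h2, mul_zero] at h1
    exact le_antisymm h1 zero_le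
  have hex : ∃ q ∈ Metric.ball p δ, q ∉ ⋃ x ∈ toMeasurable volume N ∩ D, sd u x := by
    by_contra! hall
    have := measure_mono_null (fun q hq => hall q hq) hI
    exact (Metric.measure_ball_pos volume p hδ).ne' this
  obtain ⟨q, hq, hqN⟩ := hex
  obtain ⟨z, hz, hzv, hqz⟩ := hs q hq
  have hzD := hrD (Metric.ball_subset_closedBall hz)
  have hzN : ∃ A, IsPSD A ∧ SubDiffAt (sd u) z A := by
    by_contra hcon
    refine hqN ?_
    simp only [mem_iUnion, exists_prop]
    exact ⟨z, ⟨subset_toMeasurable _ _ hcon, hzD⟩, hqz⟩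
  obtain ⟨A, -, hA⟩ := hzN
  have hzs : sd u z ⊆ Metric.ball p δ := fun q' hq' => hA.subsingleton hqz hq' ▸ hq
  refine ⟨z, hzD, ?_⟩
  filter_upwards [eventually_sd_subset hu.lip Metric.isOpen_ball hzs, hf.isOpen.mem_nhds hzD]
    with y hy hyD
  refine contact_of_slopes hf hu hv.lip.continuous Metric.isOpen_ball (fun q hq => ?_) hyD hy
  obtain ⟨z, -, h1, h2⟩ := hs q hq
  exact ⟨z, h1, h2⟩

/-- A boundary point of the contact set lies on a segment along which `u` is affine. -/
lemma exists_leaf (hf : IsDensity D f lam Lam) (hu : IsMA D f u Ru)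
    (hv : IsMA D f v Rv) (hvu : ∀ x ∈ D, v x ≤ u x) {k : E} (hk : k ∈ D) (hkv : u k = v k)
    (hbd : k ∈ closure {x | u x ≠ v x}) :
    ∃ p ∈ sd u k, ∃ x ∈ D, x ≠ k ∧ u x = u k + ⟪p, x - k⟫ := by
  have huc := hu.lip.continuous
  have hvc := hv.lip.continuous
  by_contra! hcon
  have hstrict : ∀ p ∈ sd u k, ∀ x ∈ D, x ≠ k → u k + ⟪p, x - k⟫ < u x := fun p hp x hx hxk =>
    lt_of_le_of_ne (hp x) (hcon p hp x hx hxk).symm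
  have hopen : IsOpen {y | u y ≠ v y} := isOpen_ne_fun huc hvc
  have hfreq : ∃ᶠ x in nhds k, ∃ q, q ∈ sd u x ∧ sd u x ⊆ {q} ∧ u x ≠ v x := by
    rw [Filter.frequently_iff]
    intro U hU
    obtain ⟨U', hU'U, hU'o, hkU'⟩ := mem_nhds_iff.1 hU
    have hne : ({y | u y ≠ v y} ∩ U').Nonempty := by
      rw [inter_comm]; exact mem_closure_iff.1 hbd U' hU'o hkU'
    have hpos : 0 < volume ({y | u y ≠ v y} ∩ U') := (hopen.inter hU'o).measure_pos _ hne
    obtain ⟨x, hx, A, -, hA⟩ : ∃ x ∈ {y | u y ≠ v y} ∩ U', ∃ A, IsPSD A ∧ SubDiffAt (sd u) x A := by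
      by_contra! hall
      refine hpos.ne' (measure_mono_null (fun x hx => ?_)
        (show volume {x | ¬ ∃ A, IsPSD A ∧ SubDiffAt (sd u) x A} = 0 from
          ae_subDiffAt hu.conv hu.lip))
      rintro ⟨A, h1, h2⟩
      exact hall x hx A h1 h2
    obtain ⟨q, hq⟩ := sd_nonempty hu.conv hu.lip x
    exact ⟨x, hU'U hx.2, q, hq, fun q' hq' => hA.subsingleton hq' hq, hx.1⟩
  obtain ⟨x, hxlim, hx⟩ := Filter.exists_seq_forall_of_frequently hfreq
  choose q hq hqs hqv using hx
  obtain ⟨p, -, φ, hφ, hlim⟩ := (isCompact_closedBall (0 : E) Ru).tendsto_subseq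
    (x := q) fun j => by simpa using norm_le_of_mem_sd hu.lip (hq j)
  have hpk : p ∈ sd u k := mem_sd_of_tendsto huc (hxlim.comp hφ.tendsto_atTop) hlim
    (Filter.Eventually.of_forall fun j => hq _)
  obtain ⟨r, hr, δ, hδ, hrD, hs⟩ := exists_contact_slopes hf hu hv hvu hk hkv (hstrict p hpk)
  have hev : ∀ᶠ j in Filter.atTop, q (φ j) ∈ Metric.ball p δ ∧ x (φ j) ∈ D :=
    (hlim.eventually (Metric.ball_mem_nhds p hδ)).and
      ((hxlim.comp hφ.tendsto_atTop).eventually (hf.isOpen.mem_nhds hk))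
  obtain ⟨j, hj, hjD⟩ := hev.exists
  refine hqv (φ j) (contact_of_slopes hf hu hvc (Metric.isOpen_ball (x := p) (ε := δ))
    (fun q hq => ?_) hjD fun q' hq' => ?_)
  · obtain ⟨z, -, h1, h2⟩ := hs q hq
    exact ⟨z, h1, h2⟩
  · rw [mem_singleton_iff.1 (hqs (φ j) hq')]; exact hj

end LocalContact

section Boxes

variable {E : Type*} [NormedAddCommGroup E] [InnerProductSpace ℝ E] [FiniteDimensional ℝ E]

/-- A maximal-determinant frame rounds a convex body. -/
lemma exists_frame {S : Set E} (hS : IsCompact S) (hSc : Convex ℝ S) (hSi : (interior S).Nonempty) :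
    ∃ (a : E) (B : E →L[ℝ] E), Function.Surjective B ∧
      (∀ ξ, ‖ξ‖ ≤ 1 / ((Module.finrank ℝ E : ℝ) + 1) ^ 2 → a + B ξ ∈ S) ∧
      ∀ y ∈ S, ∃ ξ, ‖ξ‖ ≤ 2 * ((Module.finrank ℝ E : ℝ) + 1) ∧ y = a + B ξ := by
  obtain ⟨w, hw⟩ := hSi
  set b := stdOrthonormalBasis ℝ E with hb
  set d := Module.finrank ℝ E with hd
  have hcont : Continuous fun X : Fin d → E => |b.toBasis.det (fun j => X j - w)| := by
    refine continuous_abs.comp ?_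
    simp only [Module.Basis.det_apply]
    refine Continuous.matrix_det (continuous_matrix fun i j => ?_)
    simp only [Module.Basis.toMatrix_apply, OrthonormalBasis.coe_toBasis_repr_apply,
      OrthonormalBasis.repr_apply_apply]
    fun_prop
  have hwS := interior_subset hw
  obtain ⟨X, hX, hXm⟩ := (isCompact_univ_pi fun _ : Fin d => hS).exists_isMaxOn
    ⟨fun _ => w, fun _ _ => hwS⟩ hcont.continuousOn
  obtain ⟨r, hr, hrS⟩ := Metric.nhds_basis_closedBall.mem_iff.1 (mem_interior_iff_mem_nhds.1 hw)
  have hdet0 : b.toBasis.det (fun j => X j - w) ≠ 0 := by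
    have h1 := hXm (a := fun j => w + r • b j) (fun j _ => hrS (by
      simp [norm_smul, abs_of_pos hr]))
    simp only [mem_ofPred_eq, add_sub_cancel_left] at h1
    have h2 : b.toBasis.det (fun j => r • b j) = r ^ d := by
      have := b.toBasis.det.map_smul_univ (fun _ : Fin d => r) (fun j => b j)
      rw [this]
      have h3 : b.toBasis.det (fun j => b j) = 1 := by
        have := b.toBasis.det_self
        rwa [OrthonormalBasis.coe_toBasis] at this
      rw [h3]; simp
    rw [h2] at h1
    intro h0
    rw [h0, abs_zero] at h1
    have : 0 < |r ^ d| := by positivity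
    linarith
  set β : Fin d → E := fun j => X j - w with hβ
  obtain ⟨hli, hsp⟩ := (Module.Basis.is_basis_iff_det b.toBasis).2 (isUnit_iff_ne_zero.2 hdet0)
  set β' := Module.Basis.mk hli hsp.ge with hβ'
  have hβj : ∀ j, β' j = X j - w := fun j => by rw [hβ', Module.Basis.mk_apply]
  set T : E ≃ₗ[ℝ] E := b.toBasis.equiv β' (Equiv.refl _) with hT
  have hTb : ∀ ξ : E, T ξ = ∑ j, ⟪b j, ξ⟫ • (X j - w) := by
    intro ξ
    conv_lhs => rw [← b.sum_repr' ξ]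
    rw [map_sum]
    refine Finset.sum_congr rfl fun j _ => ?_
    rw [map_smul, ← hβj j]
    congr 1
    have := b.toBasis.equiv_apply j β' (Equiv.refl _)
    rwa [OrthonormalBasis.coe_toBasis] at this
  have hcoord : ∀ y ∈ S, ∀ i, |β'.repr (y - w) i| ≤ 1 := by
    intro y hy i
    have h1 := DFunLike.congr_fun (b.toBasis.det_smul_mk_coord_eq_det_update hli hsp.ge i) (y - w)
    have h2 := hXm (a := Function.update X i y) (fun j _ => by
      by_cases hj : j = i
      · subst hj; simpa using hy
      · simpa [hj] using hX j (mem_univ _))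
    have h3 : (fun j => Function.update X i y j - w) = Function.update β i (y - w) := by
      ext j
      by_cases hj : j = i
      · subst hj; simp
      · simp [hj, hβ]
    simp only [mem_ofPred_eq, h3] at h2
    have h4 : b.toBasis.det β * β'.repr (y - w) i = b.toBasis.det (Function.update β i (y - w)) := h1
    rw [← h4, abs_mul] at h2
    have h5 : 0 < |b.toBasis.det β| := abs_pos.2 hdet0
    nlinarith
  have hd1 : (0 : ℝ) < d + 1 := by positivity
  set c : E := ∑ j, ((1 : ℝ) / (d + 1)) • b j with hc
  have hcj : ∀ j, ⟪b j, c⟫ = 1 / (d + 1) := by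
    intro j
    rw [hc, inner_sum]
    simp [inner_smul_right, b.inner_eq_ite]
  refine ⟨w + T c, (T.toLinearMap).toContinuousLinearMap, T.surjective, fun ξ hξ => ?_,
    fun y hy => ?_⟩
  · have hs : ∀ j, |⟪b j, ξ⟫| ≤ 1 / ((d : ℝ) + 1) ^ 2 := fun j =>
      (abs_real_inner_le_norm _ _).trans (by simpa using hξ)
    have heq : w + T c + T ξ = w + ∑ j, ⟪b j, c + ξ⟫ • (X j - w) := by
      rw [add_assoc, ← map_add, hTb]
    have hnn : ∀ j, 0 ≤ ⟪b j, c + ξ⟫ := by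
      intro j
      rw [inner_add_right, hcj]
      have h1 := (abs_le.1 (hs j)).1
      have h2 : 1 / ((d : ℝ) + 1) ^ 2 ≤ 1 / (d + 1) := by
        apply one_div_le_one_div_of_le hd1
        nlinarith [(Nat.cast_nonneg d : (0 : ℝ) ≤ d)]
      linarith
    have hsum : ∑ j, ⟪b j, c + ξ⟫ ≤ 1 := by
      have h1 : ∀ j ∈ Finset.univ, ⟪b j, c + ξ⟫ ≤ 1 / ((d : ℝ) + 1) + 1 / ((d : ℝ) + 1) ^ 2 := by
        intro j _
        rw [inner_add_right, hcj]
        linarith [(abs_le.1 (hs j)).2]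
      refine (Finset.sum_le_sum h1).trans ?_
      rw [Finset.sum_const, Finset.card_univ, Fintype.card_fin, nsmul_eq_mul]
      rw [show (d : ℝ) * (1 / ((d : ℝ) + 1) + 1 / ((d : ℝ) + 1) ^ 2) =
        (d * (d + 1) + d) / ((d : ℝ) + 1) ^ 2 by field_simp]
      rw [div_le_one (by positivity)]
      nlinarith
    change w + T c + T ξ ∈ S
    rw [heq]
    have h2 : w + ∑ j, ⟪b j, c + ξ⟫ • (X j - w) =
        ∑ o : Option (Fin d), (o.elim (1 - ∑ j, ⟪b j, c + ξ⟫) fun j => ⟪b j, c + ξ⟫) •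
          (o.elim w X) := by
      rw [Fintype.sum_option]
      simp only [Option.elim_none, Option.elim_some, smul_sub, Finset.sum_sub_distrib, sub_smul,
        one_smul, Finset.sum_smul]
      abel
    rw [h2]
    refine hSc.sum_mem (fun o _ => ?_) ?_ (fun o _ => ?_)
    · cases o with
      | none => simpa using hsum
      | some j => exact hnn j
    · rw [Fintype.sum_option]; simp
    · cases o with
      | none => exact hwS
      | some j => exact hX j (mem_univ _)
  · refine ⟨T.symm (y - w) - c, ?_, ?_⟩
    · have h1 : ∀ j, ⟪b j, T.symm (y - w)⟫ = β'.repr (y - w) j := by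
        intro j
        have h2 := hTb (T.symm (y - w))
        rw [T.apply_symm_apply] at h2
        conv_rhs => rw [h2, map_sum, Finsupp.finsetSum_apply]
        simp_rw [← hβj, map_smul, β'.repr_self]
        simp [Finsupp.single_apply]
      rw [← b.sum_repr' (T.symm (y - w) - c)]
      refine (norm_sum_le _ _).trans ?_
      have h3 : ∀ j ∈ Finset.univ, ‖⟪b j, T.symm (y - w) - c⟫ • b j‖ ≤ 2 := by
        intro j _
        rw [norm_smul, b.norm_eq_one, mul_one, Real.norm_eq_abs, inner_sub_right, h1, hcj]
        have h4 := abs_le.1 (hcoord y hy j)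
        have h5 : 1 / ((d : ℝ) + 1) ≤ 1 := by
          rw [div_le_one hd1]; linarith [(Nat.cast_nonneg d : (0 : ℝ) ≤ d)]
        have h6 : 0 ≤ 1 / ((d : ℝ) + 1) := by positivity
        rw [abs_le]; constructor <;> linarith
      refine (Finset.sum_le_sum h3).trans ?_
      rw [Finset.sum_const, Finset.card_univ, Fintype.card_fin, nsmul_eq_mul]
      linarith
    · change y = w + T c + T (T.symm (y - w) - c)
      rw [map_sub, T.apply_symm_apply]
      abel

/-- Every convex body is comparable to a box. -/
lemma exists_box {S : Set E} (hS : IsCompact S) (hSc : Convex ℝ S) (hSi : (interior S).Nonempty) :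
    ∃ (a : E) (b : OrthonormalBasis (Fin (Module.finrank ℝ E)) ℝ E)
      (σ : Fin (Module.finrank ℝ E) → ℝ), (∀ i, 0 < σ i) ∧
      (∀ y, (∀ i, |⟪b i, y - a⟫| ≤ 1 / (2 * ((Module.finrank ℝ E : ℝ) + 1) ^ 4) * σ i) → y ∈ S) ∧
      ∀ y ∈ S, ∀ i, |⟪b i, y - a⟫| ≤ σ i := by
  obtain ⟨a, B, hB, hin, hout⟩ := exists_frame hS hSc hSi
  set d := Module.finrank ℝ E with hd
  have hd1 : (0 : ℝ) < d + 1 := by positivity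
  set B' := B.adjoint with hB'
  have hPSD : IsPSD (B.comp B') := by
    refine ⟨fun x y => ?_, fun x => ?_⟩
    · exact (ContinuousLinearMap.adjoint_inner_right B _ _).symm.trans
        (ContinuousLinearMap.adjoint_inner_left B _ _)
    · rw [ContinuousLinearMap.comp_apply, hB', ← ContinuousLinearMap.adjoint_inner_right]
      exact real_inner_self_nonneg
  obtain ⟨b, α, hα, hb⟩ := hPSD.exists_diag
  have hnorm : ∀ i, ‖B' (b i)‖ ^ 2 = α i := by
    intro i
    rw [← real_inner_self_eq_norm_sq, hB', ContinuousLinearMap.adjoint_inner_right]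
    have := hb i
    rw [ContinuousLinearMap.comp_apply] at this
    rw [← hB', this, inner_smul_left, real_inner_self_eq_norm_sq, b.norm_eq_one]
    simp
  have hαpos : ∀ i, 0 < α i := by
    intro i
    refine lt_of_le_of_ne (hα i) fun h0 => ?_
    have h1 : B' (b i) = 0 := by
      have := hnorm i
      rw [← h0] at this
      simpa using this
    obtain ⟨x, hx⟩ := hB (b i)
    have h2 : ⟪B' (b i), x⟫ = ⟪b i, b i⟫ := by
      rw [hB', ContinuousLinearMap.adjoint_inner_left, hx]
    rw [h1, inner_zero_left, real_inner_self_eq_norm_sq, b.norm_eq_one] at h2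
    norm_num at h2
  have hn : ∀ i, ‖B' (b i)‖ = √(α i) := fun i => by
    rw [← hnorm i, Real.sqrt_sq (norm_nonneg _)]
  refine ⟨a, b, fun i => 2 * (d + 1) * √(α i), fun i => by have := hαpos i; positivity,
    fun y hy => ?_, fun y hy i => ?_⟩
  · set ξ := ∑ i, (⟪b i, y - a⟫ / α i) • B' (b i) with hξ
    have h1 : B ξ = y - a := by
      rw [hξ, map_sum]
      conv_rhs => rw [← b.sum_repr' (y - a)]
      refine Finset.sum_congr rfl fun i _ => ?_
      have := hb i
      rw [ContinuousLinearMap.comp_apply] at this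
      rw [map_smul, this, smul_smul, div_mul_cancel₀ _ (hαpos i).ne']
    have h2 : ‖ξ‖ ≤ 1 / ((d : ℝ) + 1) ^ 2 := by
      refine (norm_sum_le _ _).trans ?_
      have h3 : ∀ i ∈ Finset.univ, ‖(⟪b i, y - a⟫ / α i) • B' (b i)‖ ≤ 1 / ((d : ℝ) + 1) ^ 3 := by
        intro i _
        have h4 := hy i
        have h5 : 0 < √(α i) := Real.sqrt_pos.2 (hαpos i)
        have h6 : √(α i) * √(α i) = α i := Real.mul_self_sqrt (hα i)
        have h7 : |⟪b i, y - a⟫| ≤ 1 / ((d : ℝ) + 1) ^ 3 * √(α i) := by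
          refine h4.trans_eq ?_
          field_simp
        rw [norm_smul, hn, Real.norm_eq_abs, abs_div, abs_of_pos (hαpos i),
          div_mul_eq_mul_div, div_le_iff₀ (hαpos i)]
        calc |⟪b i, y - a⟫| * √(α i) ≤ 1 / ((d : ℝ) + 1) ^ 3 * √(α i) * √(α i) := by gcongr
          _ = _ := by rw [mul_assoc, h6]
      refine (Finset.sum_le_sum h3).trans ?_
      rw [Finset.sum_const, Finset.card_univ, Fintype.card_fin, nsmul_eq_mul,
        mul_one_div, div_le_div_iff₀ (by positivity) (by positivity)]
      nlinarith [pow_pos hd1 2]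
    have := hin ξ h2
    rwa [h1, add_sub_cancel] at this
  · obtain ⟨ξ, hξ, rfl⟩ := hout y hy
    rw [add_sub_cancel_left, ← ContinuousLinearMap.adjoint_inner_left, ← hB']
    refine (abs_real_inner_le_norm _ _).trans ?_
    rw [hn, mul_comm]
    exact mul_le_mul_of_nonneg_right hξ (Real.sqrt_nonneg _)

variable [MeasurableSpace E] [BorelSpace E]

lemma volume_box {ι : Type*} [Fintype ι] (b : OrthonormalBasis ι ℝ E) (a : E) (r : ι → ℝ) :
    volume {y : E | ∀ i, |⟪b i, y - a⟫| ≤ r i} = ∏ i, ENNReal.ofReal (2 * r i) := by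
  have h1 : {y : E | ∀ i, |⟪b i, y - a⟫| ≤ r i} =
      b.repr ⁻¹' ((WithLp.ofLp) ⁻¹' Icc (fun i => ⟪b i, a⟫ - r i) (fun i => ⟪b i, a⟫ + r i)) := by
    ext y
    simp only [mem_ofPred_eq, mem_preimage, mem_Icc, Pi.le_def, b.repr_apply_apply,
      inner_sub_right, abs_le, ← forall_and]
    refine forall_congr' fun i => ?_
    constructor <;> rintro ⟨h1, h2⟩ <;> constructor <;> linarith
  rw [h1, b.measurePreserving_repr.measure_preimage
    ((PiLp.volume_preserving_ofLp ι).measurable measurableSet_Icc).nullMeasurableSet,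
    (PiLp.volume_preserving_ofLp ι).measure_preimage measurableSet_Icc.nullMeasurableSet,
    Real.volume_Icc_pi]
  refine Finset.prod_congr rfl fun i _ => ?_
  congr 1; ring

/-- Disjoint translates of a set that is thin in the direction `e`. -/
lemma card_mul_volume_le {S T : Set E} (hS : MeasurableSet S) {e : E} (he : ‖e‖ = 1) {w : ℝ}
    (hw : 0 < w) (hthin : ∀ x ∈ S, ∀ y ∈ S, ⟪x - y, e⟫ < w) {N : ℕ} (t₀ : ℝ)
    (hT : ∀ j < N, ∀ x ∈ S, (t₀ + j * w) • e + x ∈ T) : N * volume S ≤ volume T := by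
  have h1 : ∀ j : ℕ, volume ((fun x => (t₀ + j * w) • e + x) '' S) = volume S := fun j => by
    rw [image_add_left, measure_preimage_add]
  have hm : ∀ j : ℕ, MeasurableSet ((fun x => (t₀ + j * w) • e + x) '' S) := fun j => by
    rw [image_add_left]; exact (measurable_const_add _) hS
  have hdisj : Pairwise (Function.onFun Disjoint
      fun j : Fin N => (fun x => (t₀ + (j : ℕ) * w) • e + x) '' S) := by
    intro i j hij
    rw [Function.onFun, Set.disjoint_left]
    rintro _ ⟨x, hx, rfl⟩ ⟨y, hy, hxy⟩
    have h2 : ∀ i j : ℕ, i < j → ∀ x ∈ S, ∀ y ∈ S,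
        (t₀ + j * w) • e + y ≠ (t₀ + i * w) • e + x := by
      intro i j hij x hx y hy h
      have h3 := hthin x hx y hy
      have h4 : x - y = ((j - i : ℝ) * w) • e := by
        rw [sub_eq_iff_eq_add, eq_comm, ← sub_eq_zero]
        rw [← sub_eq_zero] at h
        rw [← h]; module
      rw [h4, inner_smul_left, real_inner_self_eq_norm_sq, he] at h3
      simp only [conj_trivial, one_pow, mul_one] at h3
      have h5 : (i : ℝ) + 1 ≤ j := by exact_mod_cast hij
      nlinarith
    rcases lt_or_gt_of_ne (Fin.val_ne_of_ne hij) with h | h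
    · exact h2 _ _ h x hx y hy hxy
    · exact h2 _ _ h y hy x hx hxy.symm
  calc (N : ℝ≥0∞) * volume S = ∑ j : Fin N, volume ((fun x => (t₀ + (j : ℕ) * w) • e + x) '' S) := by
        simp only [h1]; simp
    _ = volume (⋃ j : Fin N, (fun x => (t₀ + (j : ℕ) * w) • e + x) '' S) := by
        rw [measure_iUnion hdisj fun j => hm _, tsum_fintype]
    _ ≤ volume T := measure_mono (iUnion_subset fun j => by
        rintro _ ⟨x, hx, rfl⟩; exact hT j j.2 x hx)

end Boxes

section Polarity

variable {E : Type*} [NormedAddCommGroup E] [InnerProductSpace ℝ E]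
  {ψ : E → ℝ} {R : NNReal}

lemma convex_sublevel (hc : ConvexOn ℝ univ ψ) (h : ℝ) :
    Convex ℝ {x : E | ψ x + ‖x‖ ^ 2 / 2 ≤ h} := by
  have h1 : ConvexOn ℝ univ fun x : E => ‖x‖ ^ 2 := (convexOn_norm convex_univ).pow
    (fun x _ => norm_nonneg x) 2
  have h2 := (hc.add (h1.smul (by norm_num : (0 : ℝ) ≤ 1 / 2))).convex_le h
  convert h2 using 1
  ext x
  simp [div_eq_inv_mul]

variable [FiniteDimensional ℝ E]

lemma isCompact_sublevel (hR : LipschitzWith R ψ) (hpos : ∀ x, 0 ≤ ψ x) (h : ℝ) :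
    IsCompact {x : E | ψ x + ‖x‖ ^ 2 / 2 ≤ h} := by
  have hψ := hR.continuous
  refine Metric.isCompact_of_isClosed_isBounded (isClosed_le (by fun_prop) continuous_const)
    ((Metric.isBounded_closedBall (x := (0 : E)) (r := 2 * h + 1)).subset fun x hx => ?_)
  have h1 := hpos x
  simp only [mem_ofPred_eq, mem_closedBall_zero_iff] at hx ⊢
  nlinarith [sq_nonneg (‖x‖ - 1)]

lemma conj_nonneg (hR : LipschitzWith R ψ) (h0 : ψ 0 = 0) (y : E) : 0 ≤ conj ψ y := by
  simpa [h0] using le_conj hR y 0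

lemma norm_prox_le_of_polar (hc : ConvexOn ℝ univ ψ) (hR : LipschitzWith R ψ)
    (hpos : ∀ x, 0 ≤ ψ x) (h0 : ψ 0 = 0) {t : ℝ} (ht : 0 < t) {y : E}
    (hy : ∀ x, ψ x + ‖x‖ ^ 2 / 2 ≤ t ^ 2 → ⟪y, x⟫ ≤ t ^ 2 / 2) : ‖prox ψ y‖ ≤ 2 * t := by
  set x := prox ψ y with hx
  set m := ψ x + ‖x‖ ^ 2 / 2 with hm
  have h1 : m ≤ ⟪y, x⟫ := by
    have := conj_nonneg hR h0 y
    unfold conj at this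
    rw [← hx] at this
    linarith
  have h2 : m ≤ t ^ 2 := by
    by_contra! hlt
    have hm0 : 0 < m := lt_trans (by positivity) hlt
    set s := t ^ 2 / m with hs
    have hs0 : 0 < s := by positivity
    have hs1 : s < 1 := (div_lt_one hm0).2 hlt
    have h3 : ψ (s • x) ≤ s * ψ x := by
      have := hc.2 (mem_univ x) (mem_univ (0 : E)) hs0.le (sub_nonneg.2 hs1.le) (by ring)
      simpa [h0] using this
    have h4 := hy (s • x) (by
      rw [norm_smul, Real.norm_eq_abs, abs_of_pos hs0]
      have h5 : s * m = t ^ 2 := div_mul_cancel₀ _ hm0.ne'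
      have h6 : (s * ‖x‖) ^ 2 ≤ s * ‖x‖ ^ 2 := by
        rw [mul_pow]
        have : s ^ 2 ≤ s := by nlinarith
        gcongr
      rw [← h5, hm]; linarith)
    rw [inner_smul_right] at h4
    have h5 : s * m = t ^ 2 := div_mul_cancel₀ _ hm0.ne'
    have h6 : s * m ≤ s * ⟪y, x⟫ := mul_le_mul_of_nonneg_left h1 hs0.le
    have : 0 < t ^ 2 := by positivity
    linarith
  have h3 := hpos x
  refine abs_le_of_sq_le_sq' ?_ (by positivity) |>.2
  nlinarith

variable [MeasurableSpace E] [BorelSpace E]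

/-- A lower bound for the product of the volumes of a section and of its polar. -/
lemma le_volume_sublevel_mul (hc : ConvexOn ℝ univ ψ) (hR : LipschitzWith R ψ)
    (hpos : ∀ x, 0 ≤ ψ x) (h0 : ψ 0 = 0) {t : ℝ} (ht : 0 < t) :
    ENNReal.ofReal ((t ^ 2 / (2 * ((Module.finrank ℝ E : ℝ) + 1) ^ 5)) ^ Module.finrank ℝ E) ≤
      volume {x : E | ψ x + ‖x‖ ^ 2 / 2 ≤ t ^ 2} * volume {y : E | ‖prox ψ y‖ ≤ 2 * t} := by
  have hsub_int : (interior {x : E | ψ x + ‖x‖ ^ 2 / 2 ≤ t ^ 2}).Nonempty := by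
    have hψ := hR.continuous
    refine ⟨0, mem_interior.2 ⟨{x : E | ψ x + ‖x‖ ^ 2 / 2 < t ^ 2}, fun x hx => le_of_lt hx,
      isOpen_lt (by fun_prop) continuous_const, ?_⟩⟩
    have : 0 < t ^ 2 := by positivity
    simpa [h0] using this
  set d := Module.finrank ℝ E with hd
  obtain ⟨a, b, σ, hσ, hin, hout⟩ := exists_box (isCompact_sublevel hR hpos (t ^ 2))
    (convex_sublevel hc _) hsub_int
  have hd1 : (0 : ℝ) < d + 1 := by positivity
  have hout2 : ∀ x, ψ x + ‖x‖ ^ 2 / 2 ≤ t ^ 2 → ∀ i, |⟪b i, x⟫| ≤ 2 * σ i := by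
    intro x hx i
    have h1 := abs_le.1 (hout x hx i)
    have h2 := abs_le.1 (hout 0 (by simp [h0, sq_nonneg]) i)
    rw [inner_sub_right] at h1 h2
    rw [inner_zero_right] at h2
    rw [abs_le]; constructor <;> linarith
  have hpol : {y : E | ∀ i, |⟪b i, y - 0⟫| ≤ t ^ 2 / (4 * (d + 1) * σ i)} ⊆
      {y : E | ‖prox ψ y‖ ≤ 2 * t} := by
    intro y hy
    refine norm_prox_le_of_polar hc hR hpos h0 ht fun x hx => ?_
    rw [← b.sum_inner_mul_inner y x]
    have h1 : ∀ i ∈ Finset.univ, ⟪y, b i⟫ * ⟪b i, x⟫ ≤ t ^ 2 / (2 * (d + 1)) := by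
      intro i _
      have h2 := hy i
      have h3 := hout2 x hx i
      have h4 := hσ i
      rw [sub_zero, real_inner_comm] at h2
      calc ⟪y, b i⟫ * ⟪b i, x⟫ ≤ |⟪y, b i⟫| * |⟪b i, x⟫| := by
            rw [← abs_mul]; exact le_abs_self _
        _ ≤ t ^ 2 / (4 * (d + 1) * σ i) * (2 * σ i) := by gcongr
        _ = _ := by field_simp; ring
    refine (Finset.sum_le_sum h1).trans ?_
    rw [Finset.sum_const, Finset.card_univ, Fintype.card_fin, nsmul_eq_mul, mul_div_assoc',
      div_le_div_iff₀ (by positivity) (by positivity)]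
    have : 0 < t ^ 2 := by positivity
    nlinarith
  have hv1 := measure_mono (μ := volume) hpol
  have hv2 := measure_mono (μ := volume)
    (show {y : E | ∀ i, |⟪b i, y - a⟫| ≤ 1 / (2 * ((d : ℝ) + 1) ^ 4) * σ i} ⊆
      {x : E | ψ x + ‖x‖ ^ 2 / 2 ≤ t ^ 2} from fun y hy => hin y hy)
  rw [volume_box] at hv1 hv2
  refine le_trans (le_of_eq ?_) (mul_le_mul' hv2 hv1)
  rw [← Finset.prod_mul_distrib]
  have : ∀ i, ENNReal.ofReal (2 * (1 / (2 * ((d : ℝ) + 1) ^ 4) * σ i)) *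
      ENNReal.ofReal (2 * (t ^ 2 / (4 * (d + 1) * σ i))) =
      ENNReal.ofReal (t ^ 2 / (2 * ((d : ℝ) + 1) ^ 5)) := by
    intro i
    have := hσ i
    rw [← ENNReal.ofReal_mul (by positivity)]
    congr 1
    field_simp
    ring
  rw [Finset.prod_congr rfl fun i _ => this i, Finset.prod_const, Finset.card_univ,
    Fintype.card_fin, ENNReal.ofReal_pow (by positivity)]

end Polarity

section Slices

variable {E : Type*} [NormedAddCommGroup E] [InnerProductSpace ℝ E] [FiniteDimensional ℝ E]
  {ψ : E → ℝ} {R : NNReal}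

lemma norm_sub_le_conj (hR : LipschitzWith R ψ) (h0 : ψ 0 = 0) (y : E) :
    ‖y‖ - R - 1 / 2 ≤ conj ψ y := by
  rcases eq_or_ne y 0 with rfl | hy
  · have := conj_nonneg hR h0 (0 : E)
    have := R.2
    simp only [norm_zero]
    linarith [NNReal.coe_nonneg R]
  · have hy' : 0 < ‖y‖ := norm_pos_iff.2 hy
    have h1 := le_conj hR y (‖y‖⁻¹ • y)
    have h2 : ‖‖y‖⁻¹ • y‖ = 1 := by rw [norm_smul, norm_inv, norm_norm, inv_mul_cancel₀ hy'.ne']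
    have h3 : ψ (‖y‖⁻¹ • y) ≤ R := by
      have := hR.dist_le_mul (‖y‖⁻¹ • y) 0
      rw [dist_zero_right, h2, h0, Real.dist_eq, sub_zero, mul_one] at this
      exact (le_abs_self _).trans this
    rw [h2, inner_smul_right, real_inner_self_eq_norm_sq, sq, ← mul_assoc,
      inv_mul_cancel₀ hy'.ne', one_mul] at h1
    linarith

/-- A point in a coordinate slice through a box where the conjugate is small at which the proximal
map is small. -/
lemma exists_slice_min {d : ℕ} (hc : ConvexOn ℝ univ ψ) (hR : LipschitzWith R ψ)
    (h0 : ψ 0 = 0) (b : OrthonormalBasis (Fin d) ℝ E) {a : E} {r : Fin d → ℝ} (hr : ∀ i, 0 < r i)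
    {H : ℝ} (hbox : ∀ y, (∀ i, |⟪b i, y - a⟫| ≤ 2 * r i) → conj ψ y ≤ H) (I : Finset (Fin d))
    {ρ : ℝ} (hρ : 0 ≤ ρ) (hρr : ∀ i ∈ I, d * H ≤ r i * ρ) {q : Fin d → ℝ} (hq : ∀ i, |q i| ≤ r i) :
    ∃ y, (∀ i ∈ I, ⟪b i, y - a⟫ = q i) ∧ ‖prox ψ y‖ ≤ ρ := by
  have hcc : Continuous (conj ψ) :=
    continuous_iff_continuousAt.2 fun y => (hasFDerivAt_conj hc hR y).continuousAt
  set s : Set E := {y | ∀ i ∈ I, ⟪b i, y - a⟫ = q i} with hs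
  have hsc : IsClosed s := by
    have : s = ⋂ i ∈ I, {y | ⟪b i, y - a⟫ = q i} := by ext; simp [hs]
    rw [this]
    exact isClosed_biInter fun i _ => isClosed_eq (by fun_prop) continuous_const
  have hcomb : ∀ (w : Fin d → ℝ) (i : Fin d), ⟪b i, (a + ∑ j, w j • b j) - a⟫ = w i := by
    intro w i
    rw [add_sub_cancel_left, inner_sum]
    simp [inner_smul_right, b.inner_eq_ite]
  have hne : (a + ∑ j, q j • b j) ∈ s := fun i _ => hcomb q i
  have hcoer : ∀ᶠ x in Filter.cocompact E ⊓ Filter.principal s,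
      conj ψ (a + ∑ j, q j • b j) ≤ conj ψ x := by
    refine Filter.Eventually.filter_mono inf_le_left ?_
    filter_upwards [tendsto_norm_cocompact_atTop.eventually_ge_atTop
      (conj ψ (a + ∑ j, q j • b j) + R + 1 / 2)] with x hx
    have := norm_sub_le_conj hR h0 x
    linarith
  obtain ⟨y, hys, hym⟩ := hcc.continuousOn.exists_isMinOn' hsc hne hcoer
  refine ⟨y, hys, ?_⟩
  set x := prox ψ y with hx
  have hout : ∀ l ∉ I, ⟪x, b l⟫ = 0 := by
    intro l hl
    have h1 : HasDerivAt (fun s : ℝ => conj ψ (y + s • b l)) ⟪x, b l⟫ 0 := by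
      have h2 : HasDerivAt (fun s : ℝ => y + s • b l) (b l) 0 := by
        simpa using ((hasDerivAt_id (0 : ℝ)).smul_const (b l)).const_add y
      have h3 : HasFDerivAt (conj ψ) (innerSL ℝ x) (y + (0 : ℝ) • b l) := by
        rw [zero_smul, add_zero]; exact hasFDerivAt_conj hc hR y
      exact h3.comp_hasDerivAt (0 : ℝ) h2
    have hmin : IsLocalMin (fun s : ℝ => conj ψ (y + s • b l)) 0 := by
      refine Filter.Eventually.of_forall fun c => ?_
      simp only
      rw [zero_smul, add_zero]
      refine hym fun i hi => ?_
      have hil : i ≠ l := fun h => hl (h ▸ hi)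
      have := hys i hi
      rw [add_sub_right_comm, inner_add_right, this, inner_smul_right, b.inner_eq_ite, if_neg hil]
      simp
    exact hmin.hasDerivAt_eq_zero h1
  have hside : ∀ l ∈ I, ∀ ε : ℝ, |ε| ≤ 1 → ⟪x, b l⟫ * (ε * r l) ≤ H := by
    intro l hl ε hε
    set w : Fin d → ℝ := fun i => if i ∈ I then q i + (if i = l then ε * r l else 0) else 0 with hw
    have h1 : conj ψ (a + ∑ j, w j • b j) ≤ H := by
      refine hbox _ fun i => ?_
      rw [hcomb, hw]
      have hri := hr i
      have hqi := hq i
      have h3 : |ε * r l| ≤ r l := by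
        rw [abs_mul, abs_of_pos (hr l)]
        have := hr l
        nlinarith
      simp only
      split_ifs with h1 h2
      · subst h2
        refine (abs_add_le _ _).trans ?_
        linarith
      · rw [add_zero]; linarith
      · simp [hri.le]
    have h2 := conj_add_le hR y (a + ∑ j, w j • b j)
    have h3 := conj_nonneg hR h0 y
    have h4 : ⟪x, (a + ∑ j, w j • b j) - y⟫ = ⟪x, b l⟫ * (ε * r l) := by
      rw [← b.sum_inner_mul_inner, Finset.sum_eq_single l]
      · congr 1
        have h5 := hcomb w l
        have h6 := hys l hl
        rw [inner_sub_right] at h5 h6 ⊢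
        have h7 : w l = q l + ε * r l := by simp [hw, hl]
        linarith
      · intro i _ hil
        by_cases hi : i ∈ I
        · have h5 := hcomb w i
          have h6 := hys i hi
          have h7 : w i = q i := by simp [hw, hi, hil]
          rw [inner_sub_right] at h5 h6 ⊢
          rw [mul_eq_zero]; right; linarith
        · rw [hout i hi, zero_mul]
      · simp
    rw [← hx, h4] at h2
    linarith
  have hcoordx : ∀ l, |⟪x, b l⟫| * d ≤ ρ := by
    intro l
    by_cases hl : l ∈ I
    · have h1 := hside l hl 1 (by simp)
      have h2 := hside l hl (-1) (by simp)
      have h3 := hr l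
      have h4 : |⟪x, b l⟫| * r l ≤ H := by
        rcases abs_cases ⟪x, b l⟫ with ⟨h, -⟩ | ⟨h, -⟩ <;> rw [h] <;> linarith
      have h5 := hρr l hl
      have h6 : (d : ℝ) * (|⟪x, b l⟫| * r l) ≤ d * H := by gcongr
      refine le_of_mul_le_mul_left ?_ h3
      linarith
    · rw [hout l hl, abs_zero, zero_mul]; exact hρ
  rw [← b.sum_repr' x]
  refine (norm_sum_le _ _).trans ?_
  rcases Nat.eq_zero_or_pos d with rfl | hd
  · simpa using hρ
  have hd' : (0 : ℝ) < d := by exact_mod_cast hd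
  have h1 : ∀ i ∈ Finset.univ, ‖⟪b i, x⟫ • b i‖ ≤ ρ / d := by
    intro i _
    rw [norm_smul, b.norm_eq_one, mul_one, Real.norm_eq_abs, real_inner_comm, le_div_iff₀ hd']
    exact hcoordx i
  refine (Finset.sum_le_sum h1).trans ?_
  rw [Finset.sum_const, Finset.card_univ, Fintype.card_fin, nsmul_eq_mul, mul_div_cancel₀ _ hd'.ne']

variable [MeasurableSpace E] [BorelSpace E]

/-- Coordinate slices of a box where the conjugate is small contribute many points at which the
proximal map is small. -/
lemma prod_mul_volume_ball_le {d : ℕ} (hc : ConvexOn ℝ univ ψ) (hR : LipschitzWith R ψ)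
    (h0 : ψ 0 = 0) (b : OrthonormalBasis (Fin d) ℝ E) {a : E} {r : Fin d → ℝ} (hr : ∀ i, 0 < r i)
    {H : ℝ} (hbox : ∀ y, (∀ i, |⟪b i, y - a⟫| ≤ 2 * r i) → conj ψ y ≤ H) (I : Finset (Fin d))
    {ρ : ℝ} (hρ : 0 < ρ) (hρr : ∀ i ∈ I, d * H ≤ r i * ρ) :
    ENNReal.ofReal (∏ i ∈ I, r i / (2 * ρ)) * volume (Metric.ball (0 : E) ρ) ≤
      volume {y : E | ‖prox ψ y‖ ≤ 2 * ρ} := by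
  set m : Fin d → ℕ := fun i => ⌊r i / (2 * ρ)⌋₊ + 1 with hm
  set q : ((i : I) → Fin (m i)) → Fin d → ℝ := fun j i =>
    if h : i ∈ I then - (2 * ρ * ((j ⟨i, h⟩ : ℕ) : ℝ)) else 0 with hq
  have hqr : ∀ j i, |q j i| ≤ r i := by
    intro j i
    simp only [hq]
    split_ifs with h
    · rw [abs_neg, abs_of_nonneg (by positivity)]
      have h1 : ((j ⟨i, h⟩ : ℕ) : ℝ) ≤ r i / (2 * ρ) := by
        have h2 := (j ⟨i, h⟩).2
        have h3 : (j ⟨i, h⟩ : ℕ) ≤ ⌊r i / (2 * ρ)⌋₊ := Nat.lt_succ_iff.1 h2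
        exact (Nat.cast_le.2 h3).trans (Nat.floor_le (by have := hr i; positivity))
      rw [le_div_iff₀ (by positivity)] at h1
      linarith
    · simpa using (hr i).le
  choose y hy hyρ using fun j => exists_slice_min hc hR h0 b hr hbox I hρ.le hρr (hqr j)
  have hdisj : Pairwise (Function.onFun Disjoint fun j => Metric.ball (y j) ρ) := by
    intro j j' hjj
    obtain ⟨⟨i, hi⟩, hne⟩ := Function.ne_iff.1 hjj
    refine Metric.ball_disjoint_ball ?_
    have h1 : ⟪b i, y j - y j'⟫ = q j i - q j' i := by
      have h2 := hy j i hi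
      have h3 := hy j' i hi
      rw [inner_sub_right] at h2 h3 ⊢
      linarith
    have h2 : |⟪b i, y j - y j'⟫| ≤ dist (y j) (y j') := by
      rw [dist_eq_norm]
      simpa using abs_real_inner_le_norm (b i) (y j - y j')
    refine le_trans ?_ h2
    rw [h1]
    simp only [hq, dif_pos hi]
    have h3 : (1 : ℝ) ≤ |((j ⟨i, hi⟩ : ℕ) : ℝ) - ((j' ⟨i, hi⟩ : ℕ) : ℝ)| := by
      have h4 : ((j ⟨i, hi⟩ : ℕ) : ℤ) - ((j' ⟨i, hi⟩ : ℕ) : ℤ) ≠ 0 := by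
        rw [sub_ne_zero]; exact_mod_cast fun h => hne (Fin.ext h)
      have := Int.one_le_abs h4
      exact_mod_cast this
    rw [show -(2 * ρ * ((j ⟨i, hi⟩ : ℕ) : ℝ)) - -(2 * ρ * ((j' ⟨i, hi⟩ : ℕ) : ℝ)) =
      -(2 * ρ * (((j ⟨i, hi⟩ : ℕ) : ℝ) - ((j' ⟨i, hi⟩ : ℕ) : ℝ))) by ring, abs_neg, abs_mul,
      abs_of_pos (by positivity)]
    nlinarith
  have hsub : (⋃ j, Metric.ball (y j) ρ) ⊆ {y : E | ‖prox ψ y‖ ≤ 2 * ρ} := by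
    refine iUnion_subset fun j z hz => ?_
    have h1 := (lipschitz_prox hc hR).dist_le_mul z (y j)
    rw [NNReal.coe_one, one_mul, dist_eq_norm] at h1
    have h2 := norm_le_norm_add_norm_sub' (prox ψ z) (prox ψ (y j))
    have h3 := hyρ j
    have h4 : dist z (y j) < ρ := hz
    simp only [mem_ofPred_eq]
    linarith
  refine le_trans ?_ (measure_mono hsub)
  rw [measure_iUnion hdisj fun j => Metric.isOpen_ball.measurableSet, tsum_fintype]
  simp only [Measure.addHaar_ball_center]
  rw [Finset.sum_const, Finset.card_univ, Fintype.card_pi, nsmul_eq_mul]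
  gcongr
  simp only [Fintype.card_fin]
  rw [← ENNReal.ofReal_natCast]
  refine ENNReal.ofReal_le_ofReal ?_
  rw [Nat.cast_prod, Finset.prod_coe_sort I (fun i => ((m i : ℕ) : ℝ))]
  refine Finset.prod_le_prod (fun i _ => by have := hr i; positivity) fun i _ => ?_
  rw [hm]
  push_cast
  exact (Nat.lt_floor_add_one _).le

end Slices

section LargeFactor

lemma exists_large_factor {ι : Type*} [DecidableEq ι] {C : ℝ} (hC : 0 < C) (m : ℕ) :
    ∀ c : ℝ, 0 < c → ∃ c' : ℝ, 0 < c' ∧ ∀ (T : ℝ) (s : ι → ℝ) (I : Finset ι), 0 < T →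
      I.card = m + 1 → (∀ i, 1 ≤ s i) →
      (∀ J : Finset ι, ∀ i ∈ J, (∀ j ∈ J, s i ≤ s j) →
        (∏ j ∈ J, s j) * s i ^ (J.card - 1) ≤ C * T) →
      c * T ≤ ∏ i ∈ I, s i → ∃ i ∈ I, c' * T ≤ s i := by
  induction m with
  | zero =>
    intro c hc
    refine ⟨c, hc, fun T s I hT hI hs hJ h => ?_⟩
    obtain ⟨i, rfl⟩ := Finset.card_eq_one.1 hI
    exact ⟨i, by simp, by simpa using h⟩
  | succ m ih =>
    intro c hc
    obtain ⟨c', hc', h'⟩ := ih (c * c / C) (by positivity)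
    refine ⟨c', hc', fun T s I hT hI hs hJ h => ?_⟩
    obtain ⟨i, hi, hmin⟩ := I.exists_min_image s (Finset.card_pos.1 (by omega))
    have h1 := hJ I i hi hmin
    rw [hI, Nat.add_sub_cancel] at h1
    have hi1 := hs i
    have h2 : s i ≤ s i ^ (m + 1) := le_self_pow₀ hi1 (by omega)
    have h3 : c * s i ≤ C := by
      have h4 : (c * T) * s i ≤ C * T := by
        refine le_trans ?_ h1
        gcongr
        exact Finset.prod_nonneg fun j _ => by linarith [hs j]
      refine le_of_mul_le_mul_right ?_ hT
      linarith
    have h4 : (I.erase i).card = m + 1 := by rw [Finset.card_erase_of_mem hi]; omega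
    obtain ⟨j, hj, hj'⟩ := h' T s (I.erase i) hT h4 hs hJ (by
      rw [← Finset.mul_prod_erase I s hi] at h
      have h5 : 0 < ∏ j ∈ I.erase i, s j := Finset.prod_pos fun j _ => by linarith [hs j]
      set P := ∏ j ∈ I.erase i, s j
      have h6 : c * (c * T) ≤ C * P := by
        calc c * (c * T) ≤ c * (s i * P) := by gcongr
          _ = (c * s i) * P := by ring
          _ ≤ C * P := by gcongr
      rw [div_mul_eq_mul_div, div_le_iff₀ hC]
      linarith)
    exact ⟨j, Finset.mem_of_mem_erase hj, hj'⟩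

end LargeFactor

section Radius

variable {E : Type*} [NormedAddCommGroup E] [InnerProductSpace ℝ E] [FiniteDimensional ℝ E]
  [MeasurableSpace E] [BorelSpace E] {ψ : E → ℝ} {R : NNReal}

/-- A convex set on which the conjugate is small and whose volume is not too small must be long
in some direction, provided that the proximal map is not too often small. -/
lemma exists_le_radius (hd : 0 < Module.finrank ℝ E) (hc : ConvexOn ℝ univ ψ)
    (hR : LipschitzWith R ψ) (h0 : ψ 0 = 0) {M c : ℝ} (hM : 0 < M) (hc0 : 0 < c)
    (hprox : ∀ ρ : ℝ, 0 < ρ → ρ ≤ 1 →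
      volume {y : E | ‖prox ψ y‖ ≤ ρ} ≤ ENNReal.ofReal (M * ρ ^ (Module.finrank ℝ E - 1))) :
    ∃ c' : ℝ, 0 < c' ∧ ∀ (t : ℝ) (A : Set E) (r : ℝ), 0 < t → t ≤ c' → IsCompact A →
      Convex ℝ A → Metric.closedBall 0 t ⊆ A → (∀ y ∈ A, conj ψ y ≤ 2 * t ^ 2) →
      ENNReal.ofReal (c * t ^ (Module.finrank ℝ E - 1)) ≤ volume A →
      A ⊆ Metric.closedBall 0 r → c' ≤ r := by
  set d := Module.finrank ℝ E with hdd
  obtain ⟨m, hm⟩ : ∃ m, d = m + 1 := ⟨d - 1, by omega⟩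
  have hdR : (0 : ℝ) < d := by exact_mod_cast hd
  set κ : ℝ := 1 / (2 * ((d : ℝ) + 1) ^ 4) with hκ
  have hκ0 : 0 < κ := by positivity
  have hκ1 : κ ≤ 1 := by
    rw [hκ, div_le_one (by positivity)]
    have : (1 : ℝ) ≤ (d + 1) ^ 4 := one_le_pow₀ (by linarith)
    linarith
  set ω : ℝ := (volume (Metric.ball (0 : E) 1)).toReal with hω
  have hω0 : 0 < ω := ENNReal.toReal_pos (Metric.measure_ball_pos volume _ one_pos).ne'
    measure_ball_lt_top.ne
  set B : ℝ := 16 * d / κ ^ 2 with hB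
  have hd1 : (1 : ℝ) ≤ d := by exact_mod_cast hd
  have hB1 : 1 ≤ B := by
    rw [hB, le_div_iff₀ (by positivity)]
    nlinarith
  set C : ℝ := M * 2 ^ m * κ / (4 * d * ω) * B ^ d with hC
  have hC0 : 0 < C := by positivity
  obtain ⟨c₁, hc₁, hlarge⟩ := exists_large_factor (ι := Fin d) hC0 m (c / 2 ^ d) (by positivity)
  refine ⟨min (κ * c₁) (κ / (8 * d)), by positivity, ?_⟩
  intro t A r ht htc hA hAc hball hconj hvol hAr
  have ht1 : 8 * d * t ≤ κ := by
    have := htc.trans (min_le_right _ _)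
    rw [le_div_iff₀ (by positivity)] at this
    linarith
  obtain ⟨a, b, σ, hσ, hin, hout⟩ := exists_box hA hAc
    ⟨0, mem_interior.2 ⟨Metric.ball 0 t, Metric.ball_subset_closedBall.trans hball,
      Metric.isOpen_ball, Metric.mem_ball_self ht⟩⟩
  have hσt : ∀ i, t ≤ σ i := by
    intro i
    have h1 : t • b i ∈ A := hball (by
      rw [mem_closedBall_zero_iff, norm_smul, b.norm_eq_one, mul_one, Real.norm_eq_abs,
        abs_of_pos ht])
    have h2 : (-t) • b i ∈ A := hball (by
      rw [mem_closedBall_zero_iff, norm_smul, b.norm_eq_one, mul_one, Real.norm_eq_abs,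
        abs_neg, abs_of_pos ht])
    have h3 := abs_le.1 (hout _ h1 i)
    have h4 := abs_le.1 (hout _ h2 i)
    rw [inner_sub_right, inner_smul_right, real_inner_self_eq_norm_sq, b.norm_eq_one] at h3 h4
    linarith [h3.2, h4.1]
  set s : Fin d → ℝ := fun i => σ i / t with hs
  have hs1 : ∀ i, 1 ≤ s i := fun i => (one_le_div ht).2 (hσt i)
  have hJ : ∀ J : Finset (Fin d), ∀ i ∈ J, (∀ j ∈ J, s i ≤ s j) →
      (∏ j ∈ J, s j) * s i ^ (J.card - 1) ≤ C * (1 / t) := by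
    intro J i hi hmin
    have hsi : 0 < s i := by linarith [hs1 i]
    set ρ : ℝ := 4 * d / κ * (t / s i) with hρ
    have hρ0 : 0 < ρ := by positivity
    have hρ1 : 2 * ρ ≤ 1 := by
      have h1 : t / s i ≤ t := div_le_self ht.le (hs1 i)
      have h2 : 2 * ρ ≤ 2 * (4 * d / κ * t) := by rw [hρ]; gcongr
      refine h2.trans ?_
      rw [div_mul_eq_mul_div, mul_div_assoc', div_le_one hκ0]
      linarith
    have h1 := prod_mul_volume_ball_le hc hR h0 b (a := a) (r := fun j => κ * σ j / 2)
      (fun j => by have := hσ j; positivity) (H := 2 * t ^ 2)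
      (fun y hy => hconj y (hin y fun j => (hy j).trans (le_of_eq (by ring)))) J hρ0 (by
        intro j hj
        have h2 := hmin j hj
        have h3 : σ j = s j * t := by rw [hs]; field_simp
        rw [h3, hρ]
        have h4 : κ * (s j * t) / 2 * (4 * d / κ * (t / s i)) = 2 * d * t ^ 2 * (s j / s i) := by
          field_simp
          ring
        rw [h4]
        have h5 : 1 ≤ s j / s i := (one_le_div hsi).2 h2
        have h6 : 0 < 2 * d * t ^ 2 := by positivity
        nlinarith)
    have h2 := h1.trans (hprox (2 * ρ) (by positivity) hρ1)
    have hρd : ρ ^ Module.finrank ℝ E = ρ ^ m * ρ := by rw [← hdd, hm, pow_succ]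
    have hρd' : (2 * ρ) ^ (d - 1) = 2 ^ m * ρ ^ m := by rw [hm, Nat.add_sub_cancel, mul_pow]
    rw [Measure.addHaar_ball_of_pos _ _ hρ0,
      ← ENNReal.ofReal_toReal (a := volume (Metric.ball (0 : E) 1)) measure_ball_lt_top.ne, ← hω,
      hρd, hρd', ← ENNReal.ofReal_mul (by positivity),
      ← ENNReal.ofReal_mul (Finset.prod_nonneg fun j _ => by have := hσ j; positivity),
      ENNReal.ofReal_le_ofReal_iff (by positivity)] at h2
    have h3 : ∀ j ∈ J, κ * σ j / 2 / (2 * ρ) = (s i / B) * s j := by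
      intro j _
      have h3 : σ j = s j * t := by rw [hs]; field_simp
      rw [h3, hρ, hB]
      field_simp
      ring
    rw [Finset.prod_congr rfl h3, Finset.prod_mul_distrib, Finset.prod_const] at h2
    set P := ∏ j ∈ J, s j with hP
    have hP0 : 0 < P := Finset.prod_pos fun j _ => by linarith [hs1 j]
    have hcard : J.card ≤ d := by simpa using J.card_le_univ
    obtain ⟨k, hk⟩ : ∃ k, J.card = k + 1 :=
      ⟨J.card - 1, by have := Finset.card_pos.2 ⟨i, hi⟩; omega⟩
    rw [hk] at h2 hcard ⊢
    rw [Nat.add_sub_cancel]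
    have h4 : (s i / B) ^ (k + 1) * P * ρ * ω ≤ M * 2 ^ m := by
      refine le_of_mul_le_mul_right ?_ (show 0 < ρ ^ m by positivity)
      linarith
    have h5 : B ^ (k + 1) ≤ B ^ d := pow_le_pow_right₀ hB1 hcard
    have h6 : (s i / B) ^ (k + 1) * P * ρ * ω =
        (P * s i ^ k) * (4 * d / κ * t * ω / B ^ (k + 1)) := by
      rw [hρ, div_pow, pow_succ (s i)]
      field_simp
    rw [h6, ← le_div_iff₀ (by positivity)] at h4
    refine h4.trans ?_
    have h7 : M * 2 ^ m / (4 * d / κ * t * ω / B ^ (k + 1)) =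
        M * 2 ^ m * κ / (4 * d * ω) * B ^ (k + 1) * (1 / t) := by
      field_simp
    rw [h7, hC]
    gcongr
  have hprod : c / 2 ^ d * (1 / t) ≤ ∏ i, s i := by
    have h1 := hvol.trans (measure_mono (show A ⊆ {y | ∀ i, |⟪b i, y - a⟫| ≤ σ i} from
      fun y hy => hout y hy))
    rw [volume_box, ← ENNReal.ofReal_prod_of_nonneg (fun i _ => by have := hσ i; positivity),
      ENNReal.ofReal_le_ofReal_iff (Finset.prod_nonneg fun i _ => by have := hσ i; positivity)] at h1
    have h2 : ∀ i ∈ Finset.univ, 2 * σ i = (2 * t) * s i := by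
      intro i _
      rw [hs]; field_simp
    rw [Finset.prod_congr rfl h2, Finset.prod_mul_distrib, Finset.prod_const, Finset.card_univ,
      Fintype.card_fin] at h1
    have h3 : c * t ^ (d - 1) = c / 2 ^ d * (1 / t) * (2 * t) ^ d := by
      rw [mul_pow, hm, Nat.add_sub_cancel, pow_succ t]
      field_simp
    rw [h3, mul_comm ((2 * t) ^ d)] at h1
    exact le_of_mul_le_mul_right h1 (by positivity)
  obtain ⟨i, -, hi⟩ := hlarge (1 / t) s Finset.univ (by positivity) (by simp [hm]) hs1 hJ hprod
  have hσi : c₁ ≤ σ i := by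
    simp only [hs] at hi
    rw [mul_one_div] at hi
    exact (div_le_div_iff_of_pos_right ht).1 hi
  refine (min_le_left _ _).trans ?_
  have hmem : ∀ ε : ℝ, |ε| = 1 → a + (ε * (κ * σ i)) • b i ∈ A := by
    intro ε hε
    refine hin _ fun j => ?_
    rw [add_sub_cancel_left, inner_smul_right, b.inner_eq_ite]
    have := hσ j
    split_ifs with h
    · rw [h, mul_one, abs_mul, hε, one_mul, abs_of_pos (by have := hσ i; positivity)]
    · rw [mul_zero, abs_zero]; positivity
  have h1 := hAr (hmem 1 (by simp))
  have h2 := hAr (hmem (-1) (by simp))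
  rw [mem_closedBall_zero_iff] at h1 h2
  have h3 := norm_sub_le (a + (1 * (κ * σ i)) • b i) (a + (-1 * (κ * σ i)) • b i)
  rw [add_sub_add_left_eq_sub, ← sub_smul, norm_smul, b.norm_eq_one, mul_one, Real.norm_eq_abs] at h3
  have h4 := le_abs_self (1 * (κ * σ i) - -1 * (κ * σ i))
  have h5 : κ * c₁ ≤ κ * σ i := by gcongr
  linarith

end Radius

section Leaf

variable {E : Type*} [NormedAddCommGroup E] [InnerProductSpace ℝ E]

/-- A nonnegative function vanishing on the segment from `0` to `L • e`, normalized so that `0` is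
an extreme point, in the direction `μ`, of the slopes at `0` orthogonal to `e`. -/
structure IsFlat (ψ : E → ℝ) (e μ : E) (L : ℝ) : Prop where
  norm_eq : ‖e‖ = 1
  pos : 0 < L
  nonneg : ∀ x, 0 ≤ ψ x
  flat : ∀ t, 0 ≤ t → t ≤ L → ψ (t • e) = 0
  exposed : ∀ q ∈ sd ψ 0, 0 ≤ ⟪q, e⟫ → 0 ≤ ⟪q, μ⟫ → q = 0

variable {ψ : E → ℝ} {R : NNReal} {e μ : E} {L : ℝ}

lemma IsFlat.zero (hF : IsFlat ψ e μ L) : ψ 0 = 0 := by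
  simpa using hF.flat 0 le_rfl hF.pos.le

/-- Estimates on slopes at points near the middle of the segment. -/
lemma IsFlat.slope_bounds (hF : IsFlat ψ e μ L) (hc : ConvexOn ℝ univ ψ)
    {h s : ℝ} {z w x p : E} (hz : ψ z ≤ h) (hw : ψ w ≤ h) (hs : L / 4 ≤ s)
    (hs' : s ≤ 3 * L / 4) (hx : x = (1 / 6 : ℝ) • (s • e + z + w)) (hp : p ∈ sd ψ x) :
    (∀ y, ⟪p, y⟫ ≤ ψ y + h) ∧ -(16 * h / L) ≤ ⟪p, e⟫ ∧ ⟪p, e⟫ ≤ h / L ∧ -(3 * h) ≤ ⟪p, z⟫ := by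
  have hL := hF.pos
  have hse : ψ (s • e) = 0 := hF.flat s (by linarith) (by linarith)
  have hx0 := hF.nonneg x
  have h1 : 0 ≤ ⟪p, x⟫ := by
    have := hp 0
    rw [hF.zero, zero_sub, inner_neg_right] at this
    linarith
  have h2 : ψ ((2 : ℝ) • x) ≤ h := by
    have hi : (2 : ℝ) • x = (1 / 3 : ℝ) • s • e + (2 / 3 : ℝ) • ((1 / 2 : ℝ) • z + (1 / 2 : ℝ) • w) := by
      rw [hx]; module
    have h3 := hc.2 (mem_univ z) (mem_univ w) (by norm_num : (0 : ℝ) ≤ 1 / 2)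
      (by norm_num : (0 : ℝ) ≤ 1 / 2) (by norm_num)
    have h4 := hc.2 (mem_univ (s • e)) (mem_univ ((1 / 2 : ℝ) • z + (1 / 2 : ℝ) • w))
      (by norm_num : (0 : ℝ) ≤ 1 / 3) (by norm_num : (0 : ℝ) ≤ 2 / 3) (by norm_num)
    rw [hi]
    simp only [smul_eq_mul] at h3 h4
    have := hF.nonneg z
    linarith
  have h3 : ⟪p, x⟫ ≤ h := by
    have := hp ((2 : ℝ) • x)
    rw [two_smul, add_sub_cancel_right, ← two_smul ℝ] at this
    linarith
  have h4 : ∀ y, ⟪p, y⟫ ≤ ψ y + h := by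
    intro y
    have := hp y
    rw [inner_sub_right] at this
    linarith
  have h5 := h4 (s • e)
  have h6 := h4 z
  have h7 := h4 w
  have h8 := h4 (L • e)
  rw [hF.flat L hL.le le_rfl, inner_smul_right] at h8
  rw [hse, inner_smul_right] at h5
  have h9 : 0 ≤ s * ⟪p, e⟫ + ⟪p, z⟫ + ⟪p, w⟫ := by
    rw [hx, inner_smul_right, inner_add_right, inner_add_right, inner_smul_right] at h1
    linarith
  have hh : 0 ≤ h := (hF.nonneg z).trans hz
  refine ⟨h4, ?_, ?_, by linarith⟩
  · rw [neg_le, ← neg_le_neg_iff, neg_neg]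
    have h10 : -(4 * h) ≤ s * ⟪p, e⟫ := by linarith
    by_contra! hlt
    have h11 : ⟪p, e⟫ < -(16 * h / L) := by linarith
    have h12 : (L / 4) * (16 * h / L) = 4 * h := by field_simp; ring
    have h13 : 0 ≤ 16 * h / L := by positivity
    nlinarith
  · rw [le_div_iff₀ hL]; linarith

variable [FiniteDimensional ℝ E]

lemma IsFlat.norm_lt (hF : IsFlat ψ e μ L) (hR : LipschitzWith R ψ) {ε : ℝ} (hε : 0 < ε) :
    ∃ τ : ℝ, 0 < τ ∧ ∀ p, (∀ x, ⟪p, x⟫ ≤ ψ x + τ) → -τ ≤ ⟪p, e⟫ → -τ ≤ ⟪p, μ⟫ → ‖p‖ < ε := by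
  by_contra! hcon
  have hpos : ∀ n : ℕ, (0 : ℝ) < 1 / ((n : ℝ) + 1) := fun n => by positivity
  choose p hp1 hp2 hp3 hp4 using fun n : ℕ => hcon _ (hpos n)
  have hbd : ∀ n, p n ∈ Metric.closedBall (0 : E) (R + 1) := by
    intro n
    rw [mem_closedBall_zero_iff]
    have h1 : 0 < ‖p n‖ := hε.trans_le (hp4 n)
    have h2 := hp1 n (‖p n‖⁻¹ • p n)
    have h3 : ‖‖p n‖⁻¹ • p n‖ = 1 := by
      rw [norm_smul, norm_inv, norm_norm, inv_mul_cancel₀ h1.ne']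
    have h4 := hR.dist_le_mul (‖p n‖⁻¹ • p n) 0
    rw [dist_zero_right, h3, hF.zero, Real.dist_eq, sub_zero, mul_one] at h4
    rw [inner_smul_right, real_inner_self_eq_norm_sq, sq, ← mul_assoc,
      inv_mul_cancel₀ h1.ne', one_mul] at h2
    have h5 : 1 / ((n : ℝ) + 1) ≤ 1 := by
      rw [div_le_one (by positivity)]
      have : (0 : ℝ) ≤ n := n.cast_nonneg
      linarith
    linarith [le_abs_self (ψ (‖p n‖⁻¹ • p n))]
  obtain ⟨q, -, φ, hφ, hq⟩ := (isCompact_closedBall (0 : E) (R + 1)).tendsto_subseq hbd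
  have hlim : Filter.Tendsto (fun n : ℕ => 1 / ((φ n : ℝ) + 1)) Filter.atTop (nhds 0) :=
    (tendsto_one_div_add_atTop_nhds_zero_nat (𝕜 := ℝ)).comp hφ.tendsto_atTop
  have hin : ∀ x, Filter.Tendsto (fun n => ⟪p (φ n), x⟫) Filter.atTop (nhds ⟪q, x⟫) :=
    fun x => hq.inner tendsto_const_nhds
  have hq0 : q = 0 := by
    refine hF.exposed q (fun x => ?_) ?_ ?_
    · rw [hF.zero, zero_add, sub_zero]
      have := le_of_tendsto_of_tendsto' (hin x) (tendsto_const_nhds.add hlim)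
        (fun n => hp1 (φ n) x)
      simpa using this
    · have := le_of_tendsto_of_tendsto' hlim.neg (hin e) (fun n => hp2 (φ n))
      simpa using this
    · have := le_of_tendsto_of_tendsto' hlim.neg (hin μ) (fun n => hp3 (φ n))
      simpa using this
  have := ge_of_tendsto' hq.norm (fun n => hp4 (φ n))
  rw [hq0, norm_zero] at this
  linarith

lemma IsFlat.le_mul (hF : IsFlat ψ e μ L) (hc : ConvexOn ℝ univ ψ) (hR : LipschitzWith R ψ)
    {τ : ℝ} (hτ : 0 < τ) :
    ∃ s₁ : ℝ, 0 < s₁ ∧ ∀ s, 0 ≤ s → s ≤ s₁ → ψ ((L / 2) • e + s • μ) ≤ τ * s := by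
  have hL := hF.pos
  have hmid : ψ ((L / 2) • e) = 0 := hF.flat _ (by linarith) (by linarith)
  have hsub : sd ψ ((L / 2) • e) ⊆ {q | ⟪q, μ⟫ < τ} := by
    intro q hq
    have hee : ⟪q, e⟫ = 0 := by
      have h1 := hq (0 : E)
      have h2 := hq (L • e)
      rw [hmid, hF.zero, zero_sub, inner_neg_right, inner_smul_right] at h1
      rw [hmid, hF.flat L hL.le le_rfl, ← sub_smul, inner_smul_right] at h2
      nlinarith
    have hq0 : q ∈ sd ψ 0 := by
      intro y
      have := hq y
      rw [hmid, inner_sub_right, inner_smul_right, hee] at this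
      rw [hF.zero, sub_zero]
      linarith
    rcases le_or_gt 0 ⟪q, μ⟫ with h | h
    · have := hF.exposed q hq0 hee.ge h
      simp [this, hτ]
    · exact h.trans hτ
  have hev := eventually_sd_subset hR (isOpen_lt (by fun_prop) continuous_const) hsub
  have htend : Filter.Tendsto (fun s : ℝ => (L / 2) • e + s • μ) (nhds 0)
      (nhds ((L / 2) • e)) := by
    have : Continuous fun s : ℝ => (L / 2) • e + s • μ := by fun_prop
    simpa using this.tendsto 0
  obtain ⟨δ, hδ, hball⟩ := Metric.eventually_nhds_iff.1 (htend.eventually hev)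
  refine ⟨δ / 2, by positivity, fun s hs hs1 => ?_⟩
  obtain ⟨q, hq⟩ := sd_nonempty hc hR ((L / 2) • e + s • μ)
  have h1 : ⟪q, μ⟫ < τ := hball (by rw [Real.dist_eq, sub_zero, abs_of_nonneg hs]; linarith) hq
  have h2 := hq ((L / 2) • e)
  rw [hmid, sub_add_cancel_left, inner_neg_right, inner_smul_right] at h2
  nlinarith

variable [MeasurableSpace E] [BorelSpace E]

lemma IsFlat.le_volume_section (hF : IsFlat ψ e μ L) (hc : ConvexOn ℝ univ ψ)
    (hR : LipschitzWith R ψ) {M : ℝ} (hM : 0 < M)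
    (hprox : ∀ ρ : ℝ, 0 < ρ → ρ ≤ 1 →
      volume {y : E | ‖prox ψ y‖ ≤ ρ} ≤ ENNReal.ofReal (M * ρ ^ (Module.finrank ℝ E - 1))) :
    ∃ c : ℝ, 0 < c ∧ ∀ t : ℝ, 0 < t → 2 * t ≤ 1 →
      ENNReal.ofReal (c * t ^ (Module.finrank ℝ E + 1)) ≤
        volume {x : E | ψ x + ‖x‖ ^ 2 / 2 ≤ t ^ 2} := by
  set d := Module.finrank ℝ E with hd
  obtain ⟨m, hm⟩ : ∃ m, d = m + 1 := by
    have : Nontrivial E := ⟨e, 0, fun h => by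
      have := hF.norm_eq
      rw [h, norm_zero] at this
      exact zero_ne_one this⟩
    exact ⟨d - 1, by have : 0 < d := Module.finrank_pos; omega⟩
  refine ⟨1 / (2 * ((d : ℝ) + 1) ^ 5) ^ d / (M * 2 ^ m), by positivity, fun t ht ht1 => ?_⟩
  have h1 := le_volume_sublevel_mul hc hR hF.nonneg hF.zero ht
  have h2 := hprox (2 * t) (by positivity) ht1
  have h3 := h1.trans (mul_le_mul_right h2 _)
  have hMt : 0 < M * (2 * t) ^ (d - 1) := by positivity
  rw [← ENNReal.div_le_iff_le_mul (Or.inl (by simpa using hMt)) (Or.inl ENNReal.ofReal_ne_top),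
    ← ENNReal.ofReal_div_of_pos hMt] at h3
  refine le_trans (le_of_eq ?_) h3
  congr 1
  rw [← hd, hm, Nat.add_sub_cancel, div_pow, mul_pow 2 t]
  field_simp
  ring

end Leaf

section LeafVolume

open scoped Pointwise

variable {E : Type*} [NormedAddCommGroup E] [InnerProductSpace ℝ E] [FiniteDimensional ℝ E]
  [MeasurableSpace E] [BorelSpace E] {ψ : E → ℝ} {R : NNReal} {e μ : E} {L : ℝ}

lemma ofReal_div_mul_volume_le {S T : Set E} (hS : MeasurableSet S) {e : E} (he : ‖e‖ = 1) {w l : ℝ}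
    (hw : 0 < w) (hl : 0 ≤ l) (hthin : ∀ x ∈ S, ∀ y ∈ S, ⟪x - y, e⟫ < w) (t₀ : ℝ)
    (hT : ∀ s, t₀ ≤ s → s ≤ t₀ + l → ∀ x ∈ S, s • e + x ∈ T) :
    ENNReal.ofReal (l / w) * volume S ≤ volume T := by
  have h := card_mul_volume_le (N := ⌊l / w⌋₊ + 1) hS he hw hthin t₀ fun j hj x hx => by
    have h1 : (j : ℝ) ≤ l / w :=
      (Nat.cast_le.2 (Nat.lt_succ_iff.1 hj)).trans (Nat.floor_le (by positivity))
    rw [le_div_iff₀ hw] at h1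
    exact hT _ (by have : (0 : ℝ) ≤ j * w := by positivity
                   linarith) (by linarith) x hx
  refine le_trans ?_ h
  gcongr
  rw [← ENNReal.ofReal_natCast]
  refine ENNReal.ofReal_le_ofReal ?_
  push_cast
  exact (Nat.lt_floor_add_one _).le

lemma IsFlat.le_volume_conj (hF : IsFlat ψ e μ L) (hc : ConvexOn ℝ univ ψ)
    (hR : LipschitzWith R ψ) {M lam r : ℝ} (hM : 0 < M) (hlam : 0 < lam) (hLr : L ≤ r)
    (hlow : ∀ s ⊆ Metric.ball (0 : E) r, IsCompact s →
      ENNReal.ofReal lam * volume s ≤ volume (⋃ x ∈ s, sd ψ x))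
    (hprox : ∀ ρ : ℝ, 0 < ρ → ρ ≤ 1 →
      volume {y : E | ‖prox ψ y‖ ≤ ρ} ≤ ENNReal.ofReal (M * ρ ^ (Module.finrank ℝ E - 1))) :
    ∃ c : ℝ, 0 < c ∧ ∀ ε : ℝ, 0 < ε → ∀ᶠ t in nhdsWithin (0 : ℝ) (Ioi 0),
      ENNReal.ofReal (c * t ^ (Module.finrank ℝ E - 1)) ≤
        volume {y : E | conj ψ y ≤ 2 * t ^ 2 ∧ ‖y‖ ≤ 2 * ε} := by
  obtain ⟨c₁, hc₁, hsec⟩ := hF.le_volume_section hc hR hM hprox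
  set d := Module.finrank ℝ E with hd
  obtain ⟨m, hm⟩ : ∃ m, d = m + 1 := by
    have : Nontrivial E := ⟨e, 0, fun h => by
      have := hF.norm_eq
      rw [h, norm_zero] at this
      exact zero_ne_one this⟩
    exact ⟨d - 1, by have : 0 < d := Module.finrank_pos; omega⟩
  have hL := hF.pos
  have he := hF.norm_eq
  refine ⟨(L / 18) * (lam * ((1 / 6) ^ d * ((L / 10) * c₁))), by positivity, fun ε hε => ?_⟩
  obtain ⟨τ, hτ, hloc⟩ := hF.norm_lt hR hε
  obtain ⟨s₁, hs₁, hloc'⟩ := hF.le_mul hc hR (τ := τ / 4) (by positivity)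
  have hsmall : ∀ᶠ t in nhdsWithin (0 : ℝ) (Ioi 0), 2 * t < 1 ∧ t < ε ∧ t ^ 2 / (τ / 4) < s₁ ∧
      t ^ 2 / (τ / 4) * ‖μ‖ + 2 * t < L ∧ t ^ 2 < τ ∧ 16 * t ^ 2 / L < τ := by
    refine Filter.Eventually.filter_mono nhdsWithin_le_nhds ?_
    have key : ∀ (g : ℝ → ℝ) (a : ℝ), Continuous g → g 0 < a → ∀ᶠ t in nhds (0 : ℝ), g t < a :=
      fun g a hg h => hg.continuousAt.eventually_lt continuousAt_const h
    refine (key _ _ (by fun_prop) (by simp)).and ((key _ _ (by fun_prop) hε).and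
      ((key _ _ (by fun_prop) (by simpa)).and ((key _ _ (by fun_prop) (by simpa)).and
      ((key _ _ (by fun_prop) (by simpa)).and (key _ _ (by fun_prop) (by simpa))))))
  filter_upwards [hsmall, self_mem_nhdsWithin] with t ⟨ht1, htε, hts, htL, htτ, htτ'⟩ ht
  have ht : 0 < t := ht
  have ht2 : 0 < t ^ 2 := by positivity
  set h := t ^ 2 with hh
  set T := h / (τ / 4) with hT
  have hT0 : 0 < T := by positivity
  set z := (L / 2) • e + T • μ with hz
  have hzh : ψ z ≤ h := by
    have h1 := hloc' T hT0.le hts.le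
    have h2 : τ / 4 * T = h := by rw [hT]; field_simp
    rwa [h2] at h1
  set S := {x : E | ψ x + ‖x‖ ^ 2 / 2 ≤ h} with hS
  have hSc : IsCompact S := isCompact_sublevel hR hF.nonneg h
  have hSψ : ∀ w ∈ S, ψ w ≤ h := fun w hw => by
    have h1 : ψ w + ‖w‖ ^ 2 / 2 ≤ h := hw
    have := sq_nonneg ‖w‖
    linarith
  have hSn : ∀ w ∈ S, ‖w‖ ≤ 2 * t := fun w hw => by
    have h1 : ψ w + ‖w‖ ^ 2 / 2 ≤ h := hw
    have h2 := hF.nonneg w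
    refine abs_le_of_sq_le_sq' ?_ (by positivity) |>.2
    nlinarith
  set T₀ : Set E := (fun q : ℝ × E => q.1 • e + q.2) '' (Icc (L / 4) (3 * L / 4) ×ˢ S) with hT₀
  have hT₀c : IsCompact T₀ := (isCompact_Icc.prod hSc).image (by fun_prop)
  have hv1 : ENNReal.ofReal (L / 2 / (5 * t)) * volume S ≤ volume T₀ := by
    refine ofReal_div_mul_volume_le hSc.measurableSet he (by positivity) (by positivity)
      (fun x hx y hy => ?_) (L / 4) fun s hs hs' x hx =>
        ⟨(s, x), ⟨⟨hs, by linarith⟩, hx⟩, rfl⟩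
    have h1 : ⟪x - y, e⟫ ≤ ‖x - y‖ * ‖e‖ := real_inner_le_norm _ _
    have h2 := norm_sub_le x y
    have h3 := hSn x hx
    have h4 := hSn y hy
    rw [he, mul_one] at h1
    linarith
  set W : Set E := (1 / 6 : ℝ) • ((fun x => z + x) '' T₀) with hW
  have hWc : IsCompact W := (hT₀c.image (by fun_prop)).smul _
  have hvW : volume W = ENNReal.ofReal ((1 / 6) ^ d) * volume T₀ := by
    rw [hW, Measure.addHaar_smul, image_add_left, measure_preimage_add, abs_of_pos (by positivity)]
  have hWmem : ∀ x ∈ W, ∃ s w, L / 4 ≤ s ∧ s ≤ 3 * L / 4 ∧ w ∈ S ∧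
      x = (1 / 6 : ℝ) • (s • e + z + w) := by
    rintro x hx
    obtain ⟨_, ⟨_, ⟨⟨s, w⟩, ⟨⟨hs, hs'⟩, hw⟩, rfl⟩, rfl⟩, rfl⟩ := hx
    refine ⟨s, w, hs, hs', hw, ?_⟩
    simp only
    congr 1
    abel
  have hWball : W ⊆ Metric.ball (0 : E) r := by
    intro x hx
    obtain ⟨s, w, hs, hs', hw, rfl⟩ := hWmem x hx
    rw [mem_ball_zero_iff, norm_smul, Real.norm_eq_abs, abs_of_pos (by positivity)]
    have h1 : ‖s • e + z + w‖ ≤ s + (L / 2 + T * ‖μ‖) + 2 * t := by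
      refine (norm_add₃_le).trans ?_
      have h2 : ‖s • e‖ = s := by
        rw [norm_smul, he, mul_one, Real.norm_eq_abs, abs_of_pos (by linarith)]
      have h3 : ‖z‖ ≤ L / 2 + T * ‖μ‖ := by
        refine (norm_add_le _ _).trans (le_of_eq ?_)
        rw [norm_smul, norm_smul, he, mul_one, Real.norm_eq_abs, Real.norm_eq_abs,
          abs_of_pos (by linarith), abs_of_pos hT0]
      have := hSn w hw
      linarith
    linarith
  have hvG := hlow W hWball hWc
  set G := ⋃ x ∈ W, sd ψ x with hG
  have hGc : IsCompact G := isCompact_iUnion_sd hR hWc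
  have hGb : ∀ p ∈ G, (∀ y, ⟪p, y⟫ ≤ ψ y + h) ∧ -(16 * h / L) ≤ ⟪p, e⟫ ∧ ⟪p, e⟫ ≤ h / L ∧
      ‖p‖ < ε := by
    intro p hp
    simp only [hG, mem_iUnion] at hp
    obtain ⟨x, hx, hpx⟩ := hp
    obtain ⟨s, w, hs, hs', hw, hxe⟩ := hWmem x hx
    obtain ⟨h1, h2, h3, h4⟩ := hF.slope_bounds hc hzh (hSψ w hw) hs hs' hxe hpx
    refine ⟨h1, h2, h3, hloc p (fun y => (h1 y).trans (by linarith)) (by linarith) ?_⟩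
    rw [hz, inner_add_right, inner_smul_right, inner_smul_right] at h4
    have h5 : h = τ / 4 * T := by rw [hT]; field_simp
    have h6 : (L / 2) * ⟪p, e⟫ ≤ h / 2 := by
      rw [le_div_iff₀ hL] at h3
      linarith
    have h7 : T * (-τ) ≤ T * ⟪p, μ⟫ := by
      nlinarith
    exact le_of_mul_le_mul_left h7 hT0
  have hvA : ENNReal.ofReal (t / (18 * h / L)) * volume G ≤
      volume {y : E | conj ψ y ≤ 2 * h ∧ ‖y‖ ≤ 2 * ε} := by
    refine ofReal_div_mul_volume_le hGc.measurableSet he (by positivity) ht.le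
      (fun x hx y hy => ?_) 0 fun s hs hs' p hp => ?_
    · obtain ⟨-, h1, h2, -⟩ := hGb x hx
      obtain ⟨-, h3, h4, -⟩ := hGb y hy
      rw [inner_sub_left]
      have h5 : 18 * h / L = h / L + 16 * h / L + h / L := by ring
      have h6 : 0 < h / L := by positivity
      linarith
    · obtain ⟨h1, -, -, h2⟩ := hGb p hp
      have hns : ‖s • e‖ = s := by rw [norm_smul, he, mul_one, Real.norm_eq_abs, abs_of_nonneg hs]
      constructor
      · unfold conj
        set y := prox ψ (s • e + p)
        have h3 := h1 y
        have h4 : ⟪s • e, y⟫ ≤ ‖s • e‖ * ‖y‖ := real_inner_le_norm _ _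
        rw [hns] at h4
        rw [inner_add_left]
        have h5 : s ^ 2 ≤ h := by rw [hh]; gcongr; linarith
        nlinarith [sq_nonneg (s - ‖y‖)]
      · refine (norm_add_le _ _).trans ?_
        rw [hns]
        linarith
  refine le_trans ?_ hvA
  have hv2 := hsec t ht ht1.le
  calc ENNReal.ofReal (L / 18 * (lam * ((1 / 6) ^ d * (L / 10 * c₁))) * t ^ (d - 1))
      = ENNReal.ofReal (t / (18 * h / L)) * (ENNReal.ofReal lam * (ENNReal.ofReal ((1 / 6) ^ d) *
        (ENNReal.ofReal (L / 2 / (5 * t)) * ENNReal.ofReal (c₁ * t ^ (d + 1))))) := by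
        rw [← ENNReal.ofReal_mul (by positivity), ← ENNReal.ofReal_mul (by positivity),
          ← ENNReal.ofReal_mul (by positivity), ← ENNReal.ofReal_mul (by positivity)]
        congr 1
        rw [hh, hm, Nat.add_sub_cancel]
        field_simp
        ring
    _ ≤ ENNReal.ofReal (t / (18 * h / L)) * volume G := by
        refine mul_le_mul_right (le_trans ?_ hvG) _
        rw [hvW]
        exact mul_le_mul_right (mul_le_mul_right ((mul_le_mul_right hv2 _).trans hv1) _) _

/-- The proximal preimages of small balls at the endpoint of a flat segment are large. -/
lemma IsFlat.exists_volume_prox_gt (hF : IsFlat ψ e μ L) (hc : ConvexOn ℝ univ ψ)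
    (hR : LipschitzWith R ψ) {M lam r : ℝ} (hM : 0 < M) (hlam : 0 < lam) (hLr : L ≤ r)
    (hlow : ∀ s ⊆ Metric.ball (0 : E) r, IsCompact s →
      ENNReal.ofReal lam * volume s ≤ volume (⋃ x ∈ s, sd ψ x)) :
    ∃ ρ : ℝ, 0 < ρ ∧ ρ ≤ 1 ∧
      ENNReal.ofReal (M * ρ ^ (Module.finrank ℝ E - 1)) < volume {y : E | ‖prox ψ y‖ ≤ ρ} := by
  by_contra! hprox
  have hd : 0 < Module.finrank ℝ E := by
    have : Nontrivial E := ⟨e, 0, fun h => by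
      have := hF.norm_eq
      rw [h, norm_zero] at this
      exact zero_ne_one this⟩
    exact Module.finrank_pos
  obtain ⟨c, hc0, hvol⟩ := hF.le_volume_conj hc hR hM hlam hLr hlow hprox
  obtain ⟨c', hc', hrad⟩ := exists_le_radius hd hc hR hF.zero hM hc0 hprox
  have hsmall : ∀ᶠ t in nhdsWithin (0 : ℝ) (Ioi 0), t < c' / 4 :=
    Filter.Eventually.filter_mono nhdsWithin_le_nhds (gt_mem_nhds (by positivity))
  obtain ⟨t, ht1, ht2, ht⟩ := ((hvol (c' / 8) (by positivity)).and
    (hsmall.and self_mem_nhdsWithin)).exists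
  have ht : 0 < t := ht
  have hcc : Continuous (conj ψ) :=
    continuous_iff_continuousAt.2 fun y => (hasFDerivAt_conj hc hR y).continuousAt
  have hconv : ConvexOn ℝ univ (conj ψ) := by
    refine ⟨convex_univ, fun x _ y _ a b ha hb hab => ?_⟩
    have h1 := conj_add_le hR (a • x + b • y) x
    have h2 := conj_add_le hR (a • x + b • y) y
    set q := prox ψ (a • x + b • y)
    have h3 : a * ⟪q, x - (a • x + b • y)⟫ + b * ⟪q, y - (a • x + b • y)⟫ = 0 := by
      rw [← inner_smul_right, ← inner_smul_right, ← inner_add_right]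
      have : a • (x - (a • x + b • y)) + b • (y - (a • x + b • y)) = 0 := by
        have hb' : b = 1 - a := by linarith
        rw [hb']; module
      rw [this, inner_zero_right]
    have h4 := mul_le_mul_of_nonneg_left h1 ha
    have h5 := mul_le_mul_of_nonneg_left h2 hb
    have h6 : conj ψ (a • x + b • y) = a * conj ψ (a • x + b • y) + b * conj ψ (a • x + b • y) := by
      rw [← add_mul, hab, one_mul]
    simp only [smul_eq_mul]
    linarith
  have hAeq : {y : E | conj ψ y ≤ 2 * t ^ 2 ∧ ‖y‖ ≤ 2 * (c' / 8)} =
      {y | conj ψ y ≤ 2 * t ^ 2} ∩ Metric.closedBall 0 (2 * (c' / 8)) := by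
    ext; simp
  have := hrad t {y : E | conj ψ y ≤ 2 * t ^ 2 ∧ ‖y‖ ≤ 2 * (c' / 8)} (2 * (c' / 8)) ht
    (by linarith) (by
      rw [hAeq, inter_comm]
      exact (isCompact_closedBall _ _).inter_right (isClosed_le hcc continuous_const))
    (by
      rw [hAeq]
      have := hconv.convex_le (2 * t ^ 2)
      simp only [mem_univ, true_and] at this
      exact this.inter (convex_closedBall _ _))
    (by
      intro y hy
      rw [mem_closedBall_zero_iff] at hy
      refine ⟨?_, by linarith⟩
      unfold conj
      set q := prox ψ y
      have h1 := hF.nonneg q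
      have h2 : ⟪y, q⟫ ≤ ‖y‖ * ‖q‖ := real_inner_le_norm _ _
      have h3 : ‖y‖ ^ 2 ≤ t ^ 2 := by gcongr
      nlinarith [sq_nonneg (‖y‖ - ‖q‖)])
    (fun y hy => hy.1) ht1 (by
      rw [hAeq]; exact inter_subset_right)
  linarith

end LeafVolume

section LeafContact

variable {E : Type*} [NormedAddCommGroup E] [InnerProductSpace ℝ E] [FiniteDimensional ℝ E]
  [MeasurableSpace E] [BorelSpace E] {D : Set E} {f u : E → ℝ} {R : NNReal} {lam Lam : ℝ}

/-- The proximal preimages of small balls around an interior point from which a flat segment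
starts are large. -/
lemma IsMA.exists_volume_prox_gt (hf : IsDensity D f lam Lam) (hu : IsMA D f u R) {k p x : E}
    (hk : k ∈ D) (hp : p ∈ sd u k) (hxk : x ≠ k) (hux : u x = u k + ⟪p, x - k⟫) {M : ℝ}
    (hM : 0 < M) :
    ∃ ρ : ℝ, 0 < ρ ∧ ρ ≤ 1 ∧
      ENNReal.ofReal (M * ρ ^ (Module.finrank ℝ E - 1)) <
        volume {y : E | prox u y ∈ Metric.closedBall k ρ} := by
  obtain ⟨r, hr, hrD⟩ := Metric.isOpen_iff.1 hf.isOpen k hk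
  set l := ‖x - k‖ with hl
  have hl0 : 0 < l := norm_pos_iff.2 (sub_ne_zero.2 hxk)
  set e := l⁻¹ • (x - k) with he
  have he1 : ‖e‖ = 1 := by rw [he, norm_smul, norm_inv, hl, norm_norm, inv_mul_cancel₀ hl0.ne']
  have hle : l • e = x - k := by rw [he, smul_inv_smul₀ hl0.ne']
  have hcomp : IsCompact (sd u k ∩ {q | ⟪q, e⟫ = ⟪p, e⟫}) := by
    have := isCompact_iUnion_sd hu.lip (isCompact_singleton (x := k))
    rw [biUnion_singleton] at this
    exact this.inter_right (isClosed_eq (by fun_prop) continuous_const)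
  obtain ⟨q₀, ⟨hq₀, hq₀e⟩, hmax⟩ := hcomp.exists_isMaxOn ⟨p, hp, rfl⟩ continuous_norm.continuousOn
  have hq₀e : ⟪q₀, e⟫ = ⟪p, e⟫ := hq₀e
  set ψ : E → ℝ := fun y => u (k + y) - u k - ⟪q₀, y⟫ with hψ
  have hsd : ∀ y q, q ∈ sd ψ y ↔ q + q₀ ∈ sd u (k + y) := by
    intro y q
    constructor
    · intro h z
      have := h (z - k)
      simp only [hψ, add_sub_cancel] at this
      have h2 : z - (k + y) = z - k - y := by abel
      rw [h2, inner_add_left, inner_sub_right q₀]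
      linarith
    · intro h z
      have := h (k + z)
      rw [add_sub_add_left_eq_sub, inner_add_left, inner_sub_right q₀] at this
      simp only [hψ]
      linarith
  have hc : ConvexOn ℝ univ ψ := by
    refine ⟨convex_univ, fun y _ z _ a b ha hb hab => ?_⟩
    have h1 := hu.conv.2 (mem_univ (k + y)) (mem_univ (k + z)) ha hb hab
    have h2 : a • (k + y) + b • (k + z) = k + (a • y + b • z) := by
      have hb' : b = 1 - a := by linarith
      rw [hb']; module
    have h3 : u k = a * u k + b * u k := by rw [← add_mul, hab, one_mul]
    rw [h2] at h1
    simp only [hψ, smul_eq_mul] at h1 ⊢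
    rw [inner_add_right, inner_smul_right, inner_smul_right]
    linarith
  have hlip : LipschitzWith (R + ‖q₀‖₊) ψ := by
    refine LipschitzWith.of_le_add_mul _ fun y z => ?_
    have h1 := (le_abs_self _).trans (hu.lip.dist_le_mul (k + y) (k + z))
    have h2 : ⟪q₀, z - y⟫ ≤ ‖q₀‖ * ‖z - y‖ := real_inner_le_norm _ _
    rw [dist_add_left] at h1
    rw [← dist_eq_norm, dist_comm, inner_sub_right] at h2
    simp only [hψ]
    push_cast
    linarith
  have hF : IsFlat ψ e q₀ (min r l) := by
    have hflat : ∀ t, 0 ≤ t → t ≤ l → ψ (t • e) = 0 := by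
      intro t ht htl
      have h1 := hq₀ (k + t • e)
      have h2 := hu.conv.2 (mem_univ k) (mem_univ x)
        (sub_nonneg.2 ((div_le_one hl0).2 htl)) (div_nonneg ht hl0.le) (by ring)
      have h3 : (1 - t / l) • k + (t / l) • x = k + t • e := by
        have hx : x = k + l • e := by rw [hle]; abel
        nth_rewrite 1 [hx]
        rw [smul_add, smul_smul, div_mul_cancel₀ _ hl0.ne']
        module
      rw [h3, hux, ← hle] at h2
      have h4 : t / l * (u k + ⟪p, l • e⟫) = t / l * u k + t * ⟪p, e⟫ := by
        rw [inner_smul_right]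
        field_simp
      rw [add_sub_cancel_left, inner_smul_right, hq₀e] at h1
      simp only [smul_eq_mul] at h2
      rw [h4] at h2
      simp only [hψ]
      rw [inner_smul_right, hq₀e]
      linarith
    refine ⟨he1, lt_min hr hl0, fun y => ?_, fun t ht htl => hflat t ht (htl.trans (min_le_right _ _)),
      fun q hq hqe hqμ => ?_⟩
    · have := hq₀ (k + y)
      rw [add_sub_cancel_left] at this
      simp only [hψ]
      linarith
    · have h1 := hq (l • e)
      have h0 : ψ 0 = 0 := by simp [hψ]
      rw [hflat l hl0.le le_rfl, h0, sub_zero, inner_smul_right] at h1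
      have h2 : ⟪q, e⟫ = 0 := by nlinarith
      have h3 : q + q₀ ∈ sd u k ∩ {q | ⟪q, e⟫ = ⟪p, e⟫} := by
        refine ⟨by simpa using (hsd 0 q).1 hq, ?_⟩
        show ⟪q + q₀, e⟫ = ⟪p, e⟫
        rw [inner_add_left, h2, zero_add, hq₀e]
      have h4 : ‖q + q₀‖ ≤ ‖q₀‖ := hmax h3
      have h5 : ‖q + q₀‖ ^ 2 ≤ ‖q₀‖ ^ 2 := by gcongr
      rw [norm_add_sq_real] at h5
      have h6 : ‖q‖ ^ 2 ≤ 0 := by linarith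
      exact norm_eq_zero.1 (pow_eq_zero_iff two_ne_zero |>.1 (le_antisymm h6 (sq_nonneg _)))
  have hlow : ∀ s ⊆ Metric.ball (0 : E) r, IsCompact s →
      ENNReal.ofReal lam * volume s ≤ volume (⋃ x ∈ s, sd ψ x) := by
    intro s hs hsc
    have h1 := hu.le_volume_sd hf (s := (fun y => k + y) '' s) (by
      rintro _ ⟨y, hy, rfl⟩
      refine hrD ?_
      have := hs hy
      rw [mem_ball_zero_iff] at this
      simpa [Metric.mem_ball, dist_eq_norm] using this)
      (hsc.image (by fun_prop)).measurableSet
    have h2 : (⋃ x ∈ s, sd ψ x) =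
        (fun q => q + q₀) ⁻¹' (⋃ x ∈ (fun y => k + y) '' s, sd u x) := by
      rw [biUnion_image]
      ext q
      simp [hsd]
    rw [h2, measure_preimage_add_right]
    have h3 : volume ((fun y => k + y) '' s) = volume s := by
      rw [image_add_left, measure_preimage_add]
    rwa [h3] at h1
  obtain ⟨ρ, hρ0, hρ1, hρ⟩ := hF.exists_volume_prox_gt hc hlip hM hf.pos (min_le_left _ _) hlow
  refine ⟨ρ, hρ0, hρ1, hρ.trans_le (le_of_eq ?_)⟩
  have hpr : ∀ y, prox u (y + (q₀ + k)) = k + prox ψ y := by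
    intro y
    have h1 := (hsd _ _).1 (sub_prox_mem_sd hc hlip y)
    rw [← prox_add_eq hu.conv hu.lip h1]
    congr 1
    abel
  have : {y : E | ‖prox ψ y‖ ≤ ρ} =
      (fun y => y + (q₀ + k)) ⁻¹' {y : E | prox u y ∈ Metric.closedBall k ρ} := by
    ext y
    simp [hpr, dist_eq_norm]
  rw [this, measure_preimage_add_right]

end LeafContact

section Crossing

variable {E : Type*} [NormedAddCommGroup E] [InnerProductSpace ℝ E] [FiniteDimensional ℝ E]
  [MeasurableSpace E] [BorelSpace E] {u : E → ℝ} {R : NNReal}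

lemma volume_tube_le (hd : 0 < Module.finrank ℝ E) (v : E) :
    ∃ C : ℝ, 0 < C ∧ ∀ (k : E) (ρ : ℝ), 0 < ρ → ρ ≤ 1 →
      volume {x : E | ∃ s : ℝ, 0 ≤ s ∧ s ≤ 1 ∧ x + s • v ∈ Metric.closedBall k (5 * ρ)} ≤
        ENNReal.ofReal (C * ρ ^ (Module.finrank ℝ E - 1)) := by
  set d := Module.finrank ℝ E with hdd
  obtain ⟨m, hm⟩ : ∃ m, d = m + 1 := ⟨d - 1, by omega⟩
  set ω : ℝ := (volume (Metric.closedBall (0 : E) 1)).toReal with hω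
  have hω0 : 0 < ω := ENNReal.toReal_pos (Metric.measure_closedBall_pos volume _ one_pos).ne'
    measure_closedBall_lt_top.ne
  refine ⟨3 * (5 + ‖v‖) ^ d * ω, by positivity, fun k ρ hρ hρ1 => ?_⟩
  set N := ⌈1 / ρ⌉₊ with hN
  have hN1 : 1 / ρ ≤ N := Nat.le_ceil _
  have hN2 : (N : ℝ) < 1 / ρ + 1 := Nat.ceil_lt_add_one (by positivity)
  have hN0 : (0 : ℝ) < N := lt_of_lt_of_le (by positivity) hN1
  have hsub : {x : E | ∃ s : ℝ, 0 ≤ s ∧ s ≤ 1 ∧ x + s • v ∈ Metric.closedBall k (5 * ρ)} ⊆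
      ⋃ j ∈ Finset.range (N + 1), Metric.closedBall (k - ((j : ℝ) / N) • v) ((5 + ‖v‖) * ρ) := by
    rintro x ⟨s, hs, hs', hx⟩
    have hfl : (⌊s * N⌋₊ : ℝ) ≤ s * N := Nat.floor_le (by positivity)
    have hfl' : s * N < ⌊s * N⌋₊ + 1 := Nat.lt_floor_add_one _
    simp only [mem_iUnion, Finset.mem_range]
    refine ⟨⌊s * N⌋₊, ?_, ?_⟩
    · have : (⌊s * N⌋₊ : ℝ) ≤ N := hfl.trans (by nlinarith)
      have : ⌊s * N⌋₊ ≤ N := by exact_mod_cast this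
      omega
    · rw [Metric.mem_closedBall, dist_eq_norm] at hx ⊢
      have h1 : x - (k - ((⌊s * N⌋₊ : ℝ) / N) • v) =
          (x + s • v - k) - (s - (⌊s * N⌋₊ : ℝ) / N) • v := by module
      rw [h1]
      refine (norm_sub_le _ _).trans ?_
      have h2 : |s - (⌊s * N⌋₊ : ℝ) / N| ≤ ρ := by
        have h3 : s - (⌊s * N⌋₊ : ℝ) / N = (s * N - ⌊s * N⌋₊) / N := by field_simp
        rw [h3, abs_of_nonneg (div_nonneg (by linarith) hN0.le), div_le_iff₀ hN0]
        rw [div_le_iff₀ hρ] at hN1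
        linarith
      rw [norm_smul, Real.norm_eq_abs]
      have h4 := mul_le_mul_of_nonneg_right h2 (norm_nonneg v)
      linarith
  refine (measure_mono hsub).trans ((measure_biUnion_finset_le _ _).trans ?_)
  have h1 : ∀ j ∈ Finset.range (N + 1),
      volume (Metric.closedBall (k - ((j : ℝ) / N) • v) ((5 + ‖v‖) * ρ)) =
        ENNReal.ofReal (((5 + ‖v‖) * ρ) ^ d * ω) := by
    intro j _
    rw [Measure.addHaar_closedBall' _ _ (by positivity),
      ← ENNReal.ofReal_toReal (a := volume (Metric.closedBall (0 : E) 1))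
      measure_closedBall_lt_top.ne, ← hω, ← ENNReal.ofReal_mul (by positivity)]
  rw [Finset.sum_congr rfl h1, Finset.sum_const, Finset.card_range, nsmul_eq_mul,
    ← ENNReal.ofReal_natCast, ← ENNReal.ofReal_mul (by positivity)]
  refine ENNReal.ofReal_le_ofReal ?_
  have h2 : ((N + 1 : ℕ) : ℝ) ≤ 3 / ρ := by
    push_cast
    have h3 : 1 ≤ 1 / ρ := one_le_one_div hρ hρ1
    have h4 : 3 / ρ = 3 * (1 / ρ) := by ring
    linarith
  calc ((N + 1 : ℕ) : ℝ) * (((5 + ‖v‖) * ρ) ^ d * ω)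
      ≤ 3 / ρ * (((5 + ‖v‖) * ρ) ^ d * ω) := by gcongr
    _ = 3 * (5 + ‖v‖) ^ d * ω * ρ ^ (d - 1) := by
        rw [hm, Nat.add_sub_cancel, mul_pow, pow_succ ρ]
        field_simp

/-- A bounded set around whose points proximal preimages of small balls are large cannot meet all
the translates of a segment starting in a ball. -/
lemma exists_segment_avoiding (hd : 0 < Module.finrank ℝ E) (hc : ConvexOn ℝ univ u)
    (hR : LipschitzWith R u) {S : Set E} (hS : Bornology.IsBounded S)
    (hlarge : ∀ k ∈ S, ∀ M : ℝ, 0 < M → ∃ ρ : ℝ, 0 < ρ ∧ ρ ≤ 1 ∧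
      ENNReal.ofReal (M * ρ ^ (Module.finrank ℝ E - 1)) <
        volume {y : E | prox u y ∈ Metric.closedBall k ρ}) (a v : E) {r : ℝ} (hr : 0 < r) :
    ∃ x ∈ Metric.ball a r, ∀ s : ℝ, 0 ≤ s → s ≤ 1 → x + s • v ∉ S := by
  by_contra! hcross
  obtain ⟨C, hC, htube⟩ := volume_tube_le hd v
  set d := Module.finrank ℝ E with hdd
  obtain ⟨B, hB⟩ := hS.exists_norm_le
  set V : ℝ := (volume (Metric.closedBall (0 : E) (B + 1 + R))).toReal with hV
  have hV0 : 0 ≤ V := ENNReal.toReal_nonneg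
  set w : ℝ := (volume (Metric.ball a r)).toReal with hw
  have hw0 : 0 < w := ENNReal.toReal_pos (Metric.measure_ball_pos volume _ hr).ne'
    measure_ball_lt_top.ne
  set M : ℝ := C * (V + 1) / w with hM
  have hM0 : 0 < M := by positivity
  choose! ρ hρ0 hρ1 hρ using fun k hk => hlarge k hk M hM0
  obtain ⟨t, htS, htd, htc⟩ := Vitali.exists_disjoint_subfamily_covering_enlargement_closedBall
    S (fun k => k) ρ 1 hρ1 5 (by norm_num)
  have htcount : t.Countable := htd.countable_of_nonempty_interior fun k hk => by
    refine ⟨k, mem_interior.2 ⟨_, Metric.ball_subset_closedBall, Metric.isOpen_ball,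
      Metric.mem_ball_self (hρ0 k (htS hk))⟩⟩
  have hsum : ∑' k : t, ENNReal.ofReal (M * ρ k ^ (d - 1)) ≤ ENNReal.ofReal V := by
    calc ∑' k : t, ENNReal.ofReal (M * ρ k ^ (d - 1))
        ≤ ∑' k : t, volume {y : E | prox u y ∈ Metric.closedBall (k : E) (ρ k)} :=
          ENNReal.tsum_le_tsum fun k => (hρ k (htS k.2)).le
      _ = volume (⋃ k ∈ t, {y : E | prox u y ∈ Metric.closedBall k (ρ k)}) := by
          rw [measure_biUnion htcount]
          · intro k hk k' hk' hne
            exact (htd hk hk' hne).preimage (prox u)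
          · intro k _
            exact (Metric.isClosed_closedBall.preimage (lipschitz_prox hc hR).continuous).measurableSet
      _ ≤ volume (Metric.closedBall (0 : E) (B + 1 + R)) := by
          refine measure_mono (iUnion₂_subset fun k hk y hy => ?_)
          have h1 := norm_le_of_mem_sd hR (sub_prox_mem_sd hc hR y)
          have h2 := hB k (htS hk)
          have h3 := hρ1 k (htS hk)
          have h4 : ‖prox u y - k‖ ≤ ρ k := by
            rw [← dist_eq_norm]; exact hy
          have h5 := norm_add₃_le (a := y - prox u y) (b := prox u y - k) (c := k)
          rw [mem_closedBall_zero_iff]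
          have h6 : y - prox u y + (prox u y - k) + k = y := by abel
          rw [h6] at h5
          linarith
      _ = ENNReal.ofReal V := (ENNReal.ofReal_toReal measure_closedBall_lt_top.ne).symm
  have hcov : volume (Metric.ball a r) ≤ ∑' k : t, ENNReal.ofReal (C * ρ k ^ (d - 1)) := by
    have hsub : Metric.ball a r ⊆ ⋃ k ∈ t,
        {x : E | ∃ s : ℝ, 0 ≤ s ∧ s ≤ 1 ∧ x + s • v ∈ Metric.closedBall k (5 * ρ k)} := by
      intro x hx
      obtain ⟨s, hs, hs', hxS⟩ := hcross x hx
      obtain ⟨k, hk, hks⟩ := htc _ hxS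
      simp only [mem_iUnion]
      exact ⟨k, hk, s, hs, hs', hks (Metric.mem_closedBall_self (hρ0 _ hxS).le)⟩
    refine (measure_mono hsub).trans ((measure_biUnion_le _ htcount _).trans ?_)
    exact ENNReal.tsum_le_tsum fun k => htube k _ (hρ0 _ (htS k.2)) (hρ1 _ (htS k.2))
  have hfac : ∀ k : t, ENNReal.ofReal (C * ρ k ^ (d - 1)) =
      ENNReal.ofReal (C / M) * ENNReal.ofReal (M * ρ k ^ (d - 1)) := by
    intro k
    rw [← ENNReal.ofReal_mul (by positivity)]
    congr 1
    field_simp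
  simp only [hfac] at hcov
  rw [ENNReal.tsum_mul_left] at hcov
  have h1 := hcov.trans (mul_le_mul_right hsum _)
  rw [← ENNReal.ofReal_mul (by positivity), ← ENNReal.ofReal_toReal (a := volume (Metric.ball a r))
    measure_ball_lt_top.ne, ← hw, ENNReal.ofReal_le_ofReal_iff (by positivity)] at h1
  have h2 : C / M * V = w * (V / (V + 1)) := by
    rw [hM]; field_simp
  have h3 : V / (V + 1) < 1 := (div_lt_one (by linarith)).2 (by linarith)
  rw [h2] at h1
  nlinarith

end Crossing

section Dichotomy

variable {E : Type*} [NormedAddCommGroup E] [InnerProductSpace ℝ E] [FiniteDimensional ℝ E]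
  [MeasurableSpace E] [BorelSpace E] {D : Set E} {f u v : E → ℝ} {Ru Rv : NNReal} {lam Lam : ℝ}

/-- On a bounded convex domain, two ordered solutions that agree on a ball agree everywhere. -/
lemma eqOn_of_eventually_eq (hf : IsDensity D f lam Lam) (hu : IsMA D f u Ru)
    (hv : IsMA D f v Rv) (hvu : ∀ x ∈ D, v x ≤ u x) (hDc : Convex ℝ D)
    (hDb : Bornology.IsBounded D) {z : E} (hz : z ∈ D) (hzv : ∀ᶠ y in nhds z, u y = v y) :
    ∀ y ∈ D, u y = v y := by
  by_contra! hcon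
  obtain ⟨y, hyD, hy⟩ := hcon
  have huc := hu.lip.continuous
  have hvc := hv.lip.continuous
  have hd : 0 < Module.finrank ℝ E := by
    have : Nontrivial E := ⟨y, z, fun h => hy (h ▸ hzv.self_of_nhds)⟩
    exact Module.finrank_pos
  have hev : ∀ᶠ q in nhds z, q ∈ D ∧ u q = v q ∧ q + (y - z) ∈ D ∧ u (q + (y - z)) ≠ v (q + (y - z)) := by
    have ht : Filter.Tendsto (fun q => q + (y - z)) (nhds z) (nhds y) := by
      have : Continuous fun q => q + (y - z) := by fun_prop
      simpa using this.tendsto z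
    exact (hf.isOpen.eventually_mem hz).and (hzv.and ((ht.eventually (hf.isOpen.mem_nhds hyD)).and
      (ht.eventually ((isOpen_ne_fun huc hvc).mem_nhds hy))))
  obtain ⟨r, hr, hball⟩ := Metric.eventually_nhds_iff_ball.1 hev
  set S : Set E := {x | x ∈ D ∧ u x = v x ∧ x ∈ closure {x | u x ≠ v x}} with hS
  obtain ⟨x, hx, hav⟩ := exists_segment_avoiding hd hu.conv hu.lip (S := S)
    (hDb.subset fun x hx => hx.1) (fun k hk M hM => by
      obtain ⟨p, hp, x, -, hxk, hux⟩ := exists_leaf hf hu hv hvu hk.1 hk.2.1 hk.2.2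
      exact hu.exists_volume_prox_gt hf hk.1 hp hxk hux hM) z (y - z) hr
  obtain ⟨h1, h2, h3, h4⟩ := hball x hx
  set g : ℝ → E := fun s => x + s • (y - z) with hg
  have hgc : Continuous g := by fun_prop
  have hK : IsCompact (Icc (0 : ℝ) 1 ∩ {s | u (g s) = v (g s)}) :=
    isCompact_Icc.inter_right (isClosed_eq (huc.comp hgc) (hvc.comp hgc))
  obtain ⟨s, ⟨⟨hs0, hs1⟩, hs⟩, hmax⟩ := hK.exists_isGreatest ⟨0, by simp, by simpa [hg] using h2⟩
  have hs : u (g s) = v (g s) := hs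
  have hs1' : s < 1 := lt_of_le_of_ne hs1 fun h => h4 (by simpa [hg, h] using hs)
  refine hav s hs0 hs1 ⟨?_, hs, ?_⟩
  · have := hDc h1 h3 (sub_nonneg.2 hs1) hs0 (by ring)
    convert this using 1
    module
  · have h5 : Filter.Tendsto g (nhdsWithin s (Ioi s)) (nhds (g s)) :=
      (hgc.tendsto s).mono_left nhdsWithin_le_nhds
    refine mem_closure_of_tendsto h5 ?_
    filter_upwards [Ioo_mem_nhdsGT hs1'] with c hc hcon
    exact absurd (hmax ⟨⟨hs0.trans hc.1.le, hc.2.le⟩, hcon⟩) (not_le.2 hc.1)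

end Dichotomy

section Extension

variable {E : Type*} [NormedAddCommGroup E] [InnerProductSpace ℝ E]

/-- A Lipschitz convex function on a compact convex set extends to a Lipschitz convex function on
the whole space, by infimal convolution. -/
lemma exists_convex_extension {K : Set E} {u : E → ℝ} {R : NNReal} (hK : IsCompact K)
    (hne : K.Nonempty) (hu : ConvexOn ℝ K u) (hR : LipschitzOnWith R u K) :
    ∃ w : E → ℝ, ConvexOn ℝ univ w ∧ LipschitzWith R w ∧ EqOn w u K := by
  have hmin : ∀ x, ∃ z ∈ K, ∀ z' ∈ K, u z + R * ‖x - z‖ ≤ u z' + R * ‖x - z'‖ := by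
    intro x
    have hcont : ContinuousOn (fun z => u z + R * ‖x - z‖) K :=
      hR.continuousOn.add (by fun_prop)
    obtain ⟨z, hz, hmin⟩ := hK.exists_isMinOn hne hcont
    exact ⟨z, hz, fun z' hz' => hmin hz'⟩
  choose z hzK hz using hmin
  refine ⟨fun x => u (z x) + R * ‖x - z x‖, ⟨convex_univ, fun x _ y _ a b ha hb hab => ?_⟩,
    LipschitzWith.of_le_add_mul _ fun x y => ?_, fun x hx => le_antisymm ?_ ?_⟩
  · have h1 := hz (a • x + b • y) _ (hu.1 (hzK x) (hzK y) ha hb hab)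
    have h2 := hu.2 (hzK x) (hzK y) ha hb hab
    have h3 : ‖a • x + b • y - (a • z x + b • z y)‖ ≤ a * ‖x - z x‖ + b * ‖y - z y‖ := by
      have : a • x + b • y - (a • z x + b • z y) = a • (x - z x) + b • (y - z y) := by module
      rw [this]
      refine (norm_add_le _ _).trans (le_of_eq ?_)
      rw [norm_smul, norm_smul, Real.norm_eq_abs, Real.norm_eq_abs, abs_of_nonneg ha,
        abs_of_nonneg hb]
    have h4 := mul_le_mul_of_nonneg_left h3 R.2
    simp only [smul_eq_mul, NNReal.val_eq_coe] at h2 h4 ⊢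
    linarith
  · have h1 := hz x (z y) (hzK y)
    have h2 : ‖x - z y‖ ≤ dist x y + ‖y - z y‖ := by
      rw [dist_eq_norm]; simpa using norm_add_le (x - y) (y - z y)
    have h3 := mul_le_mul_of_nonneg_left h2 R.2
    simp only [NNReal.val_eq_coe] at h3
    linarith
  · simpa using hz x x hx
  · have h1 := (le_abs_self _).trans (hR.dist_le_mul x hx (z x) (hzK x))
    rw [dist_eq_norm] at h1
    simp only
    linarith

end Extension

section Reduction

lemma subgrad_eq_sd {n : ℕ} {Ω D : Set (En n)} {u w : En n → ℝ} (hu : ConvexOn ℝ Ω u)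
    (hw : ConvexOn ℝ univ w) (hD : IsOpen D) (hDΩ : D ⊆ Ω) (hwu : EqOn w u D) {x : En n}
    (hx : x ∈ D) : subgrad Ω u x = sd w x := by
  ext p
  constructor
  · intro hp
    refine mem_sd_of_eventually hw ?_
    filter_upwards [hD.mem_nhds hx] with y hy
    rw [hwu hx, hwu hy]
    exact hp y (hDΩ hy)
  · intro hp
    have hloc : IsLocalMinOn (fun y => u y - ⟪p, y⟫) Ω x := by
      refine Filter.Eventually.filter_mono nhdsWithin_le_nhds ?_
      filter_upwards [hD.mem_nhds hx] with y hy
      have := hp y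
      rw [hwu hx, hwu hy, inner_sub_right] at this
      linarith
    have hconv : ConvexOn ℝ Ω (fun y => u y - ⟪p, y⟫) := by
      refine ⟨hu.1, fun y hy z hz a b ha hb hab => ?_⟩
      have := hu.2 hy hz ha hb hab
      simp only [smul_eq_mul] at this ⊢
      rw [inner_add_right, inner_smul_right, inner_smul_right]
      linarith
    have hmin := IsMinOn.of_isLocalMinOn_of_convexOn (hDΩ hx) hloc hconv
    intro y hy
    have : u x - ⟪p, x⟫ ≤ u y - ⟪p, y⟫ := hmin hy
    rw [inner_sub_right]
    linarith

lemma exists_isMA {n : ℕ} {Ω D K : Set (En n)} {u f : En n → ℝ} (hu : ConvexOn ℝ Ω u)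
    (hΩ : IsOpen Ω) (hD : IsOpen D) (hDK : D ⊆ K) (hKΩ : K ⊆ Ω) (hK : IsCompact K)
    (hKc : Convex ℝ K) (hne : K.Nonempty)
    (hM : ∀ s : Set (En n), s ⊆ Ω → MeasurableSet s →
      MAm Ω u s = ∫⁻ x in s, ENNReal.ofReal (f x)) :
    ∃ (w : En n → ℝ) (R : NNReal), IsMA D f w R ∧ EqOn w u D ∧
      ∀ x ∈ D, subgrad Ω u x = sd w x := by
  obtain ⟨R, hR⟩ := ((hu.locallyLipschitzOn hΩ).mono hKΩ).exists_lipschitzOnWith_of_compact hK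
  obtain ⟨w, hwc, hwR, hwu⟩ := exists_convex_extension hK hne (hu.subset hKΩ hKc) hR
  have hsd : ∀ x ∈ D, subgrad Ω u x = sd w x := fun x hx =>
    subgrad_eq_sd hu hwc hD (hDK.trans hKΩ) (hwu.mono hDK) hx
  refine ⟨w, R, ⟨hwc, hwR, fun s hs hsm => ?_⟩, hwu.mono hDK, hsd⟩
  rw [← hM s (hs.trans (hDK.trans hKΩ)) hsm, MAm,
    iUnion₂_congr fun x hx => (hsd x (hs hx)).symm]

/-- A slope of `v` at a contact point strictly supports `u` if `u` or `v` is strictly convex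
there. -/
lemma add_inner_lt_of_isStrictConvexPt {n : ℕ} {Ω : Set (En n)} {u v : En n → ℝ}
    (hΩ : Convex ℝ Ω) (huv : ∀ x ∈ Ω, v x ≤ u x) {x₀ p : En n} (hx₀ : x₀ ∈ Ω)
    (heq : u x₀ = v x₀) (hp : p ∈ subgrad Ω v x₀)
    (hs : IsStrictConvexPt Ω u x₀ ∨ IsStrictConvexPt Ω v x₀) {x : En n} (hx : x ∈ Ω)
    (hne : x ≠ x₀) : u x₀ + ⟪p, x - x₀⟫ < u x := by
  have hmid : (1 / 2 : ℝ) • (x + x₀) ∈ Ω := by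
    have := hΩ hx hx₀ (by norm_num : (0 : ℝ) ≤ 1 / 2) (by norm_num : (0 : ℝ) ≤ 1 / 2) (by norm_num)
    rwa [← smul_add] at this
  have h1 := hp _ hmid
  have h2 : (1 / 2 : ℝ) • (x + x₀) - x₀ = (1 / 2 : ℝ) • (x - x₀) := by module
  rw [h2, inner_smul_right] at h1
  have h3 := huv _ hmid
  have h4 := huv x hx
  rcases hs with hs | hs <;> linarith [hs x hx hne]

lemma eqOn_of_isStrictConvexPt {n : ℕ} {Ω : Set (En n)} (hΩo : IsOpen Ω)
    {f : En n → ℝ} (hfm : Measurable f) {lam Lam : ℝ} (hlam : 0 < lam)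
    (hfb : ∀ x ∈ Ω, lam ≤ f x ∧ f x ≤ Lam)
    {u v : En n → ℝ} (hu : ConvexOn ℝ Ω u) (hv : ConvexOn ℝ Ω v)
    (huv : ∀ x ∈ Ω, v x ≤ u x)
    (hMu : ∀ s : Set (En n), s ⊆ Ω → MeasurableSet s →
      MAm Ω u s = ∫⁻ x in s, ENNReal.ofReal (f x))
    (hMv : ∀ s : Set (En n), s ⊆ Ω → MeasurableSet s →
      MAm Ω v s = ∫⁻ x in s, ENNReal.ofReal (f x))
    {x₀ : En n} (hx₀ : x₀ ∈ Ω) (heq : u x₀ = v x₀)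
    (hs : IsStrictConvexPt Ω u x₀ ∨ IsStrictConvexPt Ω v x₀) {y : En n} (hy : y ∈ Ω) :
    u y = v y := by
  have hseg : segment ℝ x₀ y ⊆ Ω := hu.1.segment_subset hx₀ hy
  have hsegc : IsCompact (segment ℝ x₀ y) := by
    rw [segment_eq_image_lineMap]
    exact isCompact_Icc.image (by fun_prop)
  obtain ⟨δ, hδ, hδΩ⟩ := hsegc.exists_cthickening_subset_open hΩo hseg
  set K := Metric.cthickening δ (segment ℝ x₀ y) with hK
  set D := Metric.thickening δ (segment ℝ x₀ y) with hD
  have hDo : IsOpen D := Metric.isOpen_thickening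
  have hDK : D ⊆ K := Metric.thickening_subset_cthickening _ _
  have hKc : IsCompact K := hsegc.cthickening
  have hx₀D : x₀ ∈ D := Metric.self_subset_thickening hδ _ (left_mem_segment ℝ x₀ y)
  have hyD : y ∈ D := Metric.self_subset_thickening hδ _ (right_mem_segment ℝ x₀ y)
  obtain ⟨U, Ru, hU, hUu, -⟩ := exists_isMA hu hΩo hDo hDK hδΩ hKc
    ((convex_segment _ _).cthickening δ) ⟨x₀, hDK hx₀D⟩ hMu
  obtain ⟨V, Rv, hV, hVv, hVsd⟩ := exists_isMA hv hΩo hDo hDK hδΩ hKc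
    ((convex_segment _ _).cthickening δ) ⟨x₀, hDK hx₀D⟩ hMv
  have hDΩ : D ⊆ Ω := hDK.trans hδΩ
  have hf : IsDensity D f lam Lam :=
    ⟨hDo, hfm, hlam, fun x hx => (hfb x (hDΩ hx)).1, fun x hx => (hfb x (hDΩ hx)).2⟩
  have hVU : ∀ x ∈ D, V x ≤ U x := fun x hx => by
    rw [hUu hx, hVv hx]; exact huv x (hDΩ hx)
  obtain ⟨p, hp⟩ := sd_nonempty hV.conv hV.lip x₀
  rw [← hVsd x₀ hx₀D] at hp
  obtain ⟨z, hz, hzv⟩ := exists_ball_contact hf hU hV hVU (p := p) hx₀D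
    (by rw [hUu hx₀D, hVv hx₀D, heq]) fun x hx hne => by
      rw [hUu hx₀D, hUu hx]
      exact add_inner_lt_of_isStrictConvexPt hu.1 huv hx₀ heq hp hs (hDΩ hx) hne
  have := eqOn_of_eventually_eq hf hU hV hVU ((convex_segment _ _).thickening δ)
    (hKc.isBounded.subset hDK) hz hzv y hyD
  rwa [hUu hyD, hVv hyD] at this

end Reduction

/-- Theorem 1.2 (Theorem `thm:smp 0`): the strong maximum principle for
`det D²u = det D²v = f` with `0 < λ ≤ f ≤ Λ`. -/
theorem statement_1 {n : ℕ} (Ω : Set (En n)) (hΩo : IsOpen Ω) (hΩc : IsConnected Ω)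
    (f : En n → ℝ) (hfm : Measurable f)
    (lam Lam : ℝ) (hlam : 0 < lam) (hLam : lam ≤ Lam)
    (hfb : ∀ x ∈ Ω, lam ≤ f x ∧ f x ≤ Lam)
    (u v : En n → ℝ) (hu : ConvexOn ℝ Ω u) (hv : ConvexOn ℝ Ω v)
    (huv : ∀ x ∈ Ω, v x ≤ u x)
    (hMu : ∀ s : Set (En n), s ⊆ Ω → MeasurableSet s →
      MAm Ω u s = ∫⁻ x in s, ENNReal.ofReal (f x))
    (hMv : ∀ s : Set (En n), s ⊆ Ω → MeasurableSet s →
      MAm Ω v s = ∫⁻ x in s, ENNReal.ofReal (f x))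
    (hne : ¬ (∀ x ∈ Ω, u x = v x)) :
    ∀ x ∈ Ω, u x = v x → x ∈ SigmaSet Ω u ∩ SigmaSet Ω v := by
  intro x hx hxe
  refine ⟨⟨hx, fun hs => hne fun y hy => ?_⟩, ⟨hx, fun hs => hne fun y hy => ?_⟩⟩
  · exact eqOn_of_isStrictConvexPt hΩo hfm hlam hfb hu hv huv hMu hMv hx hxe (Or.inl hs) hy
  · exact eqOn_of_isStrictConvexPt hΩo hfm hlam hfb hu hv huv hMu hMv hx hxe (Or.inr hs) hy
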